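/- Let Λ be a finite dimensional algebra over a field K. The assignment (M,P) ↦ D((M,P)†) is a bijection between the set of isomorphism classes of basic Gorenstein projective support τ-tilting pairs in mod Λ and the set of isomorphism classes of basic Gorenstein injective support τ⁻¹-tilting pairs in mod Λ. -/

import Mathlib

/-!  Common definitions: Gorenstein projective/injective modules, transpose,
Auslander–Reiten translation, τ-rigid and τ-tilting modules and pairs,
torsion pairs, etc., over a finite dimensional algebra.
Throughout, "mod Λ" is modelled by the category of finitely generated
(left) modules over a finite dimensional `K`-algebra `R`, and
"mod Λᵒᵖ" by finitely generated `Rᵐᵒᵖ`-modules. -/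

universe u

open Function MulOpposite

namespace GPTau

section Ring

variable (R : Type u) [Ring R]

/-- A submodule `N ≤ M` is superfluous (small) if `N ⊔ N' = ⊤` implies `N' = ⊤`. -/
def IsSuperfluous {M : Type u} [AddCommGroup M] [Module R M] (N : Submodule R M) : Prop :=
  ∀ N' : Submodule R M, N ⊔ N' = ⊤ → N' = ⊤

/-- `M` is Gorenstein projective: there is a doubly infinite exact sequence of
finitely generated projective modules which stays exact under `Hom(-, R)` and
such that `M ≅ Im (P₋₁ → P₀)`. -/
def IsGP (M : Type u) [AddCommGroup M] [Module R M] : Prop :=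
  ∃ (P : ℤ → Type u) (_ : ∀ n, AddCommGroup (P n)) (_ : ∀ n, Module R (P n))
    (d : ∀ n : ℤ, P n →ₗ[R] P (n + 1)),
    (∀ n, Module.Finite R (P n)) ∧
    (∀ n, Module.Projective R (P n)) ∧
    (∀ n, Function.Exact (d n) (d (n + 1))) ∧
    (∀ n, Function.Exact
      (fun g : P (n + 1 + 1) →ₗ[R] R => g.comp (d (n + 1)))
      (fun g : P (n + 1) →ₗ[R] R => g.comp (d n))) ∧
    Nonempty (M ≃ₗ[R] LinearMap.range (d (-1)))

/-- A linear map factors through a (finitely generated) projective module. -/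
def FactorsThroughProj {A B : Type u} [AddCommGroup A] [Module R A]
    [AddCommGroup B] [Module R B] (f : A →ₗ[R] B) : Prop :=
  ∃ (Q : Type u) (_ : AddCommGroup Q) (_ : Module R Q),
    Module.Projective R Q ∧ ∃ (a : A →ₗ[R] Q) (b : Q →ₗ[R] B), b.comp a = f

/-- Two maps are equal in the stable category (mod projectives). -/
def StEq {A B : Type u} [AddCommGroup A] [Module R A] [AddCommGroup B] [Module R B]
    (f g : A →ₗ[R] B) : Prop :=
  FactorsThroughProj R (f - g)

/-- An indecomposable module. -/
def IsIndec (M : Type u) [AddCommGroup M] [Module R M] : Prop :=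
  Nontrivial M ∧ ∀ N₁ N₂ : Submodule R M, IsCompl N₁ N₂ → N₁ = ⊥ ∨ N₂ = ⊥

/-- `|M| = k` : `M` decomposes into indecomposable direct summands having
exactly `k` isomorphism classes. -/
def NumIndec (M : Type u) [AddCommGroup M] [Module R M] (k : ℕ) : Prop :=
  ∃ (n : ℕ) (N : Fin n → Submodule R M),
    DirectSum.IsInternal N ∧ (∀ i, IsIndec R (N i)) ∧
    ∃ c : Fin n → Fin k, Surjective c ∧
      ∀ i j, (c i = c j ↔ Nonempty ((N i) ≃ₗ[R] (N j)))

/-- A basic module: it is a direct sum of pairwise nonisomorphic indecomposables. -/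
def IsBasic (M : Type u) [AddCommGroup M] [Module R M] : Prop :=
  ∃ (n : ℕ) (N : Fin n → Submodule R M),
    DirectSum.IsInternal N ∧ (∀ i, IsIndec R (N i)) ∧
    ∀ i j, i ≠ j → ¬ Nonempty ((N i) ≃ₗ[R] (N j))

/-- `M` has no nonzero projective direct summand. -/
def NoProjSummand (M : Type u) [AddCommGroup M] [Module R M] : Prop :=
  ∀ N₁ N₂ : Submodule R M, IsCompl N₁ N₂ → Module.Projective R N₁ → N₁ = ⊥

/-- `X` is a direct summand of `T`. -/
def IsDirectSummand (X T : Type u) [AddCommGroup X] [Module R X]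
    [AddCommGroup T] [Module R T] : Prop :=
  ∃ (i : X →ₗ[R] T) (p : T →ₗ[R] X), p.comp i = LinearMap.id

/-- `Ext¹(X, Y) = 0`: every short exact sequence `0 → Y → E → X → 0` splits. -/
def Ext1Vanishes (X Y : Type u) [AddCommGroup X] [Module R X]
    [AddCommGroup Y] [Module R Y] : Prop :=
  ∀ (E : Type u) [AddCommGroup E] [Module R E] (i : Y →ₗ[R] E) (p : E →ₗ[R] X),
    Injective i → Surjective p → Function.Exact i p →
    ∃ s : X →ₗ[R] E, p.comp s = LinearMap.id

/-- `X ∈ Fac G`: `X` is a quotient of a finite direct sum of copies of `G`. -/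
def FacOf (G X : Type u) [AddCommGroup G] [Module R G] [AddCommGroup X] [Module R X] : Prop :=
  ∃ (n : ℕ) (p : (Fin n → G) →ₗ[R] X), Surjective p

/-- `X ∈ Sub C`: `X` embeds into a finite direct sum of copies of `C`. -/
def SubOf (C X : Type u) [AddCommGroup C] [Module R C] [AddCommGroup X] [Module R X] : Prop :=
  ∃ (n : ℕ) (i : X →ₗ[R] (Fin n → C)), Injective i

/-- `X ∈ add G`: `X` is a direct summand of a finite direct sum of copies of `G`. -/
def InAdd (G X : Type u) [AddCommGroup G] [Module R G] [AddCommGroup X] [Module R X] : Prop :=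
  ∃ (n : ℕ) (i : X →ₗ[R] (Fin n → G)) (p : (Fin n → G) →ₗ[R] X), p.comp i = LinearMap.id

/-- The Jacobson radical of `R` (as a left ideal). -/
def JacobsonRad : Ideal R := (⊥ : Ideal R).jacobson

/-- The Jacobson radical squares to zero. -/
def RadSquareZero : Prop :=
  ∀ x y : R, x ∈ JacobsonRad R → y ∈ JacobsonRad R → x * y = 0

/-- A uniserial module: its submodules form a chain. -/
def IsUniserial (M : Type u) [AddCommGroup M] [Module R M] : Prop :=
  ∀ N₁ N₂ : Submodule R M, N₁ ≤ N₂ ∨ N₂ ≤ N₁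

/-- `R` has finite global dimension: there is `n` such that every finitely
generated module has a projective resolution vanishing in degrees `> n`. -/
def FiniteGlobalDimension : Prop :=
  ∃ n : ℕ, ∀ (M : Type u) [AddCommGroup M] [Module R M], Module.Finite R M →
    ∃ (P : ℕ → Type u) (_ : ∀ i, AddCommGroup (P i)) (_ : ∀ i, Module R (P i))
      (d : ∀ i : ℕ, P (i + 1) →ₗ[R] P i) (ε : P 0 →ₗ[R] M),
      (∀ i, Module.Projective R (P i)) ∧ Surjective ε ∧
      Function.Exact (d 0) ε ∧ (∀ i, Function.Exact (d (i + 1)) (d i)) ∧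
      (∀ i, n < i → Subsingleton (P i))

/-- The injective dimension of `R` as a module over itself is at most 1. -/
def SelfInjDimLE1 : Prop :=
  ∃ (I₀ I₁ : Type u) (_ : AddCommGroup I₀) (_ : Module R I₀)
    (_ : AddCommGroup I₁) (_ : Module R I₁),
    Module.Finite R I₀ ∧ Module.Finite R I₁ ∧
    Module.Injective R I₀ ∧ Module.Injective R I₁ ∧
    ∃ (i : R →ₗ[R] I₀) (p : I₀ →ₗ[R] I₁),
      Injective i ∧ Surjective p ∧ Function.Exact i p

end Ring

section Algebra

variable (R : Type u) [Ring R] (K : Type u) [Field K] [Algebra K R]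

/-- For an algebra over a field, the scalars of the base field commute with the
ring action on any compatible module. -/
instance (priority := 100) smulCommClass_of_tower (M : Type u) [AddCommGroup M]
    [Module R M] [Module K M] [IsScalarTower K R M] : SMulCommClass R K M :=
  ⟨fun r k m => by
    rw [← algebraMap_smul R k m, ← mul_smul, ← Algebra.commutes, mul_smul, algebraMap_smul]⟩

end Algebra

section OpDual

variable (R : Type u) [Ring R] (K : Type u) [Field K] [Algebra K R]
variable (M : Type u) [AddCommGroup M] [Module Rᵐᵒᵖ M] [Module K M]
  [IsScalarTower K Rᵐᵒᵖ M]

/-- The `K`-dual of a (finitely generated) `Rᵐᵒᵖ`-module, as an `R`-module: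
this is the duality `D : mod Λᵒᵖ → mod Λ`. -/
def OpDual (R : Type u) [Ring R] (K : Type u) [Field K] [Algebra K R]
    (M : Type u) [AddCommGroup M] [Module Rᵐᵒᵖ M] [Module K M]
    [IsScalarTower K Rᵐᵒᵖ M] : Type u := M →ₗ[K] K

instance : AddCommGroup (OpDual R K M) := inferInstanceAs (AddCommGroup (M →ₗ[K] K))

instance : Module K (OpDual R K M) := inferInstanceAs (Module K (M →ₗ[K] K))

/-- Scalar action `x ↦ op r • x` as a `K`-linear map. -/
def opSmulHom (r : R) : M →ₗ[K] M where
  toFun x := op r • x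
  map_add' x y := smul_add _ x y
  map_smul' k x := smul_comm (op r) k x

/-- Reinterpret an element of the dual as a linear functional. -/
def OpDual.toL (f : OpDual R K M) : M →ₗ[K] K := f

lemma OpDual.toL_injective :
    Function.Injective (OpDual.toL R K M) := fun _ _ h => h

instance : SMul R (OpDual R K M) :=
  ⟨fun r f => ((OpDual.toL R K M f).comp (opSmulHom R K M r) : M →ₗ[K] K)⟩

lemma OpDual.smul_toL (r : R) (f : OpDual R K M) (x : M) :
    OpDual.toL R K M (r • f) x = OpDual.toL R K M f (op r • x) := rfl

lemma OpDual.toL_add (f g : OpDual R K M) :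
    OpDual.toL R K M (f + g) = OpDual.toL R K M f + OpDual.toL R K M g := rfl

lemma OpDual.toL_zero : OpDual.toL R K M 0 = 0 := rfl

instance : Module R (OpDual R K M) where
  one_smul f := OpDual.toL_injective R K M <| LinearMap.ext fun x => by
    rw [OpDual.smul_toL, op_one, one_smul]
  mul_smul r s f := OpDual.toL_injective R K M <| LinearMap.ext fun x => by
    rw [OpDual.smul_toL, OpDual.smul_toL, OpDual.smul_toL, op_mul, mul_smul]
  smul_zero r := OpDual.toL_injective R K M <| LinearMap.ext fun x => by
    rw [OpDual.smul_toL, OpDual.toL_zero]; simp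
  smul_add r f g := OpDual.toL_injective R K M <| LinearMap.ext fun x => by
    rw [OpDual.smul_toL, OpDual.toL_add]
    simp only [LinearMap.add_apply, OpDual.toL_add]
    rw [OpDual.smul_toL, OpDual.smul_toL]
  add_smul r s f := OpDual.toL_injective R K M <| LinearMap.ext fun x => by
    rw [OpDual.smul_toL]
    simp only [OpDual.toL_add, LinearMap.add_apply]
    rw [OpDual.smul_toL, OpDual.smul_toL, op_add, add_smul, map_add]
  zero_smul f := OpDual.toL_injective R K M <| LinearMap.ext fun x => by
    rw [OpDual.smul_toL, OpDual.toL_zero, op_zero, zero_smul, map_zero]; rfl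

instance : IsScalarTower K R (OpDual R K M) :=
  ⟨fun k r f => OpDual.toL_injective R K M <| LinearMap.ext fun x => by
    have h1 : OpDual.toL R K M ((k • r) • f) x = OpDual.toL R K M f (op (k • r) • x) := rfl
    have h2 : OpDual.toL R K M (k • (r • f)) x = k • OpDual.toL R K M f (op r • x) := rfl
    rw [h1, h2, op_smul, smul_assoc, map_smul]⟩

end OpDual

section LDual

variable (R : Type u) [Ring R] (K : Type u) [Field K] [Algebra K R]
variable (M : Type u) [AddCommGroup M] [Module R M] [Module K M]
  [IsScalarTower K R M]

/-- The `K`-dual of a (finitely generated) `R`-module, as an `Rᵐᵒᵖ`-module: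
this is the duality `D : mod Λ → mod Λᵒᵖ`. -/
def LDual (R : Type u) [Ring R] (K : Type u) [Field K] [Algebra K R]
    (M : Type u) [AddCommGroup M] [Module R M] [Module K M]
    [IsScalarTower K R M] : Type u := M →ₗ[K] K

instance : AddCommGroup (LDual R K M) := inferInstanceAs (AddCommGroup (M →ₗ[K] K))

instance : Module K (LDual R K M) := inferInstanceAs (Module K (M →ₗ[K] K))

/-- Scalar action `x ↦ r • x` as a `K`-linear map. -/
def lSmulHom (r : R) : M →ₗ[K] M where
  toFun x := r • x
  map_add' x y := smul_add _ x y
  map_smul' k x := smul_comm r k x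

/-- Reinterpret an element of the dual as a linear functional. -/
def LDual.toL (f : LDual R K M) : M →ₗ[K] K := f

lemma LDual.toL_injective : Function.Injective (LDual.toL R K M) := fun _ _ h => h

instance : SMul Rᵐᵒᵖ (LDual R K M) :=
  ⟨fun s f => ((LDual.toL R K M f).comp (lSmulHom R K M (unop s)) : M →ₗ[K] K)⟩

lemma LDual.smul_toL (s : Rᵐᵒᵖ) (f : LDual R K M) (x : M) :
    LDual.toL R K M (s • f) x = LDual.toL R K M f (unop s • x) := rfl

lemma LDual.toL_add (f g : LDual R K M) :
    LDual.toL R K M (f + g) = LDual.toL R K M f + LDual.toL R K M g := rfl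

lemma LDual.toL_zero : LDual.toL R K M 0 = 0 := rfl

instance : Module Rᵐᵒᵖ (LDual R K M) where
  one_smul f := LDual.toL_injective R K M <| LinearMap.ext fun x => by
    rw [LDual.smul_toL, unop_one, one_smul]
  mul_smul s t f := LDual.toL_injective R K M <| LinearMap.ext fun x => by
    rw [LDual.smul_toL, LDual.smul_toL, LDual.smul_toL, unop_mul, mul_smul]
  smul_zero s := LDual.toL_injective R K M <| LinearMap.ext fun x => by
    rw [LDual.smul_toL, LDual.toL_zero]; simp
  smul_add s f g := LDual.toL_injective R K M <| LinearMap.ext fun x => by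
    rw [LDual.smul_toL, LDual.toL_add]
    simp only [LinearMap.add_apply, LDual.toL_add]
    rw [LDual.smul_toL, LDual.smul_toL]
  add_smul s t f := LDual.toL_injective R K M <| LinearMap.ext fun x => by
    rw [LDual.smul_toL]
    simp only [LDual.toL_add, LinearMap.add_apply]
    rw [LDual.smul_toL, LDual.smul_toL, unop_add, add_smul, map_add]
  zero_smul f := LDual.toL_injective R K M <| LinearMap.ext fun x => by
    rw [LDual.smul_toL, LDual.toL_zero, unop_zero, zero_smul, map_zero]; rfl

instance : IsScalarTower K Rᵐᵒᵖ (LDual R K M) :=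
  ⟨fun k s f => LDual.toL_injective R K M <| LinearMap.ext fun x => by
    have h1 : LDual.toL R K M ((k • s) • f) x = LDual.toL R K M f (unop (k • s) • x) := rfl
    have h2 : LDual.toL R K M (k • (s • f)) x = k • LDual.toL R K M f (unop s • x) := rfl
    rw [h1, h2, unop_smul, smul_assoc, map_smul]⟩

end LDual

section GI

variable (R : Type u) [Ring R] (K : Type u) [Field K] [Algebra K R]

/-- `M` is Gorenstein injective: there is a doubly infinite exact sequence of
finitely generated injective modules which stays exact under `Hom(DΛ, -)` and
such that `M ≅ Im (I₋₁ → I₀)`. Here `DΛ = OpDual R K R` is the `K`-dual of the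
regular module. -/
def IsGI (M : Type u) [AddCommGroup M] [Module R M] : Prop :=
  ∃ (I : ℤ → Type u) (_ : ∀ n, AddCommGroup (I n)) (_ : ∀ n, Module R (I n))
    (d : ∀ n : ℤ, I n →ₗ[R] I (n + 1)),
    (∀ n, Module.Finite R (I n)) ∧
    (∀ n, Module.Injective R (I n)) ∧
    (∀ n, Function.Exact (d n) (d (n + 1))) ∧
    (∀ n, Function.Exact
      (fun g : OpDual R K R →ₗ[R] I n => (d n).comp g)
      (fun g : OpDual R K R →ₗ[R] I (n + 1) => (d (n + 1)).comp g)) ∧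
    Nonempty (M ≃ₗ[R] LinearMap.range (d (-1)))

end GI



section MinPres

variable (R : Type u) [Ring R]

/-- A minimal projective presentation `P₁ → P₀ → M → 0`. -/
structure MinPres (M : Type u) [AddCommGroup M] [Module R M] : Type (u + 1) where
  P₁ : Type u
  P₀ : Type u
  [acg₁ : AddCommGroup P₁]
  [acg₀ : AddCommGroup P₀]
  [mod₁ : Module R P₁]
  [mod₀ : Module R P₀]
  fin₁ : Module.Finite R P₁
  fin₀ : Module.Finite R P₀
  proj₁ : Module.Projective R P₁
  proj₀ : Module.Projective R P₀
  d : P₁ →ₗ[R] P₀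
  p : P₀ →ₗ[R] M
  surj : Function.Surjective p
  exact : Function.Exact d p
  min₀ : IsSuperfluous R (LinearMap.ker p)
  min₁ : IsSuperfluous R (LinearMap.ker d)

attribute [instance] MinPres.acg₁ MinPres.acg₀ MinPres.mod₁ MinPres.mod₀

variable {R}
variable {M : Type u} [AddCommGroup M] [Module R M] (pr : MinPres R M)

/-- The map `Hom(P₀, R) → Hom(P₁, R)` dual to `d`, as a map of `Rᵐᵒᵖ`-modules. -/
def MinPres.dualMap : (pr.P₀ →ₗ[R] R) →ₗ[Rᵐᵒᵖ] (pr.P₁ →ₗ[R] R) where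
  toFun g := g.comp pr.d
  map_add' g h := by ext x; simp
  map_smul' s g := by ext x; simp

/-- The transpose `Tr M = Coker (Hom(P₀, R) → Hom(P₁, R))`, an `Rᵐᵒᵖ`-module. -/
def MinPres.Tr : Type u := (pr.P₁ →ₗ[R] R) ⧸ LinearMap.range pr.dualMap

instance : AddCommGroup pr.Tr :=
  inferInstanceAs (AddCommGroup ((pr.P₁ →ₗ[R] R) ⧸ LinearMap.range pr.dualMap))

instance : Module Rᵐᵒᵖ pr.Tr :=
  inferInstanceAs (Module Rᵐᵒᵖ ((pr.P₁ →ₗ[R] R) ⧸ LinearMap.range pr.dualMap))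

/-- The canonical projection onto the transpose. -/
def MinPres.toTr (h : pr.P₁ →ₗ[R] R) : pr.Tr :=
  Submodule.Quotient.mk (p := LinearMap.range pr.dualMap) h

section TauDef

variable (K : Type u) [Field K] [Algebra K R]

instance : Module K pr.Tr :=
  inferInstanceAs (Module K ((pr.P₁ →ₗ[R] R) ⧸ LinearMap.range pr.dualMap))

instance : IsScalarTower K Rᵐᵒᵖ pr.Tr :=
  inferInstanceAs
    (IsScalarTower K Rᵐᵒᵖ ((pr.P₁ →ₗ[R] R) ⧸ LinearMap.range pr.dualMap))

/-- The Auslander–Reiten translate `τM = D (Tr M)`, an `R`-module. -/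
def MinPres.tau : Type u := OpDual R K pr.Tr

instance : AddCommGroup (pr.tau K) := inferInstanceAs (AddCommGroup (OpDual R K pr.Tr))

instance : Module R (pr.tau K) := inferInstanceAs (Module R (OpDual R K pr.Tr))

instance : Module K (pr.tau K) := inferInstanceAs (Module K (OpDual R K pr.Tr))

instance : IsScalarTower K R (pr.tau K) :=
  inferInstanceAs (IsScalarTower K R (OpDual R K pr.Tr))

end TauDef

end MinPres

section Tau

variable (R : Type u) [Ring R] (K : Type u) [Field K] [Algebra K R]

/-- `M` is τ-rigid: `Hom(M, τM) = 0`. -/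
def IsTauRigid (M : Type u) [AddCommGroup M] [Module R M] : Prop :=
  ∀ pr : MinPres R M, ∀ f : M →ₗ[R] pr.tau K, f = 0

/-- `N ∈ ⊥(τM)`, i.e. `Hom(N, τM) = 0`. -/
def InPerpTau (M : Type u) [AddCommGroup M] [Module R M]
    (N : Type u) [AddCommGroup N] [Module R N] : Prop :=
  ∀ pr : MinPres R M, ∀ f : N →ₗ[R] pr.tau K, f = 0

/-- `M` is a τ-tilting module: τ-rigid with `|M| = |R|`. -/
def IsTauTilting (M : Type u) [AddCommGroup M] [Module R M] : Prop :=
  IsTauRigid R K M ∧ ∃ m l : ℕ, NumIndec R M m ∧ NumIndec R R l ∧ m = l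

/-- `M` is τ⁻¹-rigid: `Hom(τ⁻¹M, M) = 0`, where `τ⁻¹M = Tr (D M)`.
A homomorphism `τ⁻¹M → M` is an additive map compatible with the identification
`R ≅ Rᵐᵒᵖᵐᵒᵖ` of scalars. -/
def IsTauInvRigid (M : Type u) [AddCommGroup M] [Module R M] [Module K M]
    [IsScalarTower K R M] : Prop :=
  ∀ pr : MinPres Rᵐᵒᵖ (LDual R K M), ∀ f : pr.Tr →+ M,
    (∀ (r : R) (x : pr.Tr), f (op (op r) • x) = r • f x) → f = 0

/-- `M` is a τ⁻¹-tilting module. -/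
def IsTauInvTilting (M : Type u) [AddCommGroup M] [Module R M] [Module K M]
    [IsScalarTower K R M] : Prop :=
  IsTauInvRigid R K M ∧ ∃ m l : ℕ, NumIndec R M m ∧ NumIndec R R l ∧ m = l

end Tau

section Pairs

variable (K : Type u) [Field K] (R : Type u) [Ring R] [Algebra K R]

/-- A pair `(M, P)` of finitely generated modules (with compatible `K`-structure). -/
structure ModPair : Type (u + 1) where
  M : Type u
  [acgM : AddCommGroup M]
  [modM : Module R M]
  [modKM : Module K M]
  [towM : IsScalarTower K R M]
  finM : Module.Finite R M
  P : Type u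
  [acgP : AddCommGroup P]
  [modP : Module R P]
  [modKP : Module K P]
  [towP : IsScalarTower K R P]
  finP : Module.Finite R P

attribute [instance] ModPair.acgM ModPair.modM ModPair.modKM ModPair.towM
attribute [instance] ModPair.acgP ModPair.modP ModPair.modKP ModPair.towP

variable {K R}

/-- Isomorphism of pairs. -/
def ModPair.Iso (x y : ModPair K R) : Prop :=
  Nonempty (x.M ≃ₗ[R] y.M) ∧ Nonempty (x.P ≃ₗ[R] y.P)

variable (K R)

/-- The setoid of pairs satisfying a property `Q`, up to isomorphism. -/
def pairSetoid (Q : ModPair K R → Prop) : Setoid {x : ModPair K R // Q x} where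
  r a b := ModPair.Iso a.1 b.1
  iseqv := by
    constructor
    · exact fun a => ⟨⟨LinearEquiv.refl R a.1.M⟩, ⟨LinearEquiv.refl R a.1.P⟩⟩
    · rintro a b ⟨⟨e⟩, ⟨e'⟩⟩; exact ⟨⟨e.symm⟩, ⟨e'.symm⟩⟩
    · rintro a b c ⟨⟨e⟩, ⟨e'⟩⟩ ⟨⟨f⟩, ⟨f'⟩⟩; exact ⟨⟨e.trans f⟩, ⟨e'.trans f'⟩⟩

/-- `(M, P)` is a τ-rigid pair: `M` is τ-rigid, `P` is projective and `Hom(P, M) = 0`. -/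
def IsTauRigidPair (x : ModPair K R) : Prop :=
  IsTauRigid R K x.M ∧ Module.Projective R x.P ∧ ∀ f : x.P →ₗ[R] x.M, f = 0

/-- A Gorenstein projective τ-rigid pair. -/
def IsGPTauRigidPair (x : ModPair K R) : Prop :=
  IsTauRigidPair K R x ∧ IsGP R x.M

/-- A support τ-tilting pair: a τ-rigid pair with `|M| + |P| = |R|`. -/
def IsSuppTauTiltingPair (x : ModPair K R) : Prop :=
  IsTauRigidPair K R x ∧
    ∃ m p l : ℕ, NumIndec R x.M m ∧ NumIndec R x.P p ∧ NumIndec R R l ∧ m + p = l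

/-- A Gorenstein projective support τ-tilting pair. -/
def IsGPSuppTauTiltingPair (x : ModPair K R) : Prop :=
  IsSuppTauTiltingPair K R x ∧ IsGP R x.M

/-- `(I, N)` is a τ⁻¹-rigid pair; here `x.M = N` is the module and `x.P = I` is
injective, with `Hom(N, I) = 0`. -/
def IsTauInvRigidPair (x : ModPair K R) : Prop :=
  IsTauInvRigid R K x.M ∧ Module.Injective R x.P ∧ ∀ f : x.M →ₗ[R] x.P, f = 0

/-- A Gorenstein injective τ⁻¹-rigid pair. -/
def IsGITauInvRigidPair (x : ModPair K R) : Prop :=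
  IsTauInvRigidPair K R x ∧ IsGI R K x.M

/-- A support τ⁻¹-tilting pair: a τ⁻¹-rigid pair with `|N| + |I| = |R|`. -/
def IsSuppTauInvTiltingPair (x : ModPair K R) : Prop :=
  IsTauInvRigidPair K R x ∧
    ∃ m p l : ℕ, NumIndec R x.M m ∧ NumIndec R x.P p ∧ NumIndec R R l ∧ m + p = l

/-- A Gorenstein injective support τ⁻¹-tilting pair. -/
def IsGISuppTauInvTiltingPair (x : ModPair K R) : Prop :=
  IsSuppTauInvTiltingPair K R x ∧ IsGI R K x.M

/-- A basic pair. -/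
def IsBasicPair (x : ModPair K R) : Prop := IsBasic R x.M ∧ IsBasic R x.P

/-- `y` is (a representative of) the dagger `(M, P)† = (Tr M_np ⊕ P*, M_p*)` of `x`,
where `M = M_p ⊕ M_np` with `M_p` a maximal projective direct summand. -/
def IsDaggerOf (x : ModPair K R) (y : ModPair K Rᵐᵒᵖ) : Prop :=
  ∃ Mp Mnp : Submodule R x.M, IsCompl Mp Mnp ∧ Module.Projective R Mp ∧
    NoProjSummand R Mnp ∧
    ∃ pr : MinPres R Mnp,
      Nonempty (y.M ≃ₗ[Rᵐᵒᵖ] (pr.Tr × (x.P →ₗ[R] R))) ∧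
      Nonempty (y.P ≃ₗ[Rᵐᵒᵖ] (Mp →ₗ[R] R))

/-- `y` is (a representative of) `D((M, P)†)`, the Gorenstein injective pair
`(D(M_p*), D(Tr M_np ⊕ P*))` associated to `x`; in our convention `y.M` is the
τ⁻¹-rigid module `D(Tr M_np ⊕ P*)` and `y.P` is the injective module `D(M_p*)`. -/
def IsDDaggerOf (x : ModPair K R) (y : ModPair K R) : Prop :=
  ∃ z : ModPair K Rᵐᵒᵖ, IsDaggerOf K R x z ∧
    Nonempty (y.M ≃ₗ[R] OpDual R K z.M) ∧ Nonempty (y.P ≃ₗ[R] OpDual R K z.P)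

end Pairs

section Support

variable (R : Type u) [Ring R] (K : Type u) [Field K] [Algebra K R]

/-- `φ : R →+* S` realizes `S` as the quotient of `R` by the two-sided ideal
generated by `e` (universal property). -/
def IsQuotientByIdem (e : R) (S : Type u) [Ring S] (φ : R →+* S) : Prop :=
  Function.Surjective φ ∧ φ e = 0 ∧
    ∀ (S' : Type u) (_ : Ring S') (ψ : R →+* S'), ψ e = 0 → ∃ χ : S →+* S', χ.comp φ = ψ

/-- `M` is a support τ-tilting module: `M` is a τ-tilting module over `Λ/(e)` for
some idempotent `e`. -/
def IsSuppTauTilting (M : Type u) [AddCommGroup M] [Module R M] : Prop :=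
  ∃ e : R, IsIdempotentElem e ∧
    ∃ (S : Type u) (_ : Ring S) (_ : Algebra K S) (φ : R →+* S),
      (∀ k : K, φ (algebraMap K R k) = algebraMap K S k) ∧
      IsQuotientByIdem R e S φ ∧
      ∃ _ : Module S M, (∀ (r : R) (m : M), φ r • m = r • m) ∧ IsTauTilting S K M

/-- `M` is a support τ⁻¹-tilting module: `M` is a τ⁻¹-tilting module over `Λ/(e)`
for some idempotent `e`. -/
def IsSuppTauInvTilting (M : Type u) [AddCommGroup M] [Module R M] [Module K M] : Prop :=
  ∃ e : R, IsIdempotentElem e ∧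
    ∃ (S : Type u) (_ : Ring S) (_ : Algebra K S) (φ : R →+* S),
      (∀ k : K, φ (algebraMap K R k) = algebraMap K S k) ∧
      IsQuotientByIdem R e S φ ∧
      ∃ _ : Module S M, (∀ (r : R) (m : M), φ r • m = r • m) ∧
        ∃ _ : IsScalarTower K S M, IsTauInvTilting S K M

end Support

section Torsion

variable (R : Type u) [Ring R]

/-- A class of modules is closed under isomorphism. -/
def RespectsIso (T : ModuleCat.{u} R → Prop) : Prop :=
  ∀ X Y : ModuleCat.{u} R, Nonempty (X ≃ₗ[R] Y) → T X → T Y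

/-- `(T, F)` is a torsion pair in the category of finitely generated `R`-modules. -/
def IsTorsionPair (T F : ModuleCat.{u} R → Prop) : Prop :=
  RespectsIso R T ∧ RespectsIso R F ∧
  (∀ X, T X → Module.Finite R X) ∧ (∀ X, F X → Module.Finite R X) ∧
  (∀ X Y : ModuleCat.{u} R, T X → F Y → ∀ f : X →ₗ[R] Y, f = 0) ∧
  (∀ X : ModuleCat.{u} R, Module.Finite R X →
    ∃ t : Submodule R X, T (ModuleCat.of R t) ∧ F (ModuleCat.of R (X ⧸ t)))

/-- `T` is covariantly finite: every finitely generated module admits a left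
`T`-approximation. -/
def CovariantlyFinite (T : ModuleCat.{u} R → Prop) : Prop :=
  ∀ X : ModuleCat.{u} R, Module.Finite R X →
    ∃ (M : ModuleCat.{u} R) (f : X →ₗ[R] M), T M ∧
      ∀ (M' : ModuleCat.{u} R) (g : X →ₗ[R] M'), T M' → ∃ h : M →ₗ[R] M', h.comp f = g

/-- `T` is contravariantly finite: every finitely generated module admits a right
`T`-approximation. -/
def ContravariantlyFinite (T : ModuleCat.{u} R → Prop) : Prop :=
  ∀ X : ModuleCat.{u} R, Module.Finite R X →
    ∃ (M : ModuleCat.{u} R) (f : M →ₗ[R] X), T M ∧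
      ∀ (M' : ModuleCat.{u} R) (g : M' →ₗ[R] X), T M' → ∃ h : M' →ₗ[R] M, f.comp h = g

/-- A functorially finite class. -/
def FunctoriallyFinite (T : ModuleCat.{u} R → Prop) : Prop :=
  CovariantlyFinite R T ∧ ContravariantlyFinite R T

/-- `G` is the basic Ext-projective generator of the torsion class `T`:
`G ∈ T` is basic, Ext-projective in `T`, `T = Fac G`, and every Ext-projective
module in `T` lies in `add G`. -/
def IsBasicExtProjGen (T : ModuleCat.{u} R → Prop) (G : ModuleCat.{u} R) : Prop :=
  T G ∧ IsBasic R G ∧ (∀ X : ModuleCat.{u} R, T X → Ext1Vanishes R G X) ∧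
  (∀ X : ModuleCat.{u} R, T X ↔ (Module.Finite R X ∧ FacOf R G X)) ∧
  (∀ X : ModuleCat.{u} R, T X → (∀ Y : ModuleCat.{u} R, T Y → Ext1Vanishes R X Y) →
    InAdd R G X)

/-- `C` is the basic Ext-injective cogenerator of the torsion-free class `F`:
`C ∈ F` is basic, Ext-injective in `F`, `F = Sub C`, and every Ext-injective
module in `F` lies in `add C`. -/
def IsBasicExtInjCogen (F : ModuleCat.{u} R → Prop) (C : ModuleCat.{u} R) : Prop :=
  F C ∧ IsBasic R C ∧ (∀ X : ModuleCat.{u} R, F X → Ext1Vanishes R X C) ∧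
  (∀ X : ModuleCat.{u} R, F X ↔ (Module.Finite R X ∧ SubOf R C X)) ∧
  (∀ X : ModuleCat.{u} R, F X → (∀ Y : ModuleCat.{u} R, F Y → Ext1Vanishes R Y X) →
    InAdd R C X)

variable (K : Type u) [Field K] [Algebra K R]

/-- A (functorially finite) Gorenstein torsion pair: the basic Ext-projective
generator of `T` is Gorenstein projective. -/
def IsGorensteinTP (T F : ModuleCat.{u} R → Prop) : Prop :=
  IsTorsionPair R T F ∧ FunctoriallyFinite R T ∧
    ∀ G : ModuleCat.{u} R, IsBasicExtProjGen R T G → IsGP R G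

/-- A trivial torsion pair: the basic Ext-projective generator of `T` is projective. -/
def IsTrivialTP (T F : ModuleCat.{u} R → Prop) : Prop :=
  IsTorsionPair R T F ∧ FunctoriallyFinite R T ∧
    ∀ G : ModuleCat.{u} R, IsBasicExtProjGen R T G → Module.Projective R G

end Torsion

section Misc

variable (R : Type u) [Ring R] (K : Type u) [Field K] [Algebra K R]

/-- A projective cover `π : P → M`. -/
structure ProjCover (M : Type u) [AddCommGroup M] [Module R M] : Type (u + 1) where
  P : Type u
  [acg : AddCommGroup P]
  [mod : Module R P]
  fin : Module.Finite R P
  proj : Module.Projective R P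
  π : P →ₗ[R] M
  surj : Function.Surjective π
  min : IsSuperfluous R (LinearMap.ker π)

attribute [instance] ProjCover.acg ProjCover.mod

/-- The canonical evaluation map `M → M** = Hom_{Rᵐᵒᵖ}(Hom_R(M, R), Rᵐᵒᵖ)`. -/
def bidualEval (M : Type u) [AddCommGroup M] [Module R M] (m : M) :
    (M →ₗ[R] R) →ₗ[Rᵐᵒᵖ] Rᵐᵒᵖ where
  toFun f := op (f m)
  map_add' f g := by simp
  map_smul' s f := rfl

/-- `R` is CM-τ-tilting finite: up to isomorphism there are only finitely many
indecomposable Gorenstein projective τ-rigid modules. -/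
def CMTauTiltingFinite : Prop :=
  ∃ (n : ℕ) (V : Fin n → ModuleCat.{u} R),
    ∀ (M : Type u) [AddCommGroup M] [Module R M], Module.Finite R M →
      IsIndec R M → IsGP R M → IsTauRigid R K M → ∃ i, Nonempty (M ≃ₗ[R] V i)

/-- `R` is CM-finite: up to isomorphism there are only finitely many
indecomposable Gorenstein projective modules. -/
def CMFinite : Prop :=
  ∃ (n : ℕ) (V : Fin n → ModuleCat.{u} R),
    ∀ (M : Type u) [AddCommGroup M] [Module R M], Module.Finite R M →
      IsIndec R M → IsGP R M → ∃ i, Nonempty (M ≃ₗ[R] V i)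

/-- `T` is the Bongartz completion of the τ-rigid module `M`: the basic
Ext-projective generator of `⊥(τM)`, with `⊥(τM) = Fac T`. -/
def IsBongartzCompletion (M : Type u) [AddCommGroup M] [Module R M]
    (T : Type u) [AddCommGroup T] [Module R T] : Prop :=
  Module.Finite R T ∧ IsBasic R T ∧ InPerpTau R K M T ∧
  (∀ (X : Type u) [AddCommGroup X] [Module R X], Module.Finite R X →
    InPerpTau R K M X → Ext1Vanishes R T X) ∧
  (∀ (X : Type u) [AddCommGroup X] [Module R X], Module.Finite R X →
    (InPerpTau R K M X ↔ FacOf R T X))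

end Misc

section Superfluous

variable {R : Type u} [Ring R] {M N : Type u} [AddCommGroup M] [Module R M]
  [AddCommGroup N] [Module R N]

lemma IsSuperfluous.sup {U V : Submodule R M} (hU : IsSuperfluous R U)
    (hV : IsSuperfluous R V) : IsSuperfluous R (U ⊔ V) := fun W h =>
  hV W (hU _ (by rw [← sup_assoc]; exact h))

lemma IsSuperfluous.mono {U V : Submodule R M} (hU : IsSuperfluous R U) (h : V ≤ U) :
    IsSuperfluous R V := fun W hW => hU W (top_le_iff.mp (hW ▸ sup_le_sup_right h W))

lemma IsSuperfluous.map {U : Submodule R M} (hU : IsSuperfluous R U) (f : M →ₗ[R] N) :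
    IsSuperfluous R (U.map f) := by
  intro W hW
  have key : U ⊔ W.comap f = ⊤ := by
    refine eq_top_iff.mpr fun m _ => ?_
    obtain ⟨_, ⟨x, hx, rfl⟩, w, hw, h⟩ := Submodule.mem_sup.mp (hW ▸ Submodule.mem_top : f m ∈ _)
    refine Submodule.mem_sup.mpr ⟨x, hx, m - x, ?_, by abel⟩
    rw [Submodule.mem_comap, map_sub, ← h, add_sub_cancel_left]
    exact hw
  have htop := hU _ key
  have hle : U.map f ≤ W := Submodule.map_le_iff_le_comap.mpr (htop ▸ le_top)
  rwa [sup_eq_right.mpr hle] at hW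

lemma IsSuperfluous.prod {U : Submodule R M} {V : Submodule R N} (hU : IsSuperfluous R U)
    (hV : IsSuperfluous R V) : IsSuperfluous R (U.prod V) := by
  refine ((hU.map (LinearMap.inl R M N)).sup (hV.map (LinearMap.inr R M N))).mono ?_
  rintro ⟨x, y⟩ ⟨hx, hy⟩
  exact Submodule.mem_sup.mpr ⟨(x, 0), ⟨x, hx, rfl⟩, (0, y), ⟨y, hy, rfl⟩, by simp⟩

lemma isSuperfluous_bot : IsSuperfluous R (⊥ : Submodule R M) := fun W h => by
  rwa [bot_sup_eq] at h

/-- The kernel of `f` is superfluous iff its image under an isomorphism is. -/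
lemma IsSuperfluous.ker_comp_equiv {X : Type u} [AddCommGroup X] [Module R X] {f : M →ₗ[R] X}
    (h : IsSuperfluous R (LinearMap.ker f)) (e : N ≃ₗ[R] M) :
    IsSuperfluous R (LinearMap.ker (f ∘ₗ e.toLinearMap)) := by
  refine (h.map e.symm.toLinearMap).mono fun x hx => ⟨e x, hx, by simp⟩

lemma surjective_of_comp_surjective {X : Type u} [AddCommGroup X] [Module R X]
    {g : N →ₗ[R] X} (hg : IsSuperfluous R (LinearMap.ker g)) (h : M →ₗ[R] N)
    (hs : ∀ n, ∃ m, g (h m) = g n) : Surjective h := by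
  refine LinearMap.range_eq_top.mp (hg _ (eq_top_iff.mpr fun n _ => ?_))
  obtain ⟨m, hm⟩ := hs n
  exact Submodule.mem_sup.mpr ⟨n - h m, by simp [hm], h m, ⟨m, rfl⟩, by abel⟩

lemma bijective_of_surjective_of_surjective [IsNoetherian R M] {f : M →ₗ[R] N} {g : N →ₗ[R] M}
    (hf : Surjective f) (hg : Surjective g) : Bijective f := by
  refine ⟨?_, hf⟩
  have := IsNoetherian.injective_of_surjective_endomorphism (g ∘ₗ f) (hg.comp hf)
  exact Injective.of_comp this

/-- A map out of a projective module of finite length splits off a direct summand contained in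
its kernel so that the kernel of what is left is superfluous. -/
lemma exists_isCompl_superfluous_ker [IsNoetherian R M] [IsArtinian R M] [Module.Projective R M]
    {X : Type u} [AddCommGroup X] [Module R X] (f : M →ₗ[R] X) :
    ∃ A P : Submodule R M, IsCompl A P ∧ P ≤ LinearMap.ker f ∧
      IsSuperfluous R (LinearMap.ker (f.domRestrict A)) := by
  obtain ⟨A, ⟨P, hAP, hP⟩, hmin⟩ := IsArtinian.set_has_minimal
    {A : Submodule R M | ∃ P, IsCompl A P ∧ P ≤ LinearMap.ker f} ⟨⊤, ⊥, isCompl_top_bot, bot_le⟩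
  refine ⟨A, P, hAP, hP, fun W hW => ?_⟩
  set g := f.domRestrict A
  have hproj : Module.Projective R A := by
    refine Module.Projective.of_split A.subtype (A.projectionOnto P hAP) ?_
    ext x; simp
  have hsurj : Surjective (g.rangeRestrict ∘ₗ W.subtype) := by
    rintro ⟨_, a, rfl⟩
    obtain ⟨k, hk, w, hw, rfl⟩ := Submodule.mem_sup.mp (hW ▸ Submodule.mem_top : a ∈ _)
    refine ⟨⟨w, hw⟩, Subtype.ext ?_⟩
    have : g k = 0 := hk
    simp [this]
  obtain ⟨h, hh⟩ := Module.projective_lifting_property _ g.rangeRestrict hsurj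
  let k : A →ₗ[R] A := W.subtype ∘ₗ h
  have hk : ∀ a, g (k a) = g a := fun a => congrArg Subtype.val (LinearMap.congr_fun hh a)
  have hkn : ∀ n a, g ((k ^ n) a) = g a := by
    intro n
    induction n with
    | zero => intro a; rfl
    | succ n ih => intro a; rw [pow_succ', Module.End.mul_apply, hk, ih]
  obtain ⟨n, hn, hn1⟩ := ((LinearMap.eventually_isCompl_ker_pow_range_pow k).and
    (Filter.eventually_ge_atTop 1)).exists
  set U := LinearMap.range (k ^ n)
  set V := LinearMap.ker (k ^ n)
  have hcompl : IsCompl (U.map A.subtype) (V.map A.subtype ⊔ P) := by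
    have h1 : U.map A.subtype ⊔ V.map A.subtype = A := by
      rw [← Submodule.map_sup, hn.symm.sup_eq_top, Submodule.map_top, Submodule.range_subtype]
    refine ⟨Disjoint.disjoint_sup_right_of_disjoint_sup_left ?_ (h1.symm ▸ hAP.disjoint), ?_⟩
    · exact (Submodule.disjoint_map A.subtype_injective hn.symm.disjoint)
    · rw [codisjoint_iff, ← sup_assoc, h1, hAP.sup_eq_top]
  have hker : V.map A.subtype ⊔ P ≤ LinearMap.ker f := by
    refine sup_le ?_ hP
    rintro _ ⟨a, ha, rfl⟩
    have h0 : (k ^ n) a = 0 := ha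
    have := hkn n a
    rw [h0, map_zero] at this
    exact this.symm
  have hle : U.map A.subtype ≤ A := Submodule.map_subtype_le _ _
  have heq : U.map A.subtype = A := by
    by_contra hne
    exact hmin _ ⟨_, hcompl, hker⟩ (lt_of_le_of_ne hle hne)
  have hU : U = ⊤ := by
    apply Submodule.map_injective_of_injective A.subtype_injective
    rw [heq, Submodule.map_top, Submodule.range_subtype]
  refine eq_top_iff.mpr fun a _ => ?_
  obtain ⟨b, rfl⟩ := (hU ▸ Submodule.mem_top : a ∈ U)
  obtain ⟨m, rfl⟩ := Nat.exists_eq_add_of_le hn1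
  rw [add_comm, pow_succ', Module.End.mul_apply]
  exact (h ((k ^ m) b)).2

lemma projective_of_isCompl [Module.Projective R M] {A P : Submodule R M} (h : IsCompl A P) :
    Module.Projective R A := by
  refine Module.Projective.of_split A.subtype (A.projectionOnto P h) ?_
  ext x; simp

lemma exists_projCover [IsArtinianRing R] [Module.Finite R M] : Nonempty (ProjCover R M) := by
  obtain ⟨n, f, hf⟩ := Module.Finite.exists_fin' R M
  obtain ⟨A, P, hAP, hP, hA⟩ := exists_isCompl_superfluous_ker f
  exact ⟨{ P := A
           fin := inferInstance
           proj := projective_of_isCompl hAP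
           π := f.domRestrict A
           surj := fun x => by
             obtain ⟨v, rfl⟩ := hf x
             obtain ⟨a, ha, p, hp, rfl⟩ :=
               Submodule.mem_sup.mp (hAP.sup_eq_top ▸ Submodule.mem_top : v ∈ _)
             have : f p = 0 := hP hp
             exact ⟨⟨a, ha⟩, by simp [this]⟩
           min := hA }⟩

lemma exists_minPres [IsArtinianRing R] [Module.Finite R M] : Nonempty (MinPres R M) := by
  obtain ⟨c₀⟩ := exists_projCover (R := R) (M := M)
  have := c₀.fin
  obtain ⟨c₁⟩ := exists_projCover (R := R) (M := LinearMap.ker c₀.π)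
  have hd : LinearMap.range ((LinearMap.ker c₀.π).subtype ∘ₗ c₁.π) = LinearMap.ker c₀.π := by
    rw [LinearMap.range_comp, LinearMap.range_eq_top.mpr c₁.surj, Submodule.map_top,
      Submodule.range_subtype]
  exact ⟨{ P₁ := c₁.P
           P₀ := c₀.P
           fin₁ := c₁.fin
           fin₀ := c₀.fin
           proj₁ := c₁.proj
           proj₀ := c₀.proj
           d := (LinearMap.ker c₀.π).subtype ∘ₗ c₁.π
           p := c₀.π
           surj := c₀.surj
           exact := LinearMap.exact_iff.mpr hd.symm
           min₀ := c₀.min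
           min₁ := by
             rw [LinearMap.ker_comp_of_ker_eq_bot _ (Submodule.ker_subtype _)]
             exact c₁.min }⟩

/-- Projective covers of isomorphic modules are isomorphic. -/
lemma exists_equiv_of_cover {A B X Y : Type u} [AddCommGroup A] [Module R A] [AddCommGroup B]
    [Module R B] [AddCommGroup X] [Module R X] [AddCommGroup Y] [Module R Y]
    [IsNoetherian R A] [Module.Projective R A] [Module.Projective R B]
    {f : A →ₗ[R] X} {g : B →ₗ[R] Y} (hf : Surjective f) (hg : Surjective g)
    (hf' : IsSuperfluous R (LinearMap.ker f)) (hg' : IsSuperfluous R (LinearMap.ker g))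
    (e : X ≃ₗ[R] Y) : ∃ α : A ≃ₗ[R] B, ∀ a, g (α a) = e (f a) := by
  obtain ⟨h, hh⟩ := Module.projective_lifting_property g (e.toLinearMap ∘ₗ f) hg
  obtain ⟨k, hk⟩ := Module.projective_lifting_property f (e.symm.toLinearMap ∘ₗ g) hf
  have hh' : ∀ a, g (h a) = e (f a) := LinearMap.congr_fun hh
  have hk' : ∀ b, f (k b) = e.symm (g b) := LinearMap.congr_fun hk
  have h1 : Surjective h := surjective_of_comp_surjective hg' h fun n => by
    obtain ⟨a, ha⟩ := hf (e.symm (g n))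
    exact ⟨a, by simp [hh', ha]⟩
  have h2 : Surjective k := surjective_of_comp_surjective hf' k fun n => by
    obtain ⟨b, hb⟩ := hg (e (f n))
    exact ⟨b, by simp [hk', hb]⟩
  exact ⟨LinearEquiv.ofBijective h (bijective_of_surjective_of_surjective h1 h2), hh'⟩

/-- Minimal presentations of isomorphic modules are isomorphic. -/
lemma MinPres.exists_equiv [IsArtinianRing R] (pr : MinPres R M) (pr' : MinPres R N)
    (e : M ≃ₗ[R] N) : ∃ (α : pr.P₁ ≃ₗ[R] pr'.P₁) (β : pr.P₀ ≃ₗ[R] pr'.P₀),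
      ∀ a, pr'.d (α a) = β (pr.d a) := by
  have := pr.fin₀
  have := pr.fin₁
  have := pr.proj₀
  have := pr.proj₁
  have := pr'.proj₀
  have := pr'.proj₁
  obtain ⟨β, hβ⟩ := exists_equiv_of_cover pr.surj pr'.surj pr.min₀ pr'.min₀ e
  have hr : LinearMap.ker pr'.p = (LinearMap.ker pr.p).map β.toLinearMap := by
    ext y
    constructor
    · intro hy
      refine ⟨β.symm y, ?_, by simp⟩
      have : e (pr.p (β.symm y)) = 0 := by rw [← hβ]; simpa using hy
      simpa using this
    · rintro ⟨x, hx, rfl⟩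
      have hx' : pr.p x = 0 := hx
      simp [hβ, hx']
  rw [LinearMap.exact_iff.mp pr.exact, LinearMap.exact_iff.mp pr'.exact] at hr
  obtain ⟨α, hα⟩ := exists_equiv_of_cover pr.d.surjective_rangeRestrict
    pr'.d.surjective_rangeRestrict (by rw [LinearMap.ker_rangeRestrict]; exact pr.min₁)
    (by rw [LinearMap.ker_rangeRestrict]; exact pr'.min₁)
    ((β.submoduleMap _).trans (LinearEquiv.ofEq _ _ hr.symm))
  exact ⟨α, β, fun a => congrArg Subtype.val (hα a)⟩

end Superfluous

/-- A perfect pairing between an `R`-module `A` and an `S`-module `A'`, with values in a group `T`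
on which both rings act: it identifies `A'` with `Hom_R(A, T)` and `A` with `Hom_S(A', T)`. -/
structure DualPair (R S T A A' : Type u) [Ring R] [Ring S] [AddCommGroup T] [Module R T]
    [Module S T] [AddCommGroup A] [Module R A] [AddCommGroup A'] [Module S A'] : Type u where
  b : A → A' → T
  add_left : ∀ x y a', b (x + y) a' = b x a' + b y a'
  add_right : ∀ a x y, b a (x + y) = b a x + b a y
  smul_left : ∀ (r : R) a a', b (r • a) a' = r • b a a'
  smul_right : ∀ (s : S) a a', b a (s • a') = s • b a a'
  exists_right : ∀ φ : A →ₗ[R] T, ∃ a', ∀ a, b a a' = φ a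
  exists_left : ∀ ψ : A' →ₗ[S] T, ∃ a, ∀ a', b a a' = ψ a'
  ext_right : ∀ a', (∀ a, b a a' = 0) → a' = 0
  ext_left : ∀ a, (∀ a', b a a' = 0) → a = 0

namespace DualPair

variable {R S T : Type u} [Ring R] [Ring S] [AddCommGroup T] [Module R T] [Module S T]
variable {A A' : Type u} [AddCommGroup A] [Module R A] [AddCommGroup A'] [Module S A']
variable {B B' : Type u} [AddCommGroup B] [Module R B] [AddCommGroup B'] [Module S B']
variable {C C' : Type u} [AddCommGroup C] [Module R C] [AddCommGroup C'] [Module S C']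

/-- Exchange the two sides of a perfect pairing. -/
def symm (p : DualPair R S T A A') : DualPair S R T A' A where
  b a' a := p.b a a'
  add_left x y a := p.add_right a x y
  add_right a' x y := p.add_left x y a'
  smul_left s a' a := p.smul_right s a a'
  smul_right r a' a := p.smul_left r a a'
  exists_right := p.exists_left
  exists_left := p.exists_right
  ext_right := p.ext_left
  ext_left := p.ext_right

variable (p : DualPair R S T A A') (q : DualPair R S T B B') (s : DualPair R S T C C')

/-- The pairing as a linear map in the first variable. -/
def left (a' : A') : A →ₗ[R] T where
  toFun a := p.b a a'
  map_add' x y := p.add_left x y a'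
  map_smul' r x := p.smul_left r x a'

@[simp] lemma left_apply (a' : A') (a : A) : p.left a' a = p.b a a' := rfl

/-- The pairing as a linear map in the second variable. -/
def right (a : A) : A' →ₗ[S] T := p.symm.left a

@[simp] lemma right_apply (a' : A') (a : A) : p.right a a' = p.b a a' := rfl

lemma zero_left (a' : A') : p.b 0 a' = 0 := (p.left a').map_zero
lemma zero_right (a : A) : p.b a 0 = 0 := (p.right a).map_zero
lemma sub_left (x y : A) (a' : A') : p.b (x - y) a' = p.b x a' - p.b y a' := (p.left a').map_sub x y
lemma sub_right (a : A) (x y : A') : p.b a (x - y) = p.b a x - p.b a y := (p.right a).map_sub x y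

lemma eq_right {x y : A'} (h : ∀ a, p.b a x = p.b a y) : x = y :=
  sub_eq_zero.mp (p.ext_right _ fun a => by rw [p.sub_right, h, sub_self])

lemma eq_left {x y : A} (h : ∀ a', p.b x a' = p.b y a') : x = y := p.symm.eq_right h

/-- `f'` is the transpose of `f`. -/
def IsTr (f : A →ₗ[R] B) (f' : B' →ₗ[S] A') : Prop := ∀ a b', q.b (f a) b' = p.b a (f' b')

variable {p q s}

lemma IsTr.symm {f : A →ₗ[R] B} {f' : B' →ₗ[S] A'} (h : p.IsTr q f f') :
    q.symm.IsTr p.symm f' f := fun b' a => (h a b').symm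

variable (p q) in
lemma exists_isTr (f : A →ₗ[R] B) : ∃ f', p.IsTr q f f' := by
  choose g hg using fun b' => p.exists_right (q.left b' ∘ₗ f)
  exact ⟨{ toFun := g
           map_add' := fun x y => p.eq_right fun a => by
             simp only [p.add_right, hg, LinearMap.comp_apply, left_apply, q.add_right]
           map_smul' := fun r x => p.eq_right fun a => by
             simp only [p.smul_right, hg, LinearMap.comp_apply, left_apply, q.smul_right,
               RingHom.id_apply] }, fun a b' => (hg b' a).symm⟩

variable (p q) in
lemma exists_isTr' (f' : B' →ₗ[S] A') : ∃ f, p.IsTr q f f' := by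
  obtain ⟨f, hf⟩ := exists_isTr q.symm p.symm f'
  exact ⟨f, hf.symm⟩

lemma IsTr.unique {f : A →ₗ[R] B} {f' f'' : B' →ₗ[S] A'} (h : p.IsTr q f f')
    (h' : p.IsTr q f f'') : f' = f'' :=
  LinearMap.ext fun b' => p.eq_right fun a => by rw [← h, ← h']

lemma IsTr.unique' {f g : A →ₗ[R] B} {f' : B' →ₗ[S] A'} (h : p.IsTr q f f')
    (h' : p.IsTr q g f') : f = g :=
  LinearMap.ext fun a => q.eq_left fun b' => by rw [h, h']

lemma IsTr.comp {f : A →ₗ[R] B} {f' : B' →ₗ[S] A'} {g : B →ₗ[R] C} {g' : C' →ₗ[S] B'}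
    (hg : q.IsTr s g g') (hf : p.IsTr q f f') : p.IsTr s (g ∘ₗ f) (f' ∘ₗ g') := fun a c' => by
  rw [LinearMap.comp_apply, hg, hf, LinearMap.comp_apply]

lemma IsTr.add {f g : A →ₗ[R] B} {f' g' : B' →ₗ[S] A'} (hf : p.IsTr q f f')
    (hg : p.IsTr q g g') : p.IsTr q (f + g) (f' + g') := fun a b' => by
  rw [LinearMap.add_apply, LinearMap.add_apply, q.add_left, p.add_right, hf, hg]

lemma IsTr.sub {f g : A →ₗ[R] B} {f' g' : B' →ₗ[S] A'} (hf : p.IsTr q f f')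
    (hg : p.IsTr q g g') : p.IsTr q (f - g) (f' - g') := fun a b' => by
  rw [LinearMap.sub_apply, LinearMap.sub_apply, q.sub_left, p.sub_right, hf, hg]

lemma isTr_id : p.IsTr p LinearMap.id LinearMap.id := fun _ _ => rfl

lemma isTr_zero : p.IsTr q 0 0 := fun _ _ => by
  rw [LinearMap.zero_apply, LinearMap.zero_apply, q.zero_left, p.zero_right]

variable (p q) in
/-- The transpose of an isomorphism is an isomorphism. -/
lemma exists_isTr_equiv (e : A ≃ₗ[R] B) : ∃ e' : B' ≃ₗ[S] A', p.IsTr q e.toLinearMap e' := by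
  obtain ⟨f, hf⟩ := exists_isTr p q e.toLinearMap
  obtain ⟨g, hg⟩ := exists_isTr q p e.symm.toLinearMap
  have h₁ : f ∘ₗ g = LinearMap.id := (IsTr.comp hg hf).unique (by simpa using isTr_id)
  have h₂ : g ∘ₗ f = LinearMap.id := (IsTr.comp hf hg).unique (by simpa using isTr_id)
  exact ⟨LinearEquiv.ofLinearMap f g h₁ h₂, hf⟩

/-- The product of two perfect pairings. -/
def prod (p : DualPair R S T A A') (q : DualPair R S T B B') :
    DualPair R S T (A × B) (A' × B') where
  b x y := p.b x.1 y.1 + q.b x.2 y.2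
  add_left x y z := by simp only [Prod.fst_add, Prod.snd_add, p.add_left, q.add_left]; abel
  add_right x y z := by simp only [Prod.fst_add, Prod.snd_add, p.add_right, q.add_right]; abel
  smul_left r x y := by simp only [Prod.smul_fst, Prod.smul_snd, p.smul_left, q.smul_left, smul_add]
  smul_right r x y := by
    simp only [Prod.smul_fst, Prod.smul_snd, p.smul_right, q.smul_right, smul_add]
  exists_right φ := by
    obtain ⟨a', ha⟩ := p.exists_right (φ ∘ₗ LinearMap.inl R A B)
    obtain ⟨b', hb⟩ := q.exists_right (φ ∘ₗ LinearMap.inr R A B)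
    exact ⟨(a', b'), fun x => by simp [ha, hb, ← map_add]⟩
  exists_left φ := by
    obtain ⟨a', ha⟩ := p.exists_left (φ ∘ₗ LinearMap.inl S A' B')
    obtain ⟨b', hb⟩ := q.exists_left (φ ∘ₗ LinearMap.inr S A' B')
    exact ⟨(a', b'), fun x => by simp [ha, hb, ← map_add]⟩
  ext_right x h := Prod.ext
    (p.ext_right _ fun a => by simpa [q.zero_left] using h (a, 0))
    (q.ext_right _ fun b => by simpa [p.zero_left] using h (0, b))
  ext_left x h := Prod.ext
    (p.ext_left _ fun a => by simpa [q.zero_right] using h (a, 0))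
    (q.ext_left _ fun b => by simpa [p.zero_right] using h (0, b))

/-- Replace the two modules by isomorphic ones. -/
def congr (p : DualPair R S T A A') (e : B ≃ₗ[R] A) (e' : B' ≃ₗ[S] A') :
    DualPair R S T B B' where
  b x y := p.b (e x) (e' y)
  add_left x y z := by rw [map_add, p.add_left]
  add_right x y z := by rw [map_add, p.add_right]
  smul_left r x y := by rw [map_smul, p.smul_left]
  smul_right r x y := by rw [map_smul, p.smul_right]
  exists_right φ := by
    obtain ⟨a', h⟩ := p.exists_right (φ ∘ₗ e.symm.toLinearMap)
    exact ⟨e'.symm a', fun x => by simp [h]⟩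
  exists_left φ := by
    obtain ⟨a', h⟩ := p.exists_left (φ ∘ₗ e'.symm.toLinearMap)
    exact ⟨e.symm a', fun x => by simp [h]⟩
  ext_right x h := by
    simpa using p.ext_right (e' x) fun a => by simpa using h (e.symm a)
  ext_left x h := by
    simpa using p.ext_left (e x) fun a => by simpa using h (e'.symm a)

/-- The zero modules are dual to each other. -/
def zero : DualPair R S T PUnit.{u + 1} PUnit.{u + 1} where
  b _ _ := 0
  add_left _ _ _ := (add_zero 0).symm
  add_right _ _ _ := (add_zero 0).symm
  smul_left r _ _ := (smul_zero r).symm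
  smul_right r _ _ := (smul_zero r).symm
  exists_right φ := ⟨0, fun a => by rw [Subsingleton.elim a 0, map_zero]⟩
  exists_left φ := ⟨0, fun a => by rw [Subsingleton.elim a 0, map_zero]⟩
  ext_right _ _ := rfl
  ext_left _ _ := rfl

lemma IsTr.prodMap {A₁ A₁' B₁ B₁' : Type u} [AddCommGroup A₁] [Module R A₁] [AddCommGroup A₁']
    [Module S A₁'] [AddCommGroup B₁] [Module R B₁] [AddCommGroup B₁'] [Module S B₁']
    {p₁ : DualPair R S T A₁ A₁'} {q₁ : DualPair R S T B₁ B₁'}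
    {f : A →ₗ[R] B} {f' : B' →ₗ[S] A'} {f₁ : A₁ →ₗ[R] B₁} {f₁' : B₁' →ₗ[S] A₁'}
    (h : p.IsTr q f f') (h₁ : p₁.IsTr q₁ f₁ f₁') :
    (p.prod p₁).IsTr (q.prod q₁) (f.prodMap f₁) (f'.prodMap f₁') := fun _ _ =>
  congrArg₂ (· + ·) (h _ _) (h₁ _ _)


end DualPair

lemma surjective_id_sub {R A : Type u} [Ring R] [AddCommGroup A] [Module R A] {f : A →ₗ[R] A}
    (h : IsSuperfluous R (LinearMap.range f)) : Surjective ((LinearMap.id : A →ₗ[R] A) - f) :=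
  LinearMap.range_eq_top.mp (h _ (eq_top_iff.mpr fun a _ =>
    Submodule.mem_sup.mpr ⟨f a, ⟨a, rfl⟩, a - f a, ⟨a, rfl⟩, by abel⟩))

lemma isSuperfluous_range_of_forall {R A B : Type u} [Ring R] [AddCommGroup A] [Module R A]
    [AddCommGroup B] [Module R B] [Module.Projective R B] {f : A →ₗ[R] B}
    (h : ∀ g : B →ₗ[R] A, Surjective ((LinearMap.id : B →ₗ[R] B) - f ∘ₗ g)) :
    IsSuperfluous R (LinearMap.range f) := by
  intro N hN
  have hs : Surjective (N.mkQ ∘ₗ f) := fun x => by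
    obtain ⟨b, rfl⟩ := N.mkQ_surjective x
    obtain ⟨_, ⟨a, rfl⟩, n, hn, rfl⟩ := Submodule.mem_sup.mp (hN ▸ Submodule.mem_top : b ∈ _)
    exact ⟨a, by simpa using hn⟩
  obtain ⟨g, hg⟩ := Module.projective_lifting_property _ N.mkQ hs
  refine eq_top_iff.mpr fun b _ => ?_
  obtain ⟨c, rfl⟩ := h g b
  have := LinearMap.congr_fun hg c
  simp only [LinearMap.comp_apply, Submodule.mkQ_apply] at this
  exact (Submodule.Quotient.eq N).mp this.symm

section Transpose

variable {R S T : Type u} [Ring R] [Ring S] [AddCommGroup T] [Module R T] [Module S T]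
variable {A A' : Type u} [AddCommGroup A] [Module R A] [AddCommGroup A'] [Module S A']
variable {B B' : Type u} [AddCommGroup B] [Module R B] [AddCommGroup B'] [Module S B']

/-- The transpose of a map in the radical is in the radical. -/
lemma DualPair.IsTr.isSuperfluous_range [IsNoetherian R A] [Module.Projective S A']
    {p : DualPair R S T A A'} {q : DualPair R S T B B'} {d : A →ₗ[R] B} {d' : B' →ₗ[S] A'}
    (h : p.IsTr q d d') (hd : IsSuperfluous R (LinearMap.range d)) :
    IsSuperfluous S (LinearMap.range d') := by
  refine isSuperfluous_range_of_forall fun g' => ?_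
  obtain ⟨g, hg⟩ := DualPair.exists_isTr' q p g'
  have hs : Surjective ((LinearMap.id : A →ₗ[R] A) - g ∘ₗ d) :=
    surjective_id_sub (by rw [LinearMap.range_comp]; exact hd.map g)
  let e := LinearEquiv.ofBijective _
    ⟨IsNoetherian.injective_of_surjective_endomorphism _ hs, hs⟩
  obtain ⟨e', he⟩ := DualPair.exists_isTr_equiv p p e
  have : e'.toLinearMap = LinearMap.id - d' ∘ₗ g' :=
    he.unique (DualPair.IsTr.sub DualPair.isTr_id (DualPair.IsTr.comp hg h))
  rw [← this]
  exact e'.surjective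

end Transpose

lemma ker_prodMap {R A B C D : Type u} [Ring R] [AddCommGroup A] [Module R A] [AddCommGroup B]
    [Module R B] [AddCommGroup C] [Module R C] [AddCommGroup D] [Module R D] (f : A →ₗ[R] C)
    (g : B →ₗ[R] D) :
    LinearMap.ker (f.prodMap g) = (LinearMap.ker f).prod (LinearMap.ker g) := by
  ext x; simp

lemma exact_prodMap {R A B C A' B' C' : Type u} [Ring R] [AddCommGroup A] [Module R A]
    [AddCommGroup B] [Module R B] [AddCommGroup C] [Module R C] [AddCommGroup A'] [Module R A']
    [AddCommGroup B'] [Module R B'] [AddCommGroup C'] [Module R C'] {f : A →ₗ[R] B}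
    {g : B →ₗ[R] C} {f' : A' →ₗ[R] B'} {g' : B' →ₗ[R] C'} (h : Exact f g) (h' : Exact f' g') :
    Exact (f.prodMap f') (g.prodMap g') := by
  rintro ⟨b, b'⟩
  constructor
  · intro hb
    obtain ⟨a, rfl⟩ := (h b).mp (congrArg Prod.fst hb)
    obtain ⟨a', rfl⟩ := (h' b').mp (congrArg Prod.snd hb)
    exact ⟨(a, a'), rfl⟩
  · rintro ⟨⟨a, a'⟩, h₀⟩
    cases h₀
    exact Prod.ext (h.apply_apply_eq_zero a) (h'.apply_apply_eq_zero a')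

section Pres

variable {R : Type u} [Ring R] {A B M P : Type u} [AddCommGroup A] [Module R A] [AddCommGroup B]
  [Module R B] [AddCommGroup M] [Module R M] [AddCommGroup P] [Module R P]
variable {A' B' M' P' : Type u} [AddCommGroup A'] [Module R A'] [AddCommGroup B']
  [Module R B'] [AddCommGroup M'] [Module R M'] [AddCommGroup P'] [Module R P']

/-- The product of two minimal presentations. -/
def MinPres.prod (pr : MinPres R M) (pr' : MinPres R M') : MinPres R (M × M') where
  P₁ := pr.P₁ × pr'.P₁
  P₀ := pr.P₀ × pr'.P₀
  fin₁ := have := pr.fin₁; have := pr'.fin₁; inferInstance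
  fin₀ := have := pr.fin₀; have := pr'.fin₀; inferInstance
  proj₁ := have := pr.proj₁; have := pr'.proj₁; inferInstance
  proj₀ := have := pr.proj₀; have := pr'.proj₀; inferInstance
  d := pr.d.prodMap pr'.d
  p := pr.p.prodMap pr'.p
  surj := pr.surj.prodMap pr'.surj
  exact := exact_prodMap pr.exact pr'.exact
  min₀ := by rw [ker_prodMap]; exact pr.min₀.prod pr'.min₀
  min₁ := by rw [ker_prodMap]; exact pr.min₁.prod pr'.min₁

/-- Transport a minimal presentation along an isomorphism. -/
def MinPres.congr (pr : MinPres R M) (e : M ≃ₗ[R] M') : MinPres R M' where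
  P₁ := pr.P₁
  P₀ := pr.P₀
  fin₁ := pr.fin₁
  fin₀ := pr.fin₀
  proj₁ := pr.proj₁
  proj₀ := pr.proj₀
  d := pr.d
  p := e.toLinearMap ∘ₗ pr.p
  surj := e.surjective.comp pr.surj
  exact := fun x => by
    rw [← pr.exact x, LinearMap.comp_apply, LinearEquiv.coe_coe, e.map_eq_zero_iff]
  min₀ := by rw [LinearMap.ker_comp_of_ker_eq_bot _ e.ker]; exact pr.min₀
  min₁ := pr.min₁

/-- `d` is isomorphic to the sum of a minimal presentation of `M` and of `P → 0`. -/
def Pres (R : Type u) [Ring R] {A B : Type u} [AddCommGroup A] [Module R A] [AddCommGroup B]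
    [Module R B] (d : A →ₗ[R] B) (M P : Type u) [AddCommGroup M] [Module R M] [AddCommGroup P]
    [Module R P] : Prop :=
  ∃ (pr : MinPres R M) (α : A ≃ₗ[R] pr.P₁ × P) (β : B ≃ₗ[R] pr.P₀), ∀ a, β (d a) = pr.d (α a).1

lemma MinPres.pres (pr : MinPres R M) : Pres R (pr.d ∘ₗ LinearMap.fst R pr.P₁ P) M P :=
  ⟨pr, LinearEquiv.refl R _, LinearEquiv.refl R _, fun _ => rfl⟩

variable {d : A →ₗ[R] B} {d' : A' →ₗ[R] B'}

lemma Pres.exists_coker (h : Pres R d M P) : ∃ p : B →ₗ[R] M, Surjective p ∧ Exact d p ∧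
    IsSuperfluous R (LinearMap.ker p) := by
  obtain ⟨pr, α, β, h⟩ := h
  refine ⟨pr.p ∘ₗ β.toLinearMap, pr.surj.comp β.surjective, fun b => ?_, pr.min₀.ker_comp_equiv β⟩
  rw [LinearMap.comp_apply, LinearEquiv.coe_coe, pr.exact]
  constructor
  · rintro ⟨a, ha⟩
    refine ⟨α.symm (a, 0), β.injective ?_⟩
    rw [h, ← ha, α.apply_symm_apply]
  · rintro ⟨a, rfl⟩
    exact ⟨_, (h a).symm⟩

lemma Pres.isSuperfluous_range (h : Pres R d M P) : IsSuperfluous R (LinearMap.range d) := by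
  obtain ⟨p, -, hp, hs⟩ := h.exists_coker
  rwa [LinearMap.exact_iff.mp hp] at hs

lemma Pres.congr (h : Pres R d M P) (e : M ≃ₗ[R] M') (e' : P ≃ₗ[R] P') : Pres R d M' P' := by
  obtain ⟨pr, α, β, h⟩ := h
  exact ⟨pr.congr e, α.trans ((LinearEquiv.refl R _).prodCongr e'), β, h⟩

lemma Pres.prod (h : Pres R d M P) (h' : Pres R d' M' P') :
    Pres R (d.prodMap d') (M × M') (P × P') := by
  obtain ⟨pr, α, β, h⟩ := h
  obtain ⟨pr', α', β', h'⟩ := h'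
  exact ⟨pr.prod pr', (α.prodCongr α').trans (LinearEquiv.prodProdProdComm R _ _ _ _),
    β.prodCongr β', fun a => Prod.ext (h a.1) (h' a.2)⟩

lemma Pres.exists_equiv [IsArtinianRing R] (h : Pres R d M P) (h' : Pres R d' M' P')
    (e : M ≃ₗ[R] M') (e' : P ≃ₗ[R] P') :
    ∃ (α : A ≃ₗ[R] A') (β : B ≃ₗ[R] B'), ∀ a, d' (α a) = β (d a) := by
  obtain ⟨pr, α, β, h⟩ := h
  obtain ⟨pr', α', β', h'⟩ := h'
  obtain ⟨γ, δ, hγ⟩ := pr.exists_equiv pr' e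
  refine ⟨(α.trans (γ.prodCongr e')).trans α'.symm, (β.trans δ).trans β'.symm, fun a => ?_⟩
  apply β'.injective
  simp [h', hγ, h]

lemma nonempty_equiv_of_coker {p : B →ₗ[R] M} {p' : B' →ₗ[R] M'} (hp : Surjective p)
    (hp' : Surjective p') (hd : Exact d p) (hd' : Exact d' p') (α : A ≃ₗ[R] A') (β : B ≃ₗ[R] B')
    (h : ∀ a, d' (α a) = β (d a)) : Nonempty (M ≃ₗ[R] M') := by
  have key : (LinearMap.ker p).map β.toLinearMap = LinearMap.ker p' := by
    rw [LinearMap.exact_iff.mp hd, LinearMap.exact_iff.mp hd', ← LinearMap.range_comp]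
    have : β.toLinearMap ∘ₗ d = d' ∘ₗ α.toLinearMap := LinearMap.ext fun a => (h a).symm
    rw [this, LinearMap.range_comp_of_range_eq_top _ α.range]
  exact ⟨(p.quotKerEquivOfSurjective hp).symm.trans
    ((Submodule.Quotient.equiv _ _ β key).trans (p'.quotKerEquivOfSurjective hp'))⟩

lemma exists_surjective_of_minPres {pr : MinPres R M} {pr' : MinPres R M'}
    (α : (pr.P₁ × P) ≃ₗ[R] pr'.P₁ × P') (β : pr.P₀ ≃ₗ[R] pr'.P₀)
    (h : ∀ a, pr'.d (α a).1 = β (pr.d a.1)) : ∃ f : P →ₗ[R] P', Surjective f := by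
  let g : (pr.P₁ × P) →ₗ[R] P' := LinearMap.snd R _ _ ∘ₗ α.toLinearMap
  refine ⟨g ∘ₗ LinearMap.inr R _ _, LinearMap.range_eq_top.mp ?_⟩
  refine pr.min₁.map (g ∘ₗ LinearMap.inl R _ _) _ (eq_top_iff.mpr fun x _ => ?_)
  obtain ⟨⟨a, b⟩, hab⟩ := α.surjective (0, x)
  have ha : pr.d a = 0 := β.injective (by simpa [hab] using (h (a, b)).symm)
  refine Submodule.mem_sup.mpr ⟨_, ⟨a, ha, rfl⟩, _, ⟨b, rfl⟩, ?_⟩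
  simp only [LinearMap.comp_apply, ← map_add]
  simp [g, hab]

lemma Pres.nonempty_equiv [IsArtinianRing R] [Module.Finite R P] (h : Pres R d M P)
    (h' : Pres R d' M' P') (α : A ≃ₗ[R] A') (β : B ≃ₗ[R] B') (hαβ : ∀ a, d' (α a) = β (d a)) :
    Nonempty (M ≃ₗ[R] M') ∧ Nonempty (P ≃ₗ[R] P') := by
  obtain ⟨p, hp, hd, -⟩ := h.exists_coker
  obtain ⟨p', hp', hd', -⟩ := h'.exists_coker
  refine ⟨nonempty_equiv_of_coker hp hp' hd hd' α β hαβ, ?_⟩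
  obtain ⟨pr, γ, δ, h⟩ := h
  obtain ⟨pr', γ', δ', h'⟩ := h'
  have key : ∀ a, pr'.d (((γ.symm.trans α).trans γ') a).1 = ((δ.symm.trans β).trans δ') (pr.d a.1) :=
    fun a => by
      have := h (γ.symm a)
      rw [γ.apply_symm_apply] at this
      simp [← h', hαβ, ← this]
  obtain ⟨f, hf⟩ := exists_surjective_of_minPres _ _ key
  obtain ⟨g, hg⟩ := exists_surjective_of_minPres _ _ fun a => by
    have := key (((γ.symm.trans α).trans γ').symm a)
    rw [LinearEquiv.apply_symm_apply] at this
    rw [this, LinearEquiv.symm_apply_apply]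
  exact ⟨LinearEquiv.ofBijective f (bijective_of_surjective_of_surjective hf hg)⟩

/-- Every radical map between finitely generated projectives is the presentation of some pair. -/
lemma exists_pres [IsArtinianRing R] [Module.Finite R A] [Module.Finite R B]
    [Module.Projective R A] [Module.Projective R B]
    (hd : IsSuperfluous R (LinearMap.range d)) :
    ∃ P : Submodule R A, Module.Projective R P ∧ Pres R d (B ⧸ LinearMap.range d) P := by
  obtain ⟨A₁, P, hc, hP, hs⟩ := exists_isCompl_superfluous_ker d
  have hr : LinearMap.range (d.domRestrict A₁) = LinearMap.range d := by
    refine le_antisymm (by rintro _ ⟨x, rfl⟩; exact ⟨x, rfl⟩) ?_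
    rintro _ ⟨x, rfl⟩
    obtain ⟨a, ha, p, hp, rfl⟩ := Submodule.mem_sup.mp (hc.sup_eq_top ▸ Submodule.mem_top : x ∈ _)
    have : d p = 0 := hP hp
    exact ⟨⟨a, ha⟩, by simp [this]⟩
  let pr : MinPres R (B ⧸ LinearMap.range d) :=
    { P₁ := A₁
      P₀ := B
      fin₁ := inferInstance
      fin₀ := inferInstance
      proj₁ := projective_of_isCompl hc
      proj₀ := inferInstance
      d := d.domRestrict A₁
      p := (LinearMap.range d).mkQ
      surj := (LinearMap.range d).mkQ_surjective
      exact := LinearMap.exact_iff.mpr (by rw [Submodule.ker_mkQ, hr])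
      min₀ := by rwa [Submodule.ker_mkQ]
      min₁ := hs }
  refine ⟨P, projective_of_isCompl hc.symm, pr, (Submodule.prodEquivOfIsCompl _ _ hc).symm,
    LinearEquiv.refl R B, fun a => ?_⟩
  obtain ⟨⟨x, y⟩, rfl⟩ := (Submodule.prodEquivOfIsCompl _ _ hc).surjective a
  have : d y = 0 := hP y.2
  rw [LinearEquiv.symm_apply_apply]
  simp [pr, this]

end Pres

section Pres

variable {R : Type u} [Ring R] {A B M P : Type u} [AddCommGroup A] [Module R A] [AddCommGroup B]
  [Module R B] [AddCommGroup M] [Module R M] [AddCommGroup P] [Module R P] {d : A →ₗ[R] B}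

lemma Pres.finite_left [Module.Finite R B] (h : Pres R d M P) : Module.Finite R M := by
  obtain ⟨p, hp, -⟩ := h.exists_coker
  exact Module.Finite.of_surjective p hp

lemma Pres.finite_right [Module.Finite R A] (h : Pres R d M P) : Module.Finite R P := by
  obtain ⟨pr, α, -⟩ := h
  exact Module.Finite.of_surjective (LinearMap.snd R pr.P₁ P ∘ₗ α.toLinearMap)
    (Prod.snd_surjective.comp α.surjective)

lemma Pres.projective_right [Module.Projective R A] (h : Pres R d M P) : Module.Projective R P := by
  obtain ⟨pr, α, -⟩ := h
  refine Module.Projective.of_split (α.symm.toLinearMap ∘ₗ LinearMap.inr R pr.P₁ P)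
    (LinearMap.snd R pr.P₁ P ∘ₗ α.toLinearMap) ?_
  ext x; simp

end Pres

section Dag

variable {R S T : Type u} [Ring R] [Ring S] [AddCommGroup T] [Module R T] [Module S T]

namespace DualPair

/-- Finite powers of a perfect pairing. -/
def pi {A A' : Type u} [AddCommGroup A] [Module R A] [AddCommGroup A'] [Module S A']
    (p : DualPair R S T A A') (n : ℕ) : DualPair R S T (Fin n → A) (Fin n → A') where
  b x y := ∑ i, p.b (x i) (y i)
  add_left x y z := by simp only [Pi.add_apply, p.add_left, Finset.sum_add_distrib]
  add_right x y z := by simp only [Pi.add_apply, p.add_right, Finset.sum_add_distrib]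
  smul_left r x y := by simp only [Pi.smul_apply, p.smul_left, Finset.smul_sum]
  smul_right r x y := by simp only [Pi.smul_apply, p.smul_right, Finset.smul_sum]
  exists_right φ := by
    choose y hy using fun i => p.exists_right (φ ∘ₗ LinearMap.single R (fun _ => A) i)
    refine ⟨y, fun x => ?_⟩
    simp only [hy, LinearMap.comp_apply, ← map_sum, LinearMap.single_apply,
      Finset.univ_sum_single x]
  exists_left φ := by
    choose y hy using fun i => p.exists_left (φ ∘ₗ LinearMap.single S (fun _ => A') i)
    refine ⟨y, fun x => ?_⟩
    simp only [hy, LinearMap.comp_apply, ← map_sum, LinearMap.single_apply,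
      Finset.univ_sum_single x]
  ext_right y h := funext fun i => p.ext_right _ fun a => by
    have := h (Pi.single i a)
    rwa [Finset.sum_eq_single i, Pi.single_eq_same] at this
    · intro j _ hj
      rw [Pi.single_eq_of_ne hj, p.zero_left]
    · simp
  ext_left x h := funext fun i => p.ext_left _ fun a => by
    have := h (Pi.single i a)
    rwa [Finset.sum_eq_single i, Pi.single_eq_same] at this
    · intro j _ hj
      rw [Pi.single_eq_of_ne hj, p.zero_right]
    · simp

/-- A retract of a module with a dual has a dual, which is a retract of the dual. -/
lemma exists_retract {A A' X : Type u} [AddCommGroup A] [Module R A] [AddCommGroup A']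
    [Module S A'] [AddCommGroup X] [Module R X] (p : DualPair R S T A A') (i : X →ₗ[R] A)
    (π : A →ₗ[R] X) (h : π ∘ₗ i = LinearMap.id) :
    ∃ (X' : Submodule S A') (ρ : A' →ₗ[S] X'), ρ ∘ₗ X'.subtype = LinearMap.id ∧
      Nonempty (DualPair R S T X X') := by
  have h' : ∀ x, π (i x) = x := LinearMap.congr_fun h
  obtain ⟨e, he⟩ := exists_isTr p p (i ∘ₗ π)
  have hee : ∀ y, e (e y) = e y := fun y => p.eq_right fun a => by
    rw [← he, ← he, ← he]; simp [h']
  have hfix : ∀ y : LinearMap.range e, e y = y := by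
    rintro ⟨_, y, rfl⟩; exact hee y
  refine ⟨LinearMap.range e, e.rangeRestrict, LinearMap.ext fun y => Subtype.ext (hfix y), ⟨?_⟩⟩
  exact
    { b := fun x y => p.b (i x) y
      add_left := fun x y z => by rw [map_add, p.add_left]
      add_right := fun x y z => by rw [Submodule.coe_add, p.add_right]
      smul_left := fun r x y => by rw [map_smul, p.smul_left]
      smul_right := fun r x y => by rw [Submodule.coe_smul, p.smul_right]
      exists_right := fun φ => by
        obtain ⟨y, hy⟩ := p.exists_right (φ ∘ₗ π)
        exact ⟨⟨e y, y, rfl⟩, fun x => by simp [← he (i x) y, h', hy]⟩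
      exists_left := fun ψ => by
        obtain ⟨x, hx⟩ := p.exists_left (ψ ∘ₗ e.rangeRestrict)
        refine ⟨π x, fun y => ?_⟩
        have := he x y
        rw [hfix] at this
        rw [← LinearMap.comp_apply i π, this, hx]
        exact congrArg ψ (Subtype.ext (hfix y))
      ext_right := fun y hy => Subtype.ext <| p.ext_right _ fun a => by
        have := he a y
        rw [hfix] at this
        rw [← this]
        exact hy _
      ext_left := fun x hx => by
        rw [← h' x, p.ext_left (i x) fun y => ?_, map_zero]
        have := he (i x) y
        rw [LinearMap.comp_apply, h'] at this
        rw [this]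
        exact hx ⟨e y, y, rfl⟩ }

lemma exists_dual (u : DualPair R S T R S) (A : Type u) [AddCommGroup A] [Module R A]
    [Module.Finite R A] [Module.Projective R A] :
    ∃ (A' : Type u) (_ : AddCommGroup A') (_ : Module S A'), Module.Finite S A' ∧
      Module.Projective S A' ∧ Nonempty (DualPair R S T A A') := by
  obtain ⟨n, π, hπ⟩ := Module.Finite.exists_fin' R A
  obtain ⟨i, hi⟩ := Module.projective_lifting_property π LinearMap.id hπ
  obtain ⟨A', ρ, hρ, hd⟩ := (u.pi n).exists_retract i π hi
  exact ⟨A', inferInstance, inferInstance,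
    Module.Finite.of_surjective ρ fun x => ⟨x, LinearMap.congr_fun hρ x⟩,
    Module.Projective.of_split _ ρ hρ, hd⟩

end DualPair

/-- `(Z, Q)` is presented by the transpose of a map presenting `(M, P)`. -/
def Dag (R S T : Type u) [Ring R] [Ring S] [AddCommGroup T] [Module R T] [Module S T]
    (M P Z Q : Type u) [AddCommGroup M] [Module R M] [AddCommGroup P] [Module R P]
    [AddCommGroup Z] [Module S Z] [AddCommGroup Q] [Module S Q] : Prop :=
  ∃ (A B : ModuleCat.{u} R) (A' B' : ModuleCat.{u} S) (p : DualPair R S T A A')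
    (q : DualPair R S T B B') (d : A →ₗ[R] B) (d' : B' →ₗ[S] A'),
    (Module.Finite R A ∧ Module.Projective R A ∧ Module.Finite R B ∧ Module.Projective R B) ∧
    (Module.Finite S A' ∧ Module.Projective S A' ∧ Module.Finite S B' ∧ Module.Projective S B') ∧
    p.IsTr q d d' ∧ Pres R d M P ∧ Pres S d' Z Q

variable {M P Z Q M' P' Z' Q' : Type u} [AddCommGroup M] [Module R M] [AddCommGroup P] [Module R P]
    [AddCommGroup Z] [Module S Z] [AddCommGroup Q] [Module S Q] [AddCommGroup M'] [Module R M']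
    [AddCommGroup P'] [Module R P'] [AddCommGroup Z'] [Module S Z'] [AddCommGroup Q'] [Module S Q']

lemma Dag.symm (h : Dag R S T M P Z Q) : Dag S R T Z Q M P := by
  obtain ⟨A, B, A', B', p, q, d, d', ⟨h₁, h₂, h₃, h₄⟩, ⟨h₅, h₆, h₇, h₈⟩, hd, h, h'⟩ := h
  exact ⟨B', A', B, A, q.symm, p.symm, d', d, ⟨h₇, h₈, h₅, h₆⟩, ⟨h₃, h₄, h₁, h₂⟩, hd.symm, h', h⟩

lemma Dag.prod (h : Dag R S T M P Z Q) (H : Dag R S T M' P' Z' Q') :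
    Dag R S T (M × M') (P × P') (Z × Z') (Q × Q') := by
  obtain ⟨A, B, A', B', p, q, d, d', ⟨h₁, h₂, h₃, h₄⟩, ⟨h₅, h₆, h₇, h₈⟩, hd, h, h'⟩ := h
  obtain ⟨A₁, B₁, A₁', B₁', p₁, q₁, d₁, d₁', ⟨k₁, k₂, k₃, k₄⟩, ⟨k₅, k₆, k₇, k₈⟩, kd, k, k'⟩ := H
  exact ⟨.of R (A × A₁), .of R (B × B₁), .of S (A' × A₁'), .of S (B' × B₁'), p.prod p₁, q.prod q₁,
    d.prodMap d₁, d'.prodMap d₁',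
    ⟨inferInstanceAs (Module.Finite R (A × A₁)), inferInstanceAs (Module.Projective R (A × A₁)),
      inferInstanceAs (Module.Finite R (B × B₁)), inferInstanceAs (Module.Projective R (B × B₁))⟩,
    ⟨inferInstanceAs (Module.Finite S (A' × A₁')), inferInstanceAs (Module.Projective S (A' × A₁')),
      inferInstanceAs (Module.Finite S (B' × B₁')),
      inferInstanceAs (Module.Projective S (B' × B₁'))⟩,
    hd.prodMap kd, h.prod k, h'.prod k'⟩

lemma Dag.congr_left (h : Dag R S T M P Z Q) (e : M ≃ₗ[R] M') (e' : P ≃ₗ[R] P') :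
    Dag R S T M' P' Z Q := by
  obtain ⟨A, B, A', B', p, q, d, d', h₁, h₂, hd, h, h'⟩ := h
  exact ⟨A, B, A', B', p, q, d, d', h₁, h₂, hd, h.congr e e', h'⟩

lemma Dag.congr_right (h : Dag R S T M P Z Q) (e : Z ≃ₗ[S] Z') (e' : Q ≃ₗ[S] Q') :
    Dag R S T M P Z' Q' := (h.symm.congr_left e e').symm

lemma Dag.finite (h : Dag R S T M P Z Q) :
    Module.Finite R M ∧ Module.Finite R P ∧ Module.Projective R P := by
  obtain ⟨A, B, A', B', p, q, d, d', ⟨h₁, h₂, h₃, h₄⟩, -, hd, h, h'⟩ := h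
  exact ⟨h.finite_left, h.finite_right, h.projective_right⟩

lemma Dag.nonempty_equiv [IsArtinianRing R] [IsArtinianRing S] (h : Dag R S T M P Z Q)
    (H : Dag R S T M' P' Z' Q') (e : M ≃ₗ[R] M') (e' : P ≃ₗ[R] P') :
    Nonempty (Z ≃ₗ[S] Z') ∧ Nonempty (Q ≃ₗ[S] Q') := by
  have := h.symm.finite.2.1
  obtain ⟨A, B, A', B', p, q, d, d', -, -, hd, h, h'⟩ := h
  obtain ⟨A₁, B₁, A₁', B₁', p₁, q₁, d₁, d₁', -, -, kd, k, k'⟩ := H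
  obtain ⟨α, β, hαβ⟩ := h.exists_equiv k e e'
  obtain ⟨α', hα⟩ := DualPair.exists_isTr_equiv p p₁ α
  obtain ⟨β', hβ⟩ := DualPair.exists_isTr_equiv q q₁ β
  have key : α'.toLinearMap ∘ₗ d₁' = d' ∘ₗ β'.toLinearMap :=
    (DualPair.IsTr.comp kd hα).unique (by
      have : d₁ ∘ₗ α.toLinearMap = β.toLinearMap ∘ₗ d := LinearMap.ext hαβ
      rw [this]
      exact DualPair.IsTr.comp hβ hd)
  refine h'.nonempty_equiv k' β'.symm α'.symm fun b => α'.injective ?_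
  have := LinearMap.congr_fun key (β'.symm b)
  simpa using this

lemma exists_dag [IsArtinianRing R] [IsArtinianRing S] [Module.Finite R M] [Module.Finite R P]
    [Module.Projective R P] (u : DualPair R S T R S) :
    ∃ Z Q : ModuleCat.{u} S, Dag R S T M P Z Q := by
  obtain ⟨pr⟩ := exists_minPres (R := R) (M := M)
  have := pr.fin₀
  have := pr.fin₁
  have := pr.proj₀
  have := pr.proj₁
  obtain ⟨A', _, _, _, _, ⟨p⟩⟩ := u.exists_dual (pr.P₁ × P)
  obtain ⟨B', _, _, _, _, ⟨q⟩⟩ := u.exists_dual pr.P₀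
  have hd : Pres R (pr.d ∘ₗ LinearMap.fst R pr.P₁ P) M P := pr.pres
  obtain ⟨d', hd'⟩ := DualPair.exists_isTr p q (pr.d ∘ₗ LinearMap.fst R pr.P₁ P)
  obtain ⟨Q, -, h'⟩ := exists_pres (hd'.isSuperfluous_range hd.isSuperfluous_range)
  exact ⟨.of S (A' ⧸ LinearMap.range d'), .of S Q, .of R (pr.P₁ × P), .of R pr.P₀, .of S A',
    .of S B', p, q, _, d', ⟨inferInstanceAs (Module.Finite R (pr.P₁ × P)),
      inferInstanceAs (Module.Projective R (pr.P₁ × P)), pr.fin₀, pr.proj₀⟩,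
    ⟨‹_›, ‹_›, ‹_›, ‹_›⟩, hd', hd, h'⟩

end Dag

section Presilting

variable {R : Type u} [Ring R] {A B M P : Type u} [AddCommGroup A] [Module R A] [AddCommGroup B]
  [Module R B] [AddCommGroup M] [Module R M] [AddCommGroup P] [Module R P]

/-- A map of projectives, viewed as a two-term complex, has no self-extensions. -/
def Presilting (R : Type u) [Ring R] {A B : Type u} [AddCommGroup A] [Module R A] [AddCommGroup B]
    [Module R B] (d : A →ₗ[R] B) : Prop :=
  ∀ α : A →ₗ[R] B, ∃ (h : A →ₗ[R] A) (g : B →ₗ[R] B), α = d ∘ₗ h + g ∘ₗ d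

lemma DualPair.IsTr.presilting {S T A' B' : Type u} [Ring S] [AddCommGroup T] [Module R T]
    [Module S T] [AddCommGroup A'] [Module S A'] [AddCommGroup B'] [Module S B']
    {p : DualPair R S T A A'} {q : DualPair R S T B B'} {d : A →ₗ[R] B} {d' : B' →ₗ[S] A'}
    (hd : p.IsTr q d d') (h : Presilting R d) : Presilting S d' := by
  intro α'
  obtain ⟨α, hα⟩ := DualPair.exists_isTr' p q α'
  obtain ⟨h, g, rfl⟩ := h α
  obtain ⟨h', hh⟩ := DualPair.exists_isTr p p h
  obtain ⟨g', hg⟩ := DualPair.exists_isTr q q g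
  refine ⟨g', h', hα.unique ?_⟩
  rw [add_comm (d' ∘ₗ g')]
  exact (DualPair.IsTr.comp hd hh).add (DualPair.IsTr.comp hg hd)

lemma presilting_iff_of_exact [Module.Projective R A] [Module.Projective R B] {d : A →ₗ[R] B}
    {p : B →ₗ[R] M} (hp : Surjective p) (hd : Exact d p) :
    Presilting R d ↔ ∀ φ : A →ₗ[R] M, ∃ ψ : B →ₗ[R] M, ψ ∘ₗ d = φ := by
  constructor
  · intro h φ
    obtain ⟨α, rfl⟩ := Module.projective_lifting_property p φ hp
    obtain ⟨k, g, rfl⟩ := h α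
    refine ⟨p ∘ₗ g, LinearMap.ext fun a => ?_⟩
    simp [hd.apply_apply_eq_zero]
  · intro h α
    obtain ⟨ψ, hψ⟩ := h (p ∘ₗ α)
    obtain ⟨g, rfl⟩ := Module.projective_lifting_property p ψ hp
    have hr : ∀ a, (α - g ∘ₗ d) a ∈ LinearMap.range d := fun a => (hd _).mp (by
      have := LinearMap.congr_fun hψ a
      simp only [LinearMap.comp_apply] at this
      simp [this])
    obtain ⟨k, hk⟩ := Module.projective_lifting_property d.rangeRestrict
      ((α - g ∘ₗ d).codRestrict _ hr) d.surjective_rangeRestrict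
    refine ⟨k, g, LinearMap.ext fun a => ?_⟩
    have := congrArg Subtype.val (LinearMap.congr_fun hk a)
    simp only [LinearMap.comp_apply, LinearMap.codRestrict_apply, LinearMap.sub_apply] at this
    change d (k a) = _ at this
    simp [this]

lemma Pres.presilting_iff [IsArtinianRing R] [Module.Finite R A] [Module.Finite R B]
    [Module.Projective R A] [Module.Projective R B] {d : A →ₗ[R] B} (h : Pres R d M P)
    (pr : MinPres R M) : Presilting R d ↔
      (∀ φ : pr.P₁ →ₗ[R] M, ∃ ψ : pr.P₀ →ₗ[R] M, ψ ∘ₗ pr.d = φ) ∧ ∀ f : P →ₗ[R] M, f = 0 := by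
  obtain ⟨p, hp, hd, -⟩ := h.exists_coker
  rw [presilting_iff_of_exact hp hd]
  obtain ⟨α, β, h⟩ := (pr.pres (P := P)).exists_equiv h (LinearEquiv.refl R M) (LinearEquiv.refl R P)
  have h' : ∀ x y, d (α (x, y)) = β (pr.d x) := fun x y => h (x, y)
  constructor
  · intro H
    constructor
    · intro φ
      obtain ⟨ψ, hψ⟩ := H (φ ∘ₗ LinearMap.fst R _ _ ∘ₗ α.symm.toLinearMap)
      refine ⟨ψ ∘ₗ β.toLinearMap, LinearMap.ext fun x => ?_⟩
      simpa [h'] using LinearMap.congr_fun hψ (α (x, 0))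
    · intro f
      obtain ⟨ψ, hψ⟩ := H (f ∘ₗ LinearMap.snd R _ _ ∘ₗ α.symm.toLinearMap)
      refine LinearMap.ext fun y => ?_
      simpa [h'] using (LinearMap.congr_fun hψ (α (0, y))).symm
  · rintro ⟨H₁, H₂⟩ φ
    obtain ⟨ψ, hψ⟩ := H₁ (φ ∘ₗ α.toLinearMap ∘ₗ LinearMap.inl R _ _)
    refine ⟨ψ ∘ₗ β.symm.toLinearMap, LinearMap.ext fun a => ?_⟩
    obtain ⟨⟨x, y⟩, rfl⟩ := α.surjective a
    have e₁ := LinearMap.congr_fun hψ x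
    have e₂ := LinearMap.congr_fun (H₂ (φ ∘ₗ α.toLinearMap ∘ₗ LinearMap.inr R _ _)) y
    simp only [LinearMap.comp_apply, LinearMap.inl_apply, LinearMap.inr_apply,
      LinearEquiv.coe_coe, LinearMap.zero_apply] at e₁ e₂
    have : ((x, y) : pr.P₁ × P) = (x, 0) + (0, y) := by simp
    rw [LinearMap.comp_apply, LinearMap.comp_apply, LinearEquiv.coe_coe, h', β.symm_apply_apply, e₁,
      this, map_add, map_add, e₂, add_zero]

lemma exists_dualBasis (R A : Type u) [Ring R] [AddCommGroup A] [Module R A] [Module.Finite R A]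
    [Module.Projective R A] :
    ∃ (n : ℕ) (a : Fin n → A) (f : Fin n → A →ₗ[R] R), ∀ x, ∑ i, f i x • a i = x := by
  obtain ⟨n, π, hπ⟩ := Module.Finite.exists_fin' R A
  obtain ⟨i, hi⟩ := Module.projective_lifting_property π LinearMap.id hπ
  refine ⟨n, fun j => π (Pi.single j 1), fun j => LinearMap.proj j ∘ₗ i, fun x => ?_⟩
  have : π (i x) = x := LinearMap.congr_fun hi x
  conv_rhs => rw [← this, ← Finset.univ_sum_single (i x), map_sum]
  refine Finset.sum_congr rfl fun j _ => ?_
  rw [← map_smul, ← Pi.single_smul, smul_eq_mul, mul_one]; rfl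

end Presilting

section Forms

variable {R : Type u} [Ring R] {K : Type u} [Field K] [Algebra K R]
variable {M : Type u} [AddCommGroup M] [Module R M]

/-- Every balanced `K`-valued form on `M × Tr M` vanishes. -/
def NoForms (K : Type u) [Field K] [Algebra K R] (pr : MinPres R M) : Prop :=
  ∀ β : M →+ pr.Tr →+ K, (∀ m t (k : K), β m (k • t) = k * β m t) →
    (∀ (r : R) m t, β (r • m) t = β m (op r • t)) → β = 0

lemma MinPres.toTr_surjective (pr : MinPres R M) : Surjective pr.toTr :=
  Submodule.Quotient.mk_surjective _

/-- Evaluation at a vector `m`, turning a functional into a map to `M`. -/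
def rankOne {A : Type u} [AddCommGroup A] [Module R A] (h : A →ₗ[R] R) (m : M) : A →ₗ[R] M :=
  LinearMap.toSpanSingleton R M m ∘ₗ h

lemma rankOne_apply {A : Type u} [AddCommGroup A] [Module R A] (h : A →ₗ[R] R) (m : M) (a : A) :
    rankOne h m a = h a • m := rfl

lemma noForms_of_surjective (pr : MinPres R M)
    (H : ∀ φ : pr.P₁ →ₗ[R] M, ∃ ψ : pr.P₀ →ₗ[R] M, ψ ∘ₗ pr.d = φ) : NoForms K pr := by
  intro β _ hb
  have := pr.fin₀; have := pr.fin₁; have := pr.proj₀; have := pr.proj₁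
  obtain ⟨n, a, f, hf⟩ := exists_dualBasis R pr.P₁
  obtain ⟨l, b, g, hg⟩ := exists_dualBasis R pr.P₀
  have key : ∀ (h : pr.P₁ →ₗ[R] R) (m : M), ∑ i, β (h (a i) • m) (pr.toTr (f i)) =
      β m (pr.toTr h) := fun h m => by
    have : h = ∑ i, op (h (a i)) • f i := LinearMap.ext fun x => by
      conv_lhs => rw [← hf x]
      simp
    conv_rhs => rw [this]
    have e : pr.toTr (∑ i, op (h (a i)) • f i) = ∑ i, op (h (a i)) • pr.toTr (f i) :=
      map_sum (LinearMap.range pr.dualMap).mkQ _ _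
    rw [e, map_sum]
    exact Finset.sum_congr rfl fun i _ => hb _ _ _
  ext m t
  obtain ⟨h, rfl⟩ := pr.toTr_surjective t
  obtain ⟨ψ, hψ⟩ := H (rankOne h m)
  rw [← key]
  have hd : ∀ i, h (a i) • m = ∑ j, g j (pr.d (a i)) • ψ (b j) := fun i => by
    rw [← rankOne_apply, ← hψ, LinearMap.comp_apply]
    conv_lhs => rw [← hg (pr.d (a i))]
    simp
  simp only [hd, map_sum, AddMonoidHom.finsetSum_apply]
  rw [Finset.sum_comm]
  refine Finset.sum_eq_zero fun j _ => ?_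
  have := key (g j ∘ₗ pr.d) (ψ (b j))
  simp only [LinearMap.comp_apply] at this
  rw [this]
  have e : pr.toTr (g j ∘ₗ pr.d) = 0 := (Submodule.Quotient.mk_eq_zero _).mpr ⟨g j, rfl⟩
  rw [e, map_zero]

lemma surjective_of_noForms [Module K M] [IsScalarTower K R M] (pr : MinPres R M)
    (H : NoForms K pr) (φ : pr.P₁ →ₗ[R] M) : ∃ ψ : pr.P₀ →ₗ[R] M, ψ ∘ₗ pr.d = φ := by
  have := pr.fin₁; have := pr.proj₁
  let U : Submodule K (pr.P₁ →ₗ[R] M) := LinearMap.range (LinearMap.lcomp K M pr.d)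
  suffices hU : U = ⊤ by
    have : φ ∈ U := hU ▸ Submodule.mem_top
    exact this
  by_contra hU
  obtain ⟨L, hL, hLU⟩ := Submodule.exists_le_ker_of_lt_top U (lt_top_iff_ne_top.mpr hU)
  have hadd : ∀ (h h' : pr.P₁ →ₗ[R] R) (m : M), rankOne (h + h') m = rankOne h m + rankOne h' m :=
    fun h h' m => LinearMap.ext fun x => by simp [rankOne_apply, add_smul]
  have hadd' : ∀ (h : pr.P₁ →ₗ[R] R) (m m' : M), rankOne h (m + m') = rankOne h m + rankOne h m' :=
    fun h m m' => LinearMap.ext fun x => by simp [rankOne_apply]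
  let γ : M → pr.Tr →+ K := fun m => QuotientAddGroup.lift (LinearMap.range pr.dualMap).toAddSubgroup
    (AddMonoidHom.mk' (fun h => L (rankOne h m)) fun h h' => by rw [hadd, map_add]) (by
      rintro _ ⟨g, rfl⟩
      exact hLU ⟨rankOne g m, rfl⟩)
  have hγ : ∀ m h, γ m (pr.toTr h) = L (rankOne h m) := fun m h => rfl
  have h0 := H (AddMonoidHom.mk' γ fun m m' => AddMonoidHom.ext fun t => by
      obtain ⟨h, rfl⟩ := pr.toTr_surjective t
      rw [AddMonoidHom.add_apply, hγ, hγ, hγ, hadd', map_add])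
    (fun m t k => by
      obtain ⟨h, rfl⟩ := pr.toTr_surjective t
      have e : k • pr.toTr h = pr.toTr (k • h) := rfl
      have e' : rankOne (k • h) m = k • rankOne h m := LinearMap.ext fun x => by
        simp [rankOne_apply]
      rw [e, AddMonoidHom.mk'_apply, hγ, hγ, e', map_smul, smul_eq_mul])
    (fun r m t => by
      obtain ⟨h, rfl⟩ := pr.toTr_surjective t
      have e : op r • pr.toTr h = pr.toTr (op r • h) := rfl
      have e' : rankOne (op r • h) m = rankOne h (r • m) := LinearMap.ext fun x => by
        simp [rankOne_apply, mul_smul]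
      rw [e, AddMonoidHom.mk'_apply, hγ, ← e', ← hγ])
  have h1 : ∀ m h, L (rankOne h m) = 0 := fun m h => by
    rw [← hγ]
    exact DFunLike.congr_fun (DFunLike.congr_fun h0 m) _
  refine hL (LinearMap.ext fun φ => ?_)
  obtain ⟨n, a, f, hf⟩ := exists_dualBasis R pr.P₁
  have : φ = ∑ i, rankOne (f i) (φ (a i)) := LinearMap.ext fun x => by
    conv_lhs => rw [← hf x]
    simp [rankOne_apply]
  rw [this, map_sum]
  exact Finset.sum_eq_zero fun i _ => h1 _ _

lemma noForms_iff [Module K M] [IsScalarTower K R M] (pr : MinPres R M) :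
    NoForms K pr ↔ ∀ φ : pr.P₁ →ₗ[R] M, ∃ ψ : pr.P₀ →ₗ[R] M, ψ ∘ₗ pr.d = φ :=
  ⟨surjective_of_noForms pr, noForms_of_surjective pr⟩

lemma isTauRigid_iff : IsTauRigid R K M ↔ ∀ pr : MinPres R M, NoForms K pr := by
  refine forall_congr' fun pr => ⟨fun H β h₁ h₂ => ?_, fun H f => ?_⟩
  · let g : M →ₗ[R] pr.tau K :=
      { toFun := fun m => (⟨(β m).toAddHom, fun k t => h₁ m t k⟩ : pr.Tr →ₗ[K] K)
        map_add' := fun m m' => LinearMap.ext fun t => by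
          change β (m + m') t = β m t + β m' t
          rw [map_add]; rfl
        map_smul' := fun r m => LinearMap.ext fun t => h₂ r m t }
    have := H g
    ext m t
    exact LinearMap.congr_fun (LinearMap.congr_fun this m) t
  · have := H (AddMonoidHom.mk' (fun m => (OpDual.toL R K pr.Tr (f m)).toAddMonoidHom)
      fun m m' => by rw [map_add]; rfl)
      (fun m t k => map_smul (OpDual.toL R K pr.Tr (f m)) k t)
      (fun r m t => by
        change OpDual.toL R K pr.Tr (f (r • m)) t = _
        rw [map_smul]; rfl)
    refine LinearMap.ext fun m => LinearMap.ext fun t => ?_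
    exact DFunLike.congr_fun (DFunLike.congr_fun this m) t

end Forms

section TauPairs

variable {R : Type u} [Ring R] {K : Type u} [Field K] [Algebra K R]

lemma Pres.presilting_iff_isTauRigid [IsArtinianRing R] {A B M P : Type u} [AddCommGroup A]
    [Module R A] [AddCommGroup B] [Module R B] [AddCommGroup M] [Module R M] [AddCommGroup P]
    [Module R P] [Module.Finite R A] [Module.Finite R B] [Module.Projective R A]
    [Module.Projective R B] [Module K M] [IsScalarTower K R M] {d : A →ₗ[R] B}
    (h : Pres R d M P) :
    Presilting R d ↔ IsTauRigid R K M ∧ ∀ f : P →ₗ[R] M, f = 0 := by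
  rw [isTauRigid_iff]
  simp only [noForms_iff]
  have := h.finite_left
  obtain ⟨pr⟩ := exists_minPres (R := R) (M := M)
  exact ⟨fun H => ⟨fun pr => ((h.presilting_iff pr).mp H).1, ((h.presilting_iff pr).mp H).2⟩,
    fun H => (h.presilting_iff pr).mpr ⟨H.1 pr, H.2⟩⟩

lemma Dag.isTauRigid {S T : Type u} [Ring S] [AddCommGroup T] [Module R T] [Module S T]
    [Algebra K S] [IsArtinianRing R] [IsArtinianRing S] {M P Z Q : Type u} [AddCommGroup M]
    [Module R M] [AddCommGroup P] [Module R P] [AddCommGroup Z] [Module S Z] [AddCommGroup Q]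
    [Module S Q] [Module K M] [IsScalarTower K R M] [Module K Z] [IsScalarTower K S Z]
    (h : Dag R S T M P Z Q) (H : IsTauRigid R K M ∧ ∀ f : P →ₗ[R] M, f = 0) :
    IsTauRigid S K Z ∧ ∀ f : Q →ₗ[S] Z, f = 0 := by
  obtain ⟨A, B, A', B', p, q, d, d', ⟨h₁, h₂, h₃, h₄⟩, ⟨h₅, h₆, h₇, h₈⟩, hd, h, h'⟩ := h
  exact h'.presilting_iff_isTauRigid.mp (hd.presilting (h.presilting_iff_isTauRigid.mpr H))

lemma isTauInvRigid_iff {M : Type u} [AddCommGroup M] [Module R M] [Module K M]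
    [IsScalarTower K R M] [FiniteDimensional K M] :
    IsTauInvRigid R K M ↔ IsTauRigid Rᵐᵒᵖ K (LDual R K M) := by
  rw [isTauRigid_iff]
  refine forall_congr' fun pr => ⟨fun H β h₁ h₂ => ?_, fun H f h => ?_⟩
  · let γ : pr.Tr →+ (Module.Dual K (Module.Dual K M)) := AddMonoidHom.mk'
      (fun t => (⟨(β.flip t).toAddHom, fun k m => by
        have e : k • m = algebraMap K Rᵐᵒᵖ k • (show LDual R K M from m) :=
          (algebraMap_smul Rᵐᵒᵖ k (show LDual R K M from m)).symm
        have e' : op (algebraMap K Rᵐᵒᵖ k) • t = k • t := algebraMap_smul Rᵐᵒᵖᵐᵒᵖ k t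
        change β (k • m) t = k * β m t
        rw [e, h₂, e', h₁]⟩ : Module.Dual K M →ₗ[K] K))
      fun t t' => LinearMap.ext fun m => map_add (β m) t t'
    let f : pr.Tr →+ M := (Module.evalEquiv K M).symm.toLinearMap.toAddMonoidHom.comp γ
    have hf : ∀ (m : LDual R K M) t, LDual.toL R K M m (f t) = β m t := fun m t =>
      LinearMap.congr_fun ((Module.evalEquiv K M).apply_symm_apply (γ t)) (LDual.toL R K M m)
    have h0 := H f fun r t => by
      rw [← sub_eq_zero, ← Module.forall_dual_apply_eq_zero_iff K]
      intro m
      have e : m (r • f t) = LDual.toL R K M (op r • (show LDual R K M from m)) (f t) := rfl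
      rw [map_sub, e, hf, h₂, ← hf]
      exact sub_self _
    ext m t
    rw [← hf, h0]
    exact map_zero (LDual.toL R K M m)
  · have hk : ∀ (k : K) t, f (k • t) = k • f t := fun k t => by
      have := h (algebraMap K R k) t
      have e : op (op (algebraMap K R k)) • t = k • t := algebraMap_smul Rᵐᵒᵖᵐᵒᵖ k t
      rwa [e, algebraMap_smul] at this
    have h0 := H (AddMonoidHom.mk' (fun m => (LDual.toL R K M m).toAddMonoidHom.comp f)
        fun m m' => rfl)
      (fun m t k => by
        change LDual.toL R K M m (f (k • t)) = k * LDual.toL R K M m (f t)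
        rw [hk, map_smul, smul_eq_mul])
      (fun r m t => by
        change LDual.toL R K M (r • m) (f t) = LDual.toL R K M m (f (op r • t))
        rw [LDual.smul_toL, ← h]; rfl)
    ext t
    rw [AddMonoidHom.zero_apply, ← Module.forall_dual_apply_eq_zero_iff K]
    exact fun m => DFunLike.congr_fun (DFunLike.congr_fun h0 m) t

end TauPairs

section Step

lemma exists_int_sequence {α : Type*} {C : α → Prop} {r : α → α → Prop}
    (h : ∀ a, C a → (∃ b, C b ∧ r b a) ∧ ∃ b, C b ∧ r a b) {a : α} (ha : C a) :
    ∃ f : ℤ → α, f 0 = a ∧ ∀ n, r (f n) (f (n + 1)) := by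
  choose p hp using fun x : {a // C a} => (h x.1 x.2).1
  choose s hs using fun x : {a // C a} => (h x.1 x.2).2
  let P : {a // C a} → {a // C a} := fun x => ⟨p x, (hp x).1⟩
  let S : {a // C a} → {a // C a} := fun x => ⟨s x, (hs x).1⟩
  let f : ℤ → {a // C a} := fun n => match n with
    | .ofNat k => S^[k] ⟨a, ha⟩
    | .negSucc k => P^[k + 1] ⟨a, ha⟩
  refine ⟨fun n => (f n).1, rfl, fun n => ?_⟩
  change r (f n).1 (f (n + 1)).1
  match n with
  | .ofNat k =>
    have : f (Int.ofNat k + 1) = S (f (Int.ofNat k)) := iterate_succ_apply' S k _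
    rw [this]; exact (hs _).2
  | .negSucc 0 => exact (hp ⟨a, ha⟩).2
  | .negSucc (k + 1) =>
    have h₁ : f (Int.negSucc (k + 1)) = P (f (Int.negSucc k)) := iterate_succ_apply' P (k + 1) _
    have h₂ : Int.negSucc (k + 1) + 1 = Int.negSucc k := by omega
    rw [h₁, h₂]; exact (hp _).2

variable (R : Type u) [Ring R]

/-- `Step R Φ Y X`: there is a short exact sequence `0 → Y → P → X → 0` satisfying `Φ`. -/
def Step (Φ : ∀ ⦃Y P X : ModuleCat.{u} R⦄, (Y →ₗ[R] P) → (P →ₗ[R] X) → Prop)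
    (Y X : ModuleCat.{u} R) : Prop :=
  ∃ (P : ModuleCat.{u} R) (i : Y →ₗ[R] P) (π : P →ₗ[R] X),
    Injective i ∧ Surjective π ∧ Exact i π ∧ Φ i π

/-- Every object of the class `C` is the end and the start of a step inside `C`. -/
def IsStable (Φ : ∀ ⦃Y P X : ModuleCat.{u} R⦄, (Y →ₗ[R] P) → (P →ₗ[R] X) → Prop)
    (C : ModuleCat.{u} R → Prop) : Prop :=
  ∀ X, C X → (∃ Y, C Y ∧ Step R Φ Y X) ∧ ∃ Y, C Y ∧ Step R Φ X Y

/-- The middle term is finitely generated projective, and maps to `R` extend to it. -/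
def GPCond ⦃Y P X : ModuleCat.{u} R⦄ (i : Y →ₗ[R] P) (_ : P →ₗ[R] X) : Prop :=
  Module.Finite R P ∧ Module.Projective R P ∧ ∀ φ : Y →ₗ[R] R, ∃ ψ : P →ₗ[R] R, ψ ∘ₗ i = φ

/-- The middle term is finitely generated injective, and maps from `T` lift to it. -/
def GICond (T : Type u) [AddCommGroup T] [Module R T] ⦃Y P X : ModuleCat.{u} R⦄
    (_ : Y →ₗ[R] P) (π : P →ₗ[R] X) : Prop :=
  Module.Finite R P ∧ Module.Injective R P ∧ ∀ φ : T →ₗ[R] X, ∃ ψ : T →ₗ[R] P, π ∘ₗ ψ = φ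

variable {R} {M : Type u} [AddCommGroup M] [Module R M]

lemma IsStable.isGP {C : ModuleCat.{u} R → Prop} (hC : IsStable R (GPCond R) C)
    (h : C (.of R M)) : IsGP R M := by
  obtain ⟨X, h₀, hX⟩ := exists_int_sequence hC h
  choose P i π hi hπ he hP using hX
  refine ⟨fun n => P n, inferInstance, inferInstance, fun n => i (n + 1) ∘ₗ π n, fun n => (hP n).1,
    fun n => (hP n).2.1, fun n => ?_, fun n g => ⟨fun hg => ?_, ?_⟩, ?_⟩
  · intro y
    rw [LinearMap.comp_apply, map_eq_zero_iff _ (hi _), he]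
    exact ⟨fun ⟨x, hx⟩ => by
        obtain ⟨z, rfl⟩ := hπ n x
        exact ⟨z, hx⟩, fun ⟨z, hz⟩ => ⟨π n z, hz⟩⟩
  · have hker : LinearMap.ker (π (n + 1)) ≤ LinearMap.ker g := fun y hy => by
      obtain ⟨x, rfl⟩ := (he _ _).1 hy
      obtain ⟨z, rfl⟩ := hπ n x
      exact LinearMap.congr_fun hg z
    obtain ⟨φ, hφ⟩ : ∃ φ : X (n + 1 + 1) →ₗ[R] R, φ ∘ₗ π (n + 1) = g :=
      ⟨(LinearMap.ker (π (n + 1))).liftQ g hker ∘ₗ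
        ((π (n + 1)).quotKerEquivOfSurjective (hπ _)).symm.toLinearMap, by
        ext x
        have : ((π (n + 1)).quotKerEquivOfSurjective (hπ _)).symm (π (n + 1) x) =
            Submodule.Quotient.mk x := by
          rw [LinearEquiv.symm_apply_eq]; rfl
        simp [this]⟩
    obtain ⟨ψ, hψ⟩ := (hP (n + 1 + 1)).2.2 φ
    exact ⟨ψ, by rw [← hφ, ← hψ]; rfl⟩
  · rintro ⟨ψ, rfl⟩
    ext x
    have : π (n + 1) (i (n + 1) (π n x)) = 0 := (he _ _).2 ⟨_, rfl⟩
    simp [this]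
  · have hr : LinearMap.range (i (-1 + 1) ∘ₗ π (-1)) = LinearMap.range (i 0) := by
      rw [LinearMap.range_comp, LinearMap.range_eq_top.2 (hπ _), Submodule.map_top]; rfl
    have e : M ≃ₗ[R] X 0 := h₀ ▸ LinearEquiv.refl R M
    exact ⟨e.trans ((LinearEquiv.ofInjective (i 0) (hi 0)).trans (LinearEquiv.ofEq _ _ hr.symm))⟩

lemma IsStable.isGI {K : Type u} [Field K] [Algebra K R] {C : ModuleCat.{u} R → Prop}
    (hC : IsStable R (GICond R (OpDual R K R)) C) (h : C (.of R M)) : IsGI R K M := by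
  obtain ⟨X, h₀, hX⟩ := exists_int_sequence hC h
  choose P i π hi hπ he hP using hX
  refine ⟨fun n => P n, inferInstance, inferInstance, fun n => i (n + 1) ∘ₗ π n, fun n => (hP n).1,
    fun n => (hP n).2.1, fun n => ?_, fun n g => ⟨fun hg => ?_, ?_⟩, ?_⟩
  · intro y
    rw [LinearMap.comp_apply, map_eq_zero_iff _ (hi _), he]
    exact ⟨fun ⟨x, hx⟩ => by
        obtain ⟨z, rfl⟩ := hπ n x
        exact ⟨z, hx⟩, fun ⟨z, hz⟩ => ⟨π n z, hz⟩⟩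
  · have hg' : ∀ t, ∃ x, i (n + 1) x = g t := fun t =>
      (he _ _).1 (hi (n + 1 + 1) (by rw [map_zero]; exact LinearMap.congr_fun hg t))
    obtain ⟨φ, hφ⟩ : ∃ φ : OpDual R K R →ₗ[R] X (n + 1), i (n + 1) ∘ₗ φ = g :=
      ⟨(LinearEquiv.ofInjective _ (hi (n + 1))).symm.toLinearMap ∘ₗ g.codRestrict _ hg', by
        ext x
        have := (LinearEquiv.ofInjective _ (hi (n + 1))).apply_symm_apply (g.codRestrict _ hg' x)
        exact congrArg Subtype.val this⟩
    obtain ⟨ψ, hψ⟩ := (hP n).2.2 φ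
    exact ⟨ψ, by rw [← hφ, ← hψ]; rfl⟩
  · rintro ⟨ψ, rfl⟩
    ext x
    have : π (n + 1) (i (n + 1) (π n (ψ x))) = 0 := (he _ _).2 ⟨_, rfl⟩
    simp [this]
  · have hr : LinearMap.range (i (-1 + 1) ∘ₗ π (-1)) = LinearMap.range (i 0) := by
      rw [LinearMap.range_comp, LinearMap.range_eq_top.2 (hπ _), Submodule.map_top]; rfl
    have e : M ≃ₗ[R] X 0 := h₀ ▸ LinearEquiv.refl R M
    exact ⟨e.trans ((LinearEquiv.ofInjective (i 0) (hi 0)).trans (LinearEquiv.ofEq _ _ hr.symm))⟩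

lemma IsGP.exists_isStable (h : IsGP R M) :
    ∃ C, IsStable R (GPCond R) C ∧ C (.of R M) := by
  obtain ⟨P, _, _, d, hf, hp, he, hx, ⟨e⟩⟩ := h
  refine ⟨fun X => ∃ n, Nonempty (X ≃ₗ[R] LinearMap.range (d n)), fun X ⟨n, ⟨e⟩⟩ => ?_, -1, ⟨e⟩⟩
  have step : ∀ n, ∀ Y Z : ModuleCat.{u} R, (Y ≃ₗ[R] LinearMap.range (d n)) →
      (Z ≃ₗ[R] LinearMap.range (d (n + 1))) → Step R (GPCond R) Y Z := by
    intro n Y Z f g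
    refine ⟨.of R (P (n + 1)), (LinearMap.range (d n)).subtype ∘ₗ f.toLinearMap,
      g.symm.toLinearMap ∘ₗ (d (n + 1)).rangeRestrict,
      Subtype.val_injective.comp f.injective,
      g.symm.surjective.comp (d (n + 1)).surjective_rangeRestrict, fun y => ?_, hf _, hp _,
      fun φ => ?_⟩
    · rw [LinearMap.comp_apply, LinearEquiv.coe_coe, LinearEquiv.map_eq_zero_iff]
      have : (d (n + 1)).rangeRestrict y = 0 ↔ d (n + 1) y = 0 := Subtype.ext_iff
      rw [this, he]
      exact ⟨fun ⟨x, hx⟩ => ⟨f.symm ⟨y, x, hx⟩, by simp⟩, fun ⟨x, hx⟩ => by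
        rw [← hx]; exact (f x).2⟩
    · obtain ⟨m, rfl⟩ : ∃ m, n = m + 1 := ⟨n - 1, by omega⟩
      obtain ⟨ψ, hψ⟩ := (hx m ((φ ∘ₗ f.symm.toLinearMap) ∘ₗ (d (m + 1)).rangeRestrict)).1 (by
        ext x
        have : (d (m + 1)).rangeRestrict (d m x) = 0 := Subtype.ext ((he m _).2 ⟨x, rfl⟩)
        simp [this])
      refine ⟨ψ, LinearMap.ext fun y => ?_⟩
      obtain ⟨x, hx⟩ := (d (m + 1)).surjective_rangeRestrict (f y)
      have := LinearMap.congr_fun hψ x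
      simp only [LinearMap.comp_apply, hx, LinearEquiv.coe_coe, LinearEquiv.symm_apply_apply] at this
      rw [← this, LinearMap.comp_apply, LinearMap.comp_apply, LinearEquiv.coe_coe, ← hx]; rfl
  constructor
  · obtain ⟨m, rfl⟩ : ∃ m, n = m + 1 := ⟨n - 1, by omega⟩
    exact ⟨.of R (LinearMap.range (d m)), ⟨m, ⟨LinearEquiv.refl R _⟩⟩,
      step m _ _ (LinearEquiv.refl R _) e⟩
  · exact ⟨.of R (LinearMap.range (d (n + 1))), ⟨n + 1, ⟨LinearEquiv.refl R _⟩⟩,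
      step n _ _ e (LinearEquiv.refl R _)⟩

lemma IsGI.exists_isStable {K : Type u} [Field K] [Algebra K R] (h : IsGI R K M) :
    ∃ C, IsStable R (GICond R (OpDual R K R)) C ∧ C (.of R M) := by
  obtain ⟨P, _, _, d, hf, hp, he, hx, ⟨e⟩⟩ := h
  refine ⟨fun X => ∃ n, Nonempty (X ≃ₗ[R] LinearMap.range (d n)), fun X ⟨n, ⟨e⟩⟩ => ?_, -1, ⟨e⟩⟩
  have step : ∀ n, ∀ Y Z : ModuleCat.{u} R, (Y ≃ₗ[R] LinearMap.range (d n)) →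
      (Z ≃ₗ[R] LinearMap.range (d (n + 1))) → Step R (GICond R (OpDual R K R)) Y Z := by
    intro n Y Z f g
    refine ⟨.of R (P (n + 1)), (LinearMap.range (d n)).subtype ∘ₗ f.toLinearMap,
      g.symm.toLinearMap ∘ₗ (d (n + 1)).rangeRestrict,
      Subtype.val_injective.comp f.injective,
      g.symm.surjective.comp (d (n + 1)).surjective_rangeRestrict, fun y => ?_, hf _, hp _,
      fun φ => ?_⟩
    · rw [LinearMap.comp_apply, LinearEquiv.coe_coe, LinearEquiv.map_eq_zero_iff]
      have : (d (n + 1)).rangeRestrict y = 0 ↔ d (n + 1) y = 0 := Subtype.ext_iff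
      rw [this, he]
      exact ⟨fun ⟨x, hx⟩ => ⟨f.symm ⟨y, x, hx⟩, by simp⟩, fun ⟨x, hx⟩ => by
        rw [← hx]; exact (f x).2⟩
    · obtain ⟨ψ, hψ⟩ := (hx (n + 1) ((LinearMap.range (d (n + 1))).subtype ∘ₗ
        g.toLinearMap ∘ₗ φ)).1 (by
          ext x
          exact (he (n + 1) _).2 (g (φ x)).2)
      refine ⟨ψ, LinearMap.ext fun y => ?_⟩
      rw [LinearMap.comp_apply, LinearMap.comp_apply, LinearEquiv.coe_coe,
        LinearEquiv.symm_apply_eq]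
      exact Subtype.ext (LinearMap.congr_fun hψ y)
  constructor
  · obtain ⟨m, rfl⟩ : ∃ m, n = m + 1 := ⟨n - 1, by omega⟩
    exact ⟨.of R (LinearMap.range (d m)), ⟨m, ⟨LinearEquiv.refl R _⟩⟩,
      step m _ _ (LinearEquiv.refl R _) e⟩
  · exact ⟨.of R (LinearMap.range (d (n + 1))), ⟨n + 1, ⟨LinearEquiv.refl R _⟩⟩,
      step n _ _ e (LinearEquiv.refl R _)⟩

end Step

section Syzygy

variable {R : Type u} [Ring R] {M N : Type u} [AddCommGroup M] [Module R M] [AddCommGroup N]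
  [Module R N]

lemma isStable_isGP : IsStable R (GPCond R) (fun X => IsGP R X) := fun X hX => by
  obtain ⟨C, hC, hX⟩ := hX.exists_isStable
  obtain ⟨⟨Y, hY, h⟩, ⟨Y', hY', h'⟩⟩ := hC _ hX
  exact ⟨⟨Y, hC.isGP hY, h⟩, ⟨Y', hC.isGP hY', h'⟩⟩

/-- Schanuel's lemma. -/
lemma nonempty_ker_prod_equiv {P Q : Type u} [AddCommGroup P] [Module R P] [AddCommGroup Q]
    [Module R Q] [Module.Projective R P] [Module.Projective R Q] {f : P →ₗ[R] M} {g : Q →ₗ[R] M}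
    (hf : Surjective f) (hg : Surjective g) :
    Nonempty ((LinearMap.ker f × Q) ≃ₗ[R] (LinearMap.ker g × P)) := by
  obtain ⟨h, hh⟩ := Module.projective_lifting_property g f hg
  obtain ⟨k, hk⟩ := Module.projective_lifting_property f g hf
  have hh' : ∀ x, g (h x) = f x := LinearMap.congr_fun hh
  have hk' : ∀ x, f (k x) = g x := LinearMap.congr_fun hk
  exact ⟨
    { toFun := fun x => (⟨x.2 - h (x.1 + k x.2), by
          have := x.1.2
          rw [LinearMap.mem_ker] at this ⊢
          simp [hh', hk', this]⟩, x.1 + k x.2)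
      invFun := fun y => (⟨y.2 - k (y.1 + h y.2), by
          have := y.1.2
          rw [LinearMap.mem_ker] at this ⊢
          simp [hh', hk', this]⟩, y.1 + h y.2)
      map_add' := fun x y => by
        ext <;> simp <;> abel
      map_smul' := fun r x => by
        ext <;> simp [smul_sub]
      left_inv := fun x => by
        ext <;> simp
      right_inv := fun y => by
        ext <;> simp }⟩

lemma nonempty_equiv_ker {Y P : Type u} [AddCommGroup P] [Module R P] [AddCommGroup Y]
    [Module R Y] {i : Y →ₗ[R] P} {π : P →ₗ[R] M} (hi : Injective i) (he : Exact i π) :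
    Nonempty (Y ≃ₗ[R] LinearMap.ker π) :=
  ⟨(LinearEquiv.ofInjective i hi).trans
    (LinearEquiv.ofEq _ _ (LinearMap.exact_iff.1 he).symm)⟩

lemma exists_extension_of_exact {Y P B : Type u} [AddCommGroup P] [Module R P] [AddCommGroup Y]
    [Module R Y] [AddCommGroup B] [Module R B] [Module.Projective R P] [Module.Projective R B]
    {i : Y →ₗ[R] P} {π : P →ₗ[R] M} (he : Exact i π) (hπ : Surjective π)
    (hext : ∀ φ : Y →ₗ[R] R, ∃ ψ : P →ₗ[R] R, ψ ∘ₗ i = φ) {b : B →ₗ[R] M} (hb : Surjective b)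
    (φ : LinearMap.ker b →ₗ[R] R) : ∃ ψ : B →ₗ[R] R, ψ ∘ₗ (LinearMap.ker b).subtype = φ := by
  obtain ⟨h, hh⟩ := Module.projective_lifting_property b π hb
  obtain ⟨k, hk⟩ := Module.projective_lifting_property π b hπ
  have hh' : ∀ x, b (h x) = π x := LinearMap.congr_fun hh
  have hk' : ∀ x, π (k x) = b x := LinearMap.congr_fun hk
  obtain ⟨ψ, hψ⟩ := hext (φ ∘ₗ (h ∘ₗ i).codRestrict (LinearMap.ker b) fun y => by
    simp [hh', he.apply_apply_eq_zero])
  refine ⟨ψ ∘ₗ k + φ ∘ₗ (LinearMap.id - h ∘ₗ k).codRestrict (LinearMap.ker b) fun x => by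
    simp [hh', hk'], LinearMap.ext fun x => ?_⟩
  obtain ⟨y, hy⟩ := (he (k x)).1 (by rw [hk']; exact x.2)
  have := LinearMap.congr_fun hψ y
  simp only [LinearMap.comp_apply] at this
  simp only [LinearMap.comp_apply, LinearMap.add_apply, Submodule.subtype_apply, ← hy, this,
    ← map_add]
  congr 1
  ext
  simp [hy]

lemma IsGP.exists_extension (h : IsGP R M) {B : Type u} [AddCommGroup B] [Module R B]
    [Module.Projective R B] {b : B →ₗ[R] M} (hb : Surjective b)
    (φ : LinearMap.ker b →ₗ[R] R) : ∃ ψ : B →ₗ[R] R, ψ ∘ₗ (LinearMap.ker b).subtype = φ := by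
  obtain ⟨⟨Y, -, P, i, π, hi, hπ, he, hf, hp, hx⟩, -⟩ := isStable_isGP (.of R M) h
  exact exists_extension_of_exact he hπ hx hb φ

/-- `X` is Gorenstein projective up to finitely generated projective summands. -/
def IsStablyGP (X : ModuleCat.{u} R) : Prop :=
  ∃ Y Q Q' : ModuleCat.{u} R, IsGP R Y ∧ Module.Finite R Q ∧ Module.Projective R Q ∧
    Module.Finite R Q' ∧ Module.Projective R Q' ∧ Nonempty ((X × Q) ≃ₗ[R] (Y × Q'))

lemma exists_extension_of_projective {X P Q : Type u} [AddCommGroup X] [Module R X]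
    [AddCommGroup P] [Module R P] [AddCommGroup Q] [Module R Q] [Module.Finite R Q]
    [Module.Projective R Q] {i : X →ₗ[R] P} (h : ∀ φ : X →ₗ[R] R, ∃ ψ : P →ₗ[R] R, ψ ∘ₗ i = φ)
    (φ : X →ₗ[R] Q) : ∃ ψ : P →ₗ[R] Q, ψ ∘ₗ i = φ := by
  obtain ⟨n, π, hπ⟩ := Module.Finite.exists_fin' R Q
  obtain ⟨s, hs⟩ := Module.projective_lifting_property π LinearMap.id hπ
  choose ψ hψ using fun j => h (LinearMap.proj j ∘ₗ s ∘ₗ φ)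
  refine ⟨π ∘ₗ LinearMap.pi ψ, LinearMap.ext fun x => ?_⟩
  have : LinearMap.pi ψ (i x) = s (φ x) := funext fun j => LinearMap.congr_fun (hψ j) x
  rw [LinearMap.comp_apply, LinearMap.comp_apply, this]
  exact LinearMap.congr_fun hs _

lemma IsStablyGP.exists_prodStep {X : ModuleCat.{u} R} (h : IsStablyGP X) :
    ∃ Y P Q : ModuleCat.{u} R, IsGP R Y ∧ Module.Finite R P ∧ Module.Projective R P ∧
      Module.Finite R Q ∧ Module.Projective R Q ∧ ∃ (i : Y →ₗ[R] P) (π : P →ₗ[R] (X × Q)),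
      Injective i ∧ Surjective π ∧ Exact i π ∧ ∀ φ : Y →ₗ[R] R, ∃ ψ : P →ₗ[R] R, ψ ∘ₗ i = φ := by
  obtain ⟨Y, Q, Q', hY, _, _, _, _, ⟨e⟩⟩ := h
  obtain ⟨⟨Y₁, hY₁, P, i, π, hi, hπ, he, hf, hp, hx⟩, -⟩ := isStable_isGP Y hY
  refine ⟨Y₁, .of R (P × Q'), Q, hY₁, inferInstanceAs (Module.Finite R (P × Q')),
    inferInstanceAs (Module.Projective R (P × Q')), ‹_›, ‹_›, LinearMap.inl R P Q' ∘ₗ i,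
    e.symm.toLinearMap ∘ₗ π.prodMap LinearMap.id, LinearMap.inl_injective.comp hi,
    e.symm.surjective.comp (hπ.prodMap surjective_id), fun x => ?_, fun φ => ?_⟩
  · obtain ⟨x, q⟩ := x
    rw [LinearMap.comp_apply, LinearEquiv.coe_coe, LinearEquiv.map_eq_zero_iff]
    simp only [LinearMap.prodMap_apply, Prod.mk_eq_zero, he x, LinearMap.id_apply]
    constructor
    · rintro ⟨⟨y, rfl⟩, rfl⟩
      exact ⟨y, rfl⟩
    · rintro ⟨y, hy⟩
      obtain ⟨h₁, h₂⟩ := Prod.ext_iff.1 hy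
      exact ⟨⟨y, h₁⟩, h₂.symm⟩
  · obtain ⟨ψ, hψ⟩ := hx φ
    exact ⟨ψ ∘ₗ LinearMap.fst R P Q', by rw [← hψ]; rfl⟩

lemma IsStablyGP.exists_extension {X : ModuleCat.{u} R} (h : IsStablyGP X) {B : Type u}
    [AddCommGroup B] [Module R B] [Module.Projective R B] {b : B →ₗ[R] X} (hb : Surjective b)
    (φ : LinearMap.ker b →ₗ[R] R) : ∃ ψ : B →ₗ[R] R, ψ ∘ₗ (LinearMap.ker b).subtype = φ := by
  obtain ⟨Y, P, Q, -, -, _, -, _, i, π, hi, hπ, he, hx⟩ := h.exists_prodStep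
  have hk : ∀ x : LinearMap.ker (b.prodMap (LinearMap.id : Q →ₗ[R] Q)), b x.1.1 = 0 := fun x =>
    congrArg Prod.fst x.2
  obtain ⟨ψ, hψ⟩ := exists_extension_of_exact he hπ hx (hb.prodMap (surjective_id (α := Q)))
    (b := b.prodMap LinearMap.id)
    (φ ∘ₗ (LinearMap.fst R B Q ∘ₗ (LinearMap.ker _).subtype).codRestrict _ hk)
  refine ⟨ψ ∘ₗ LinearMap.inl R B Q, LinearMap.ext fun x => ?_⟩
  exact LinearMap.congr_fun hψ ⟨(x, 0), Prod.ext x.2 rfl⟩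

lemma nonempty_ker_prodMap_equiv {B Q : Type u} [AddCommGroup B] [Module R B] [AddCommGroup Q]
    [Module R Q] (b : B →ₗ[R] M) :
    Nonempty (LinearMap.ker (b.prodMap (LinearMap.id : Q →ₗ[R] Q)) ≃ₗ[R] LinearMap.ker b) :=
  (nonempty_equiv_ker (i := LinearMap.inl R B Q ∘ₗ (LinearMap.ker b).subtype)
    (LinearMap.inl_injective.comp Subtype.val_injective) fun x => by
      simp only [LinearMap.prodMap_apply, Prod.mk_eq_zero, LinearMap.id_apply]
      constructor
      · rintro ⟨h₁, h₂⟩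
        exact ⟨⟨x.1, h₁⟩, Prod.ext rfl h₂.symm⟩
      · rintro ⟨y, rfl⟩
        exact ⟨y.2, rfl⟩).map LinearEquiv.symm

lemma IsStablyGP.ker {X : ModuleCat.{u} R} (h : IsStablyGP X) {B : Type u} [AddCommGroup B]
    [Module R B] [Module.Finite R B] [Module.Projective R B] {b : B →ₗ[R] X}
    (hb : Surjective b) : IsStablyGP (.of R (LinearMap.ker b)) := by
  obtain ⟨Y, P, Q, hY, _, _, _, _, i, π, hi, hπ, he, hx⟩ := h.exists_prodStep
  obtain ⟨e₁⟩ := nonempty_equiv_ker hi he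
  obtain ⟨e₂⟩ := nonempty_ker_prodMap_equiv (Q := Q) b
  obtain ⟨e₃⟩ := nonempty_ker_prod_equiv (hb.prodMap (surjective_id (α := Q)))
    (f := b.prodMap LinearMap.id) hπ
  exact ⟨Y, P, .of R (B × Q), hY, ‹_›, ‹_›, inferInstanceAs (Module.Finite R (B × Q)),
    inferInstanceAs (Module.Projective R (B × Q)),
    ⟨(e₂.symm.prodCongr (LinearEquiv.refl R P)).trans
      (e₃.trans (e₁.symm.prodCongr (LinearEquiv.refl R (B × Q))))⟩⟩

lemma IsStablyGP.finite {X : ModuleCat.{u} R} (h : IsStablyGP X) : Module.Finite R X := by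
  obtain ⟨Y, P, Q, -, _, -, -, -, i, π, -, hπ, -⟩ := h.exists_prodStep
  exact Module.Finite.of_surjective (LinearMap.fst R X Q ∘ₗ π) (Prod.fst_surjective.comp hπ)

lemma isStable_isStablyGP : IsStable R (GPCond R) (IsStablyGP (R := R)) := by
  intro X hX
  constructor
  · have := hX.finite
    obtain ⟨n, b, hb⟩ := Module.Finite.exists_fin' R X
    exact ⟨_, hX.ker hb, .of R (Fin n → R), (LinearMap.ker b).subtype, b, Subtype.val_injective, hb,
      LinearMap.exact_subtype_ker_map b, inferInstanceAs (Module.Finite R (Fin n → R)),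
      inferInstanceAs (Module.Projective R (Fin n → R)), hX.exists_extension hb⟩
  · obtain ⟨Y, Q, Q', hY, _, _, _, _, ⟨e⟩⟩ := hX
    obtain ⟨-, ⟨Y', hY', P, i, π, hi, hπ, he, hf, hp, hx⟩⟩ := isStable_isGP Y hY
    let j : (X × Q) →ₗ[R] (P × Q') := i.prodMap LinearMap.id ∘ₗ e.toLinearMap
    have hj : Injective j := (hi.prodMap injective_id).comp e.injective
    have hjx : ∀ φ : (X × Q) →ₗ[R] R, ∃ ψ : (P × Q') →ₗ[R] R, ψ ∘ₗ j = φ := fun φ => by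
      obtain ⟨ψ, hψ⟩ := hx (φ ∘ₗ e.symm.toLinearMap ∘ₗ LinearMap.inl R Y Q')
      refine ⟨ψ.coprod (φ ∘ₗ e.symm.toLinearMap ∘ₗ LinearMap.inr R Y Q'), ?_⟩
      have : ψ.coprod (φ ∘ₗ e.symm.toLinearMap ∘ₗ LinearMap.inr R Y Q') ∘ₗ
          i.prodMap LinearMap.id = φ ∘ₗ e.symm.toLinearMap := by
        ext x
        · have h₀ : ((0 : Y), (0 : Q')) = 0 := rfl
          simpa [h₀] using LinearMap.congr_fun hψ x
        · simp
      rw [← LinearMap.comp_assoc, this]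
      ext <;> simp
    let k := j ∘ₗ LinearMap.inl R X Q
    have hker : LinearMap.range k ≤ LinearMap.ker (π ∘ₗ LinearMap.fst R P Q') := by
      rintro _ ⟨x, rfl⟩
      exact he.apply_apply_eq_zero _
    obtain ⟨ρ, hρ⟩ := exists_extension_of_projective hjx (LinearMap.snd R X Q)
    have hρk : LinearMap.range k ≤ LinearMap.ker ρ := by
      rintro _ ⟨x, rfl⟩
      exact LinearMap.congr_fun hρ (x, 0)
    let f : Q →ₗ[R] ((P × Q') ⧸ LinearMap.range k) :=
      (LinearMap.range k).mkQ ∘ₗ j ∘ₗ LinearMap.inr R X Q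
    let g := (LinearMap.range k).liftQ _ hker
    have hg : Surjective g := fun y => by
      obtain ⟨x, rfl⟩ := hπ y
      exact ⟨Submodule.Quotient.mk (x, 0), rfl⟩
    have hfg : Exact f g := fun y => by
      obtain ⟨⟨x, q⟩, rfl⟩ := Submodule.mkQ_surjective _ y
      have : g ((LinearMap.range k).mkQ (x, q)) = π x := rfl
      rw [this, he]
      constructor
      · rintro ⟨z, rfl⟩
        refine ⟨(e.symm (z, q)).2, ?_⟩
        refine (Submodule.Quotient.eq _).2 ⟨-(e.symm (z, q)).1, ?_⟩
        have : j (e.symm (z, q)) = (i z, q) := by simp [j]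
        change j (-(e.symm (z, q)).1, 0) = j (0, (e.symm (z, q)).2) - (i z, q)
        rw [← this, ← map_sub]
        congr 1
        ext <;> simp
      · rintro ⟨y, hy⟩
        have := congrArg g hy
        have h₀ : g (f y) = π (i (e (0, y)).1) := rfl
        rw [h₀, he.apply_apply_eq_zero] at this
        exact (he x).1 this.symm
    have hfr : (LinearMap.range k).liftQ ρ hρk ∘ₗ f = LinearMap.id :=
      LinearMap.ext fun q => LinearMap.congr_fun hρ (0, q)
    have hE := (hfg.splitInjectiveEquiv hg ⟨_, hfr⟩).1
    refine ⟨.of R ((P × Q') ⧸ LinearMap.range k),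
      ⟨Y', .of R PUnit.{u + 1}, Q, hY', inferInstanceAs (Module.Finite R PUnit.{u + 1}),
        inferInstanceAs (Module.Projective R PUnit.{u + 1}), ‹_›, ‹_›, ⟨?_⟩⟩,
      .of R (P × Q'), k, (LinearMap.range k).mkQ, hj.comp LinearMap.inl_injective,
      Submodule.mkQ_surjective _, LinearMap.exact_map_mkQ_range k,
      inferInstanceAs (Module.Finite R (P × Q')), inferInstanceAs (Module.Projective R (P × Q')),
      fun φ => ?_⟩
    · exact LinearEquiv.prodUnique.trans (hE.trans (LinearEquiv.prodComm R Q Y'))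
    · obtain ⟨ψ, hψ⟩ := hjx (φ ∘ₗ LinearMap.fst R X Q)
      exact ⟨ψ, by rw [← LinearMap.comp_assoc, hψ]; rfl⟩

lemma IsGP.ker (h : IsGP R M) {B : Type u} [AddCommGroup B] [Module R B] [Module.Finite R B]
    [Module.Projective R B] {b : B →ₗ[R] M} (hb : Surjective b) :
    IsGP R (LinearMap.ker b) := by
  have : IsStablyGP (.of R M) := ⟨.of R M, .of R PUnit.{u + 1}, .of R PUnit.{u + 1}, h,
    inferInstanceAs (Module.Finite R PUnit.{u + 1}), inferInstanceAs (Module.Projective R PUnit.{u + 1}),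
    inferInstanceAs (Module.Finite R PUnit.{u + 1}), inferInstanceAs (Module.Projective R PUnit.{u + 1}),
    ⟨LinearEquiv.refl R _⟩⟩
  exact isStable_isStablyGP.isGP (this.ker hb)

lemma IsGP.finite (h : IsGP R M) : Module.Finite R M := by
  obtain ⟨⟨Y, -, P, i, π, hi, hπ, he, hf, hp, hx⟩, -⟩ := isStable_isGP (.of R M) h
  exact Module.Finite.of_surjective (M := P) (P := M) π hπ

end Syzygy

section DagGP

lemma exists_factor {R A B C : Type u} [Ring R] [AddCommGroup A] [Module R A] [AddCommGroup B]
    [Module R B] [AddCommGroup C] [Module R C] {π : A →ₗ[R] B} (hπ : Surjective π)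
    {f : A →ₗ[R] C} (h : LinearMap.ker π ≤ LinearMap.ker f) : ∃ g : B →ₗ[R] C, ∀ x, g (π x) = f x :=
  ⟨(LinearMap.ker π).liftQ f h ∘ₗ (π.quotKerEquivOfSurjective hπ).symm.toLinearMap, fun x => by
    have : (π.quotKerEquivOfSurjective hπ).symm (π x) = Submodule.Quotient.mk x := by
      rw [LinearEquiv.symm_apply_eq]; rfl
    simp [this]⟩

lemma forall_exists_extension_congr {R Y P T T' : Type u} [Ring R] [AddCommGroup Y] [Module R Y]
    [AddCommGroup P] [Module R P] [AddCommGroup T] [Module R T] [AddCommGroup T'] [Module R T']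
    (e : T ≃ₗ[R] T') {i : Y →ₗ[R] P} (h : ∀ φ : Y →ₗ[R] T, ∃ ψ : P →ₗ[R] T, ψ ∘ₗ i = φ)
    (φ : Y →ₗ[R] T') : ∃ ψ : P →ₗ[R] T', ∀ y, ψ (i y) = φ y := by
  obtain ⟨ψ, hψ⟩ := h (e.symm.toLinearMap ∘ₗ φ)
  exact ⟨e.toLinearMap ∘ₗ ψ, fun y => by simpa using congrArg e (LinearMap.congr_fun hψ y)⟩

variable {R S T : Type u} [Ring R] [Ring S] [AddCommGroup T] [Module R T] [Module S T]

/-- A module in perfect pairing with the regular module is the target of the pairing. -/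
lemma DualPair.nonempty_equiv_self {A : Type u} [AddCommGroup A] [Module R A]
    (u : DualPair R S T A S) : Nonempty (A ≃ₗ[R] T) := by
  refine ⟨LinearEquiv.ofBijective (u.left 1) ⟨?_, fun t => ?_⟩⟩
  · rw [injective_iff_map_eq_zero]
    intro r hr
    refine u.ext_left r fun s => ?_
    have := u.smul_right s r 1
    rw [smul_eq_mul, mul_one] at this
    rw [this, ← DualPair.left_apply, hr, smul_zero]
  · obtain ⟨r, hr⟩ := u.exists_left (LinearMap.toSpanSingleton S T t)
    exact ⟨r, by simp [hr]⟩

variable (R S T) in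
/-- Cokernels of the transposes of presentations of Gorenstein projective modules. -/
def IsTransposeOfGP (Z : ModuleCat.{u} S) : Prop :=
  ∃ (A B M : ModuleCat.{u} R) (A' B' : ModuleCat.{u} S) (p : DualPair R S T A A')
    (q : DualPair R S T B B') (d : A →ₗ[R] B) (d' : B' →ₗ[S] A') (π : B →ₗ[R] M) (ω : A' →ₗ[S] Z),
    (Module.Finite R A ∧ Module.Projective R A ∧ Module.Finite R B ∧ Module.Projective R B) ∧
    (Module.Finite S A' ∧ Module.Projective S A' ∧ Module.Finite S B' ∧ Module.Projective S B') ∧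
    p.IsTr q d d' ∧ Surjective π ∧ Exact d π ∧ Surjective ω ∧ Exact d' ω ∧ IsGP R M

lemma isStable_isTransposeOfGP [IsNoetherianRing R] (u : DualPair R S T R S) :
    IsStable S (GPCond S) (IsTransposeOfGP R S T) := by
  obtain ⟨uR⟩ := u.nonempty_equiv_self
  obtain ⟨uS⟩ := u.symm.nonempty_equiv_self
  rintro Z ⟨A, B, M, A', B', p, q, d, d', π, ω, ⟨_, _, _, _⟩, ⟨_, _, _, _⟩, hd, hπ, he, hω, he', hM⟩
  constructor
  · obtain ⟨-, M₁, hM₁, Q, i, ρ, hi, hρ, hiρ, _, _, hx⟩ := isStable_isGP M hM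
    obtain ⟨Q', _, _, _, _, ⟨s⟩⟩ := u.exists_dual Q
    obtain ⟨j', hj⟩ := DualPair.exists_isTr q s (i ∘ₗ π)
    refine ⟨.of S (LinearMap.range d'), ⟨B, Q, M₁, B', .of S Q', q, s, i ∘ₗ π, j', ρ,
      d'.rangeRestrict, ⟨‹_›, ‹_›, ‹_›, ‹_›⟩, ⟨‹_›, ‹_›, ‹_›, ‹_›⟩, hj, hρ, ?_, d'.surjective_rangeRestrict, ?_, hM₁⟩,
      A', (LinearMap.range d').subtype, ω, Subtype.val_injective, hω, ?_, ‹_›, ‹_›, fun φ => ?_⟩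
    · intro x
      rw [hiρ]
      exact ⟨fun ⟨y, hy⟩ => by
        obtain ⟨b, rfl⟩ := hπ y
        exact ⟨b, hy⟩, fun ⟨b, hb⟩ => ⟨π b, hb⟩⟩
    · intro b'
      rw [show d'.rangeRestrict b' = 0 ↔ d' b' = 0 from Subtype.ext_iff]
      constructor
      · intro hb
        obtain ⟨φ, hφ⟩ := exists_factor hπ (f := q.left b') fun b h => by
          obtain ⟨a, rfl⟩ := (he b).1 h
          rw [LinearMap.mem_ker, DualPair.left_apply, hd, hb, p.zero_right]
        obtain ⟨ψ, hψ⟩ := forall_exists_extension_congr uR hx φ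
        obtain ⟨q', hq'⟩ := s.exists_right ψ
        exact ⟨q', q.eq_right fun b => by
          rw [← hj, hq', LinearMap.comp_apply, hψ, hφ, DualPair.left_apply]⟩
      · rintro ⟨q', rfl⟩
        refine p.ext_right _ fun a => ?_
        rw [← hd, ← hj, LinearMap.comp_apply, he.apply_apply_eq_zero, map_zero, s.zero_left]
    · intro a'
      rw [he']
      exact ⟨fun ⟨b, hb⟩ => ⟨⟨_, b, rfl⟩, hb⟩, fun ⟨⟨_, b, rfl⟩, hb⟩ => ⟨b, hb⟩⟩
    · obtain ⟨b, hb⟩ := q.exists_left (uS.toLinearMap ∘ₗ φ ∘ₗ d'.rangeRestrict)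
      have hπb : π b = 0 := hi <| by
        rw [map_zero, ← LinearMap.comp_apply]
        refine s.ext_left _ fun q' => ?_
        have : d'.rangeRestrict (j' q') = 0 := Subtype.ext <| p.ext_right _ fun a => by
          change p.b a (d' (j' q')) = 0
          rw [← hd, ← hj, LinearMap.comp_apply, he.apply_apply_eq_zero, map_zero, s.zero_left]
        rw [hj, hb]
        simp [this]
      obtain ⟨a, rfl⟩ := (he b).1 hπb
      refine ⟨uS.symm.toLinearMap ∘ₗ p.right a, LinearMap.ext ?_⟩
      rintro ⟨_, b', rfl⟩
      have := hb b'
      rw [hd] at this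
      rw [LinearMap.comp_apply, LinearMap.comp_apply, LinearEquiv.coe_coe, LinearEquiv.symm_apply_eq]
      exact this
  · obtain ⟨n, c₀, hc₀⟩ := Module.Finite.exists_fin' R (LinearMap.ker d)
    let c : (Fin n → R) →ₗ[R] A := (LinearMap.ker d).subtype ∘ₗ c₀
    have hc : Exact c d := fun a =>
      ⟨fun ha => by
        obtain ⟨x, hx⟩ := hc₀ ⟨a, ha⟩
        exact ⟨x, congrArg Subtype.val hx⟩, fun ⟨x, hx⟩ => by rw [← hx]; exact (c₀ x).2⟩
    obtain ⟨C', _, _, _, _, ⟨r⟩⟩ := u.exists_dual (Fin n → R)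
    obtain ⟨c', hc'⟩ := DualPair.exists_isTr r p c
    have hcd : ∀ b', c' (d' b') = 0 := fun b' => r.ext_right _ fun x => by
      rw [← hc', ← hd, hc.apply_apply_eq_zero, q.zero_left]
    obtain ⟨i, hi⟩ := exists_factor hω (f := c') fun a' ha' => by
      obtain ⟨b', rfl⟩ := (he' a').1 ha'
      exact hcd b'
    have hri : LinearMap.range c' = LinearMap.range i := by
      rw [← LinearMap.range_comp_of_range_eq_top i (LinearMap.range_eq_top.2 hω)]
      congr 1
      exact LinearMap.ext fun x => (hi x).symm
    refine ⟨.of S (C' ⧸ LinearMap.range c'), ⟨.of R (Fin n → R), A, .of R (LinearMap.ker π),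
      .of S C', A', r, p, c, c', d.codRestrict _ he.apply_apply_eq_zero,
      (LinearMap.range c').mkQ, ⟨inferInstanceAs (Module.Finite R (Fin n → R)),
        inferInstanceAs (Module.Projective R (Fin n → R)), ‹_›, ‹_›⟩, ⟨‹_›, ‹_›, ‹_›, ‹_›⟩, hc', ?_, ?_,
      Submodule.mkQ_surjective _, LinearMap.exact_map_mkQ_range c', hM.ker hπ⟩,
      .of S C', i, (LinearMap.range c').mkQ, ?_, Submodule.mkQ_surjective _, ?_, ‹_›, ‹_›,
      fun φ => ?_⟩
    · rintro ⟨b, hb⟩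
      obtain ⟨a, rfl⟩ := (he b).1 hb
      exact ⟨a, rfl⟩
    · exact fun a => Subtype.ext_iff.trans (hc a)
    · rw [injective_iff_map_eq_zero]
      intro z hz
      obtain ⟨a', rfl⟩ := hω z
      rw [hi] at hz
      obtain ⟨φ, hφ⟩ := exists_factor (π := d.codRestrict (LinearMap.ker π) he.apply_apply_eq_zero)
        (f := p.left a') (by
          rintro ⟨b, hb⟩
          obtain ⟨a, rfl⟩ := (he b).1 hb
          exact ⟨a, rfl⟩) (fun a ha => by
          obtain ⟨x, rfl⟩ := (hc a).1 (congrArg Subtype.val ha)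
          rw [LinearMap.mem_ker, DualPair.left_apply, hc', hz, r.zero_right])
      obtain ⟨ψ, hψ⟩ := forall_exists_extension_congr uR (hM.exists_extension hπ) φ
      obtain ⟨b', hb'⟩ := q.exists_right ψ
      refine (he' a').2 ⟨b', p.eq_right fun a => ?_⟩
      have := (hψ _).trans (hφ a)
      rw [← hd, hb', ← DualPair.left_apply, ← this]
      rfl
    · intro x
      rw [Submodule.mkQ_apply, Submodule.Quotient.mk_eq_zero, hri]
      rfl
    · obtain ⟨a, ha⟩ := p.exists_left (uS.toLinearMap ∘ₗ φ ∘ₗ ω)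
      have hda : d a = 0 := q.ext_left _ fun b' => by
        rw [hd, ha]
        simp [he'.apply_apply_eq_zero]
      obtain ⟨x, rfl⟩ := (hc a).1 hda
      refine ⟨uS.symm.toLinearMap ∘ₗ r.right x, LinearMap.ext fun z => ?_⟩
      obtain ⟨a', rfl⟩ := hω z
      rw [LinearMap.comp_apply, LinearMap.comp_apply, LinearEquiv.coe_coe,
        LinearEquiv.symm_apply_eq, hi, DualPair.right_apply, ← hc', ha]
      rfl

lemma Dag.isGP [IsNoetherianRing R] {M P Z Q : Type u} [AddCommGroup M] [Module R M]
    [AddCommGroup P] [Module R P] [AddCommGroup Z] [Module S Z] [AddCommGroup Q] [Module S Q]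
    (u : DualPair R S T R S) (h : Dag R S T M P Z Q) (hM : IsGP R M) : IsGP S Z := by
  obtain ⟨A, B, A', B', p, q, d, d', h₁, h₂, hd, h, h'⟩ := h
  obtain ⟨π, hπ, he, -⟩ := h.exists_coker
  obtain ⟨ω, hω, he', -⟩ := h'.exists_coker
  exact (isStable_isTransposeOfGP u).isGP ⟨A, B, .of R M, A', B', p, q, d, d', π, ω, h₁, h₂,
    hd, hπ, he, hω, he', hM⟩

end DagGP

section InjectiveTarget

variable {R S T : Type u} [Ring R] [Ring S] [AddCommGroup T] [Module R T] [Module S T]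
variable {A A' B B' C C' : Type u} [AddCommGroup A] [Module R A] [AddCommGroup A'] [Module S A']
  [AddCommGroup B] [Module R B] [AddCommGroup B'] [Module S B'] [AddCommGroup C] [Module R C]
  [AddCommGroup C'] [Module S C']
variable {p : DualPair R S T A A'} {q : DualPair R S T B B'} {s : DualPair R S T C C'}
  {f : A →ₗ[R] B} {f' : B' →ₗ[S] A'} {g : B →ₗ[R] C} {g' : C' →ₗ[S] B'}

lemma injective_of_retract [Module.Injective R B] (i : A →ₗ[R] B) (π : B →ₗ[R] A)
    (h : ∀ x, π (i x) = x) : Module.Injective R A where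
  out X Y _ _ _ _ f hf g := by
    obtain ⟨k, hk⟩ := Module.Injective.out f hf (i ∘ₗ g)
    exact ⟨π ∘ₗ k, fun x => by simp [hk, h]⟩

namespace DualPair.IsTr

lemma injective_of_surjective (h : p.IsTr q f f') (hf : Surjective f) : Injective f' := by
  rw [injective_iff_map_eq_zero]
  refine fun b' hb => q.ext_right _ fun b => ?_
  obtain ⟨a, rfl⟩ := hf b
  rw [h, hb, p.zero_right]

lemma surjective_of_injective [Module.Injective R T] (h : p.IsTr q f f') (hf : Injective f) :
    Surjective f' := fun a' => by
  obtain ⟨φ, hφ⟩ := Module.Injective.out f hf (p.left a')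
  obtain ⟨b', hb'⟩ := q.exists_right φ
  exact ⟨b', p.eq_right fun a => by rw [← h, hb', hφ, left_apply]⟩

lemma exact [Module.Injective R T] (h : p.IsTr q f f') (hg : q.IsTr s g g') (he : Exact f g) :
    Exact g' f' := fun b' => by
  constructor
  · intro hb
    obtain ⟨φ, hφ⟩ := exists_factor g.surjective_rangeRestrict (f := q.left b') fun b h' => by
      rw [LinearMap.ker_rangeRestrict] at h'
      obtain ⟨a, rfl⟩ := (he b).1 h'
      rw [LinearMap.mem_ker, left_apply, h, hb, p.zero_right]
    obtain ⟨ψ, hψ⟩ := Module.Injective.out (LinearMap.range g).subtype Subtype.val_injective φ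
    obtain ⟨c', hc'⟩ := s.exists_right ψ
    exact ⟨c', q.eq_right fun b => by
      rw [← hg, hc', ← left_apply, ← hφ, ← hψ]; rfl⟩
  · rintro ⟨c', rfl⟩
    exact p.ext_right _ fun a => by
      rw [← h, ← hg, he.apply_apply_eq_zero, s.zero_left]

end DualPair.IsTr

variable (R S T) in
/-- Every finitely generated module over either ring is in perfect pairing with a finitely
generated module over the other one, and the target of the pairings is injective. -/
structure IsDuality : Prop where
  injective_left : Module.Injective R T
  injective_right : Module.Injective S T
  exists_right (A : Type u) [AddCommGroup A] [Module R A] [Module.Finite R A] :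
    ∃ A' : ModuleCat.{u} S, Module.Finite S A' ∧ Nonempty (DualPair R S T A A')
  exists_left (A' : Type u) [AddCommGroup A'] [Module S A'] [Module.Finite S A'] :
    ∃ A : ModuleCat.{u} R, Module.Finite R A ∧ Nonempty (DualPair R S T A A')

namespace IsDuality

lemma symm (H : IsDuality R S T) : IsDuality S R T where
  injective_left := H.injective_right
  injective_right := H.injective_left
  exists_right := by
    intro A _ _ _
    obtain ⟨A', h, ⟨p⟩⟩ := H.exists_left A
    exact ⟨A', h, ⟨p.symm⟩⟩
  exists_left := by
    intro A _ _ _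
    obtain ⟨A', h, ⟨p⟩⟩ := H.exists_right A
    exact ⟨A', h, ⟨p.symm⟩⟩

lemma projective (H : IsDuality R S T) (p : DualPair R S T A A') [Module.Finite S A']
    [Module.Injective R A] : Module.Projective S A' := by
  obtain ⟨n, π, hπ⟩ := Module.Finite.exists_fin' S A'
  obtain ⟨B, -, ⟨q⟩⟩ := H.exists_left (Fin n → S)
  obtain ⟨i, hi⟩ := DualPair.exists_isTr' p q π
  obtain ⟨ρ, hρ⟩ := Module.Injective.out i (hi.symm.injective_of_surjective hπ) LinearMap.id
  obtain ⟨σ, hσ⟩ := DualPair.exists_isTr q p ρ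
  refine Module.Projective.of_split σ π ((DualPair.IsTr.comp hσ hi).unique ?_)
  rw [show ρ ∘ₗ i = LinearMap.id from LinearMap.ext hρ]
  exact DualPair.isTr_id

lemma injective (H : IsDuality R S T) (p : DualPair R S T A A') [Module.Finite S A']
    [Module.Projective S A'] : Module.Injective R A := by
  have := H.injective_left
  obtain ⟨n, π, hπ⟩ := Module.Finite.exists_fin' S A'
  obtain ⟨σ, hσ⟩ := Module.projective_lifting_property π LinearMap.id hπ
  obtain ⟨X, -, ⟨w⟩⟩ := H.exists_left S
  obtain ⟨e⟩ := w.nonempty_equiv_self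
  have : Module.Injective R X := injective_of_retract e.toLinearMap e.symm.toLinearMap (by simp)
  let q := (w.symm.pi n).symm
  obtain ⟨i, hi⟩ := DualPair.exists_isTr' p q π
  obtain ⟨ρ, hρ⟩ := DualPair.exists_isTr' q p σ
  have : ρ ∘ₗ i = LinearMap.id := (DualPair.IsTr.comp hρ hi).unique' (by
    rw [hσ]; exact DualPair.isTr_id)
  exact injective_of_retract i ρ (LinearMap.congr_fun this)

lemma projective_iff (H : IsDuality R S T) (p : DualPair R S T A A') [Module.Finite S A'] :
    Module.Projective S A' ↔ Module.Injective R A :=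
  ⟨fun _ => H.injective p, fun _ => H.projective p⟩

lemma step_gpCond (H : IsDuality R S T) {Y X : ModuleCat.{u} R} {Y' X' : ModuleCat.{u} S}
    (p : DualPair R S T Y Y') (q : DualPair R S T X X') (h : Step R (GICond R T) Y X) :
    Step S (GPCond S) X' Y' := by
  have := H.injective_left
  obtain ⟨P, i, π, hi, hπ, he, _, _, hx⟩ := h
  obtain ⟨P', _, ⟨s⟩⟩ := H.exists_right P
  obtain ⟨i', hi'⟩ := DualPair.exists_isTr p s i
  obtain ⟨π', hπ'⟩ := DualPair.exists_isTr s q π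
  refine ⟨P', π', i', hπ'.injective_of_surjective hπ, hi'.surjective_of_injective hi,
    hi'.exact hπ' he, ‹_›, H.projective s, fun φ => ?_⟩
  obtain ⟨W, -, ⟨w⟩⟩ := H.exists_left S
  obtain ⟨e⟩ := w.nonempty_equiv_self
  obtain ⟨f, hf⟩ := DualPair.exists_isTr' w q φ
  obtain ⟨g, hg⟩ := hx (f ∘ₗ e.symm.toLinearMap)
  obtain ⟨ψ, hψ⟩ := DualPair.exists_isTr w s (g ∘ₗ e.toLinearMap)
  refine ⟨ψ, (DualPair.IsTr.comp hπ' hψ).unique ?_⟩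
  rw [← LinearMap.comp_assoc, hg, LinearMap.comp_assoc, LinearEquiv.symm_comp, LinearMap.comp_id]
  exact hf

lemma step_giCond (H : IsDuality R S T) {Y X : ModuleCat.{u} R} {Y' X' : ModuleCat.{u} S}
    (p : DualPair R S T Y Y') (q : DualPair R S T X X') (h : Step S (GPCond S) X' Y') :
    Step R (GICond R T) Y X := by
  have := H.injective_right
  obtain ⟨P', π', i', hπ, hi, he, _, _, hx⟩ := h
  obtain ⟨P, _, ⟨s⟩⟩ := H.exists_left P'
  obtain ⟨i, hi'⟩ := DualPair.exists_isTr' p s i'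
  obtain ⟨π, hπ'⟩ := DualPair.exists_isTr' s q π'
  refine ⟨P, i, π, hi'.symm.injective_of_surjective hi, hπ'.symm.surjective_of_injective hπ,
    hπ'.symm.exact hi'.symm he, ‹_›, H.injective s, fun φ => ?_⟩
  obtain ⟨W, -, ⟨w⟩⟩ := H.exists_left S
  obtain ⟨e⟩ := w.nonempty_equiv_self
  obtain ⟨f, hf⟩ := DualPair.exists_isTr w q (φ ∘ₗ e.toLinearMap)
  obtain ⟨g, hg⟩ := hx f
  obtain ⟨ψ, hψ⟩ := DualPair.exists_isTr' w s g
  have : π ∘ₗ ψ = φ ∘ₗ e.toLinearMap := (DualPair.IsTr.comp hπ' hψ).unique' (by rw [hg]; exact hf)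
  refine ⟨ψ ∘ₗ e.symm.toLinearMap, ?_⟩
  rw [← LinearMap.comp_assoc, this, LinearMap.comp_assoc, LinearEquiv.comp_symm, LinearMap.comp_id]

lemma isGP (H : IsDuality R S T) [IsNoetherianRing R] {C : ModuleCat.{u} R → Prop}
    (hC : IsStable R (GICond R T) C) {A : ModuleCat.{u} R} (hA : C A) (p : DualPair R S T A A') :
    IsGP S A' := by
  refine IsStable.isGP (C := fun Z => ∃ X, C X ∧ Nonempty (DualPair R S T X Z)) ?_ ⟨A, hA, ⟨p⟩⟩
  rintro Z ⟨X, hX, ⟨q⟩⟩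
  obtain ⟨⟨Y, hY, h⟩, ⟨Y', hY', h'⟩⟩ := hC X hX
  have : Module.Finite R Y := by
    obtain ⟨P, i, -, hi, -, -, _, -⟩ := h
    exact Module.Finite.of_injective i hi
  have : Module.Finite R Y' := by
    obtain ⟨P, -, π, -, hπ, -, _, -⟩ := h'
    exact Module.Finite.of_surjective π hπ
  obtain ⟨W, -, ⟨w⟩⟩ := H.exists_right Y
  obtain ⟨W', -, ⟨w'⟩⟩ := H.exists_right Y'
  exact ⟨⟨W', ⟨Y', hY', ⟨w'⟩⟩, H.step_gpCond q w' h'⟩, ⟨W, ⟨Y, hY, ⟨w⟩⟩, H.step_gpCond w q h⟩⟩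

lemma exists_isStable (H : IsDuality R S T) (hG : IsGP S A') (p : DualPair R S T A A') :
    ∃ C, IsStable R (GICond R T) C ∧ C (.of R A) := by
  refine ⟨fun X => ∃ Z : ModuleCat.{u} S, IsGP S Z ∧ Nonempty (DualPair R S T X Z), ?_,
    .of S A', hG, ⟨p⟩⟩
  rintro X ⟨Z, hZ, ⟨q⟩⟩
  obtain ⟨⟨Y, hY, h⟩, ⟨Y', hY', h'⟩⟩ := isStable_isGP Z hZ
  have := hY.finite
  have := hY'.finite
  obtain ⟨W, -, ⟨w⟩⟩ := H.exists_left Y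
  obtain ⟨W', -, ⟨w'⟩⟩ := H.exists_left Y'
  exact ⟨⟨W', ⟨Y', hY', ⟨w'⟩⟩, H.step_giCond w' q h'⟩, ⟨W, ⟨Y, hY, ⟨w⟩⟩, H.step_giCond q w h⟩⟩

end IsDuality
end InjectiveTarget

section KDuality

variable (R : Type u) [Ring R] (K : Type u) [Field K] [Algebra K R]

instance OpDual.moduleOp : Module Rᵐᵒᵖ (OpDual R K R) := inferInstanceAs (Module Rᵐᵒᵖ (LDual R K R))

instance OpDual.isScalarTowerOp : IsScalarTower K Rᵐᵒᵖ (OpDual R K R) :=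
  inferInstanceAs (IsScalarTower K Rᵐᵒᵖ (LDual R K R))

variable {R K}

lemma OpDual.smul_apply (r x : R) (f : OpDual R K R) :
    OpDual.toL R K R (r • f) x = OpDual.toL R K R f (x * r) := rfl

lemma OpDual.op_smul_apply (r x : R) (f : OpDual R K R) :
    OpDual.toL R K R (op r • f) x = OpDual.toL R K R f (r * x) := rfl

/-- The `K`-linear map `x ↦ φ x 1`. -/
def evalOne {S X : Type u} [Ring S] [Algebra K S] [Module S (OpDual R K R)]
    [IsScalarTower K S (OpDual R K R)] [AddCommGroup X] [Module S X] [Module K X]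
    [IsScalarTower K S X] (φ : X →ₗ[S] OpDual R K R) : X →ₗ[K] K where
  toFun x := OpDual.toL R K R (φ x) 1
  map_add' x y := by rw [map_add, OpDual.toL_add, LinearMap.add_apply]
  map_smul' k x := by
    rw [← algebraMap_smul S k x, map_smul, algebraMap_smul]; rfl

section

variable {X Z : Type u} [AddCommGroup X] [Module R X] [Module K X] [IsScalarTower K R X]
  [AddCommGroup Z] [Module Rᵐᵒᵖ Z] [Module K Z] [IsScalarTower K Rᵐᵒᵖ Z]

/-- A perfect balanced `K`-valued pairing gives a perfect pairing with values in the `K`-dual of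
the ring. -/
def DualPair.ofBilin (c : X →ₗ[K] Z →ₗ[K] K) (hc : ∀ (r : R) x z, c (r • x) z = c x (op r • z))
    (exists_right : ∀ φ : X →ₗ[K] K, ∃ z, ∀ x, c x z = φ x)
    (exists_left : ∀ ψ : Z →ₗ[K] K, ∃ x, ∀ z, c x z = ψ z)
    (ext_right : ∀ z, (∀ x, c x z = 0) → z = 0) (ext_left : ∀ x, (∀ z, c x z = 0) → x = 0) :
    DualPair R Rᵐᵒᵖ (OpDual R K R) X Z where
  b x z := (c.flip z ∘ₗ (LinearMap.toSpanSingleton R X x).restrictScalars K : R →ₗ[K] K)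
  add_left x y z := LinearMap.ext fun r =>
    show c (r • (x + y)) z = c (r • x) z + c (r • y) z by
      rw [smul_add, map_add, LinearMap.add_apply]
  add_right x y z := LinearMap.ext fun r =>
    show c (r • x) (y + z) = c (r • x) y + c (r • x) z from map_add _ _ _
  smul_left s x z := LinearMap.ext fun r => show c (r • s • x) z = c ((r * s) • x) z by rw [mul_smul]
  smul_right s x z := LinearMap.ext fun r =>
    show c (r • x) (s • z) = c ((unop s * r) • x) z by rw [mul_smul, hc (unop s), op_unop]
  exists_right φ := by
    obtain ⟨z, hz⟩ := exists_right (evalOne φ)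
    refine ⟨z, fun x => LinearMap.ext fun r => (hz (r • x)).trans ?_⟩
    change OpDual.toL R K R (φ (r • x)) 1 = OpDual.toL R K R (φ x) r
    rw [map_smul, OpDual.smul_apply, one_mul]
  exists_left ψ := by
    obtain ⟨x, hx⟩ := exists_left (evalOne ψ)
    refine ⟨x, fun z => LinearMap.ext fun r => ?_⟩
    change c (r • x) z = OpDual.toL R K R (ψ z) r
    rw [hc, hx]
    change OpDual.toL R K R (ψ (op r • z)) 1 = OpDual.toL R K R (ψ z) r
    rw [map_smul, OpDual.op_smul_apply, mul_one]
  ext_right z h := ext_right z fun x => by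
    have : c ((1 : R) • x) z = 0 := LinearMap.congr_fun (h x) (1 : R)
    rwa [one_smul] at this
  ext_left x h := ext_left x fun z => by
    have : c ((1 : R) • x) z = 0 := LinearMap.congr_fun (h z) (1 : R)
    rwa [one_smul] at this

variable (R K) in
lemma nonempty_dualPair_lDual (X : Type u) [AddCommGroup X] [Module R X] [Module K X]
    [IsScalarTower K R X] [FiniteDimensional K X] :
    Nonempty (DualPair R Rᵐᵒᵖ (OpDual R K R) X (LDual R K X)) := by
  let c : X →ₗ[K] LDual R K X →ₗ[K] K := Module.Dual.eval K X
  refine ⟨DualPair.ofBilin c (fun r x z => rfl) (fun φ => ⟨φ, fun _ => rfl⟩)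
    (fun ψ => ?_) (fun z h => LinearMap.ext h) fun x h =>
      (Module.forall_dual_apply_eq_zero_iff K x).1 h⟩
  obtain ⟨x, hx⟩ := (Module.evalEquiv K X).surjective ψ
  exact ⟨x, fun z => LinearMap.congr_fun hx z⟩

variable (R K) in
lemma nonempty_dualPair_opDual (Z : Type u) [AddCommGroup Z] [Module Rᵐᵒᵖ Z] [Module K Z]
    [IsScalarTower K Rᵐᵒᵖ Z] [FiniteDimensional K Z] :
    Nonempty (DualPair R Rᵐᵒᵖ (OpDual R K R) (OpDual R K Z) Z) := by
  let c : OpDual R K Z →ₗ[K] Z →ₗ[K] K := (LinearMap.id : (Z →ₗ[K] K) →ₗ[K] (Z →ₗ[K] K))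
  refine ⟨DualPair.ofBilin c (fun r x z => rfl)
    (fun φ => ?_) (fun φ => ⟨φ, fun _ => rfl⟩) (fun z h =>
      (Module.forall_dual_apply_eq_zero_iff K z).1 h) fun x h => LinearMap.ext h⟩
  obtain ⟨x, hx⟩ := (Module.evalEquiv K Z).surjective φ
  exact ⟨x, fun z => LinearMap.congr_fun hx z⟩

end

instance (X : Type u) [AddCommGroup X] [Module R X] [Module K X]
    [IsScalarTower K R X] [FiniteDimensional K X] : FiniteDimensional K (LDual R K X) :=
  inferInstanceAs (FiniteDimensional K (X →ₗ[K] K))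

instance (X : Type u) [AddCommGroup X] [Module Rᵐᵒᵖ X] [Module K X]
    [IsScalarTower K Rᵐᵒᵖ X] [FiniteDimensional K X] : FiniteDimensional K (OpDual R K X) :=
  inferInstanceAs (FiniteDimensional K (X →ₗ[K] K))

variable (R K)

lemma injective_opDual : Module.Injective R (OpDual R K R) where
  out X Y _ _ _ _ f hf g := by
    let _ : Module K X := Module.compHom X (algebraMap K R)
    let _ : Module K Y := Module.compHom Y (algebraMap K R)
    have : IsScalarTower K R X := .of_algebraMap_smul fun _ _ => rfl
    have : IsScalarTower K R Y := .of_algebraMap_smul fun _ _ => rfl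
    obtain ⟨σ, hσ⟩ := (f.restrictScalars K).exists_leftInverse_of_injective
      (LinearMap.ker_eq_bot.2 hf)
    let h : Y →ₗ[K] K := evalOne g ∘ₗ σ
    refine ⟨{ toFun := fun y => (h ∘ₗ (LinearMap.toSpanSingleton R Y y).restrictScalars K :
                R →ₗ[K] K)
              map_add' := fun x y => LinearMap.ext fun r =>
                show h (r • (x + y)) = h (r • x) + h (r • y) by rw [smul_add, map_add]
              map_smul' := fun s x => LinearMap.ext fun r =>
                show h (r • s • x) = h ((r * s) • x) by rw [mul_smul] }, fun x => ?_⟩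
    refine LinearMap.ext fun r => ?_
    change OpDual.toL R K R (g (σ (r • f x))) 1 = OpDual.toL R K R (g x) r
    rw [← map_smul f, show σ (f (r • x)) = r • x from LinearMap.congr_fun hσ _, map_smul,
      OpDual.smul_apply, one_mul]

lemma injective_op_opDual : Module.Injective Rᵐᵒᵖ (OpDual R K R) where
  out X Y _ _ _ _ f hf g := by
    let _ : Module K X := Module.compHom X (algebraMap K Rᵐᵒᵖ)
    let _ : Module K Y := Module.compHom Y (algebraMap K Rᵐᵒᵖ)
    have : IsScalarTower K Rᵐᵒᵖ X := .of_algebraMap_smul fun _ _ => rfl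
    have : IsScalarTower K Rᵐᵒᵖ Y := .of_algebraMap_smul fun _ _ => rfl
    obtain ⟨σ, hσ⟩ := (f.restrictScalars K).exists_leftInverse_of_injective
      (LinearMap.ker_eq_bot.2 hf)
    let h : Y →ₗ[K] K := evalOne g ∘ₗ σ
    refine ⟨{ toFun := fun y => (h ∘ₗ (LinearMap.toSpanSingleton Rᵐᵒᵖ Y y).restrictScalars K ∘ₗ
                (opLinearEquiv K).toLinearMap : R →ₗ[K] K)
              map_add' := fun x y => LinearMap.ext fun r =>
                show h (op r • (x + y)) = h (op r • x) + h (op r • y) by rw [smul_add, map_add]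
              map_smul' := fun s x => LinearMap.ext fun r =>
                show h (op r • s • x) = h (op (unop s * r) • x) by
                  rw [op_mul, op_unop, mul_smul] }, fun x => ?_⟩
    refine LinearMap.ext fun r => ?_
    change OpDual.toL R K R (g (σ (op r • f x))) 1 = OpDual.toL R K R (g x) r
    rw [← map_smul f, show σ (f (op r • x)) = op r • x from LinearMap.congr_fun hσ _, map_smul,
      OpDual.op_smul_apply, mul_one]

lemma isDuality_opDual [FiniteDimensional K R] : IsDuality R Rᵐᵒᵖ (OpDual R K R) where
  injective_left := injective_opDual R K
  injective_right := injective_op_opDual R K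
  exists_right := by
    intro A _ _ _
    let _ : Module K A := Module.compHom A (algebraMap K R)
    have : IsScalarTower K R A := .of_algebraMap_smul fun _ _ => rfl
    have : FiniteDimensional K A := Module.Finite.trans R A
    exact ⟨.of Rᵐᵒᵖ (LDual R K A), .of_restrictScalars_finite K Rᵐᵒᵖ (LDual R K A),
      nonempty_dualPair_lDual R K A⟩
  exists_left := by
    intro A _ _ _
    let _ : Module K A := Module.compHom A (algebraMap K Rᵐᵒᵖ)
    have : IsScalarTower K Rᵐᵒᵖ A := .of_algebraMap_smul fun _ _ => rfl
    have : FiniteDimensional K Rᵐᵒᵖ := Module.Finite.equiv (opLinearEquiv K)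
    have : FiniteDimensional K A := Module.Finite.trans Rᵐᵒᵖ A
    exact ⟨.of R (OpDual R K A), .of_restrictScalars_finite K R (OpDual R K A),
      nonempty_dualPair_opDual R K A⟩

end KDuality

section Decomposition

open scoped Classical in
section

variable {V W : Type*} [AddCommMonoid V] [AddCommMonoid W]

/-- An element of a monoid that is nonzero and not a sum of two nonzero elements. -/
def Irr (a : V) : Prop := a ≠ 0 ∧ ∀ b c, a = b + c → b = 0 ∨ c = 0

/-- `v` is a sum of irreducible elements, exactly `k` of which are distinct. -/
def Num (v : V) (k : ℕ) : Prop :=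
  ∃ s : Multiset V, (∀ a ∈ s, Irr a) ∧ s.sum = v ∧ s.toFinset.card = k

/-- `v` is a sum of distinct irreducible elements. -/
def Bas (v : V) : Prop := ∃ s : Multiset V, (∀ a ∈ s, Irr a) ∧ s.sum = v ∧ s.Nodup

/-- A partial isomorphism of monoids, whose domain and range are closed under summands. -/
structure PartialIso (ρ : V → W → Prop) : Prop where
  eq_iff : ∀ {v v' w w'}, ρ v w → ρ v' w' → (v = v' ↔ w = w')
  zero : ρ 0 0
  add : ∀ {v v' w w'}, ρ v w → ρ v' w' → ρ (v + v') (w + w')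
  exists_right : ∀ {v v' w}, ρ (v + v') w → ∃ u u', ρ v u ∧ ρ v' u'
  exists_left : ∀ {v w w'}, ρ v (w + w') → ∃ u u', ρ u w ∧ ρ u' w'

namespace PartialIso

variable {ρ : V → W → Prop} {v : V} {w : W}

lemma symm (h : PartialIso ρ) : PartialIso fun w v => ρ v w where
  eq_iff h₁ h₂ := (h.eq_iff h₁ h₂).symm
  zero := h.zero
  add h₁ h₂ := h.add h₁ h₂
  exists_right h₁ := h.exists_left h₁
  exists_left h₁ := h.exists_right h₁

lemma irr (h : PartialIso ρ) (hr : ρ v w) (hv : Irr v) : Irr w := by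
  refine ⟨fun h0 => hv.1 ((h.eq_iff hr h.zero).2 h0), ?_⟩
  rintro b c rfl
  obtain ⟨b', c', hb, hc⟩ := h.exists_left hr
  exact (hv.2 b' c' ((h.eq_iff hr (h.add hb hc)).2 rfl)).imp (h.eq_iff hb h.zero).1
    (h.eq_iff hc h.zero).1

lemma exists_multiset (h : PartialIso ρ) (s : Multiset V) (hs : ∀ a ∈ s, Irr a)
    (hr : ρ s.sum w) : ∃ t : Multiset W, (∀ a ∈ t, Irr a) ∧ t.sum = w ∧
      t.toFinset.card = s.toFinset.card ∧ (s.Nodup → t.Nodup) := by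
  have hd : ∀ a ∈ s, ∃ b, ρ a b := fun a ha => by
    obtain ⟨s', rfl⟩ := Multiset.exists_cons_of_mem ha
    rw [Multiset.sum_cons] at hr
    obtain ⟨b, -, hb, -⟩ := h.exists_right hr
    exact ⟨b, hb⟩
  have : ∃ F : V → W, ∀ a ∈ s, ρ a (F a) :=
    ⟨fun a => if ha : ∃ b, ρ a b then ha.choose else 0, fun a ha => by
      simp only
      rw [dif_pos (hd a ha)]; exact (hd a ha).choose_spec⟩
  obtain ⟨F, hF⟩ := this
  have hsum : ∀ s' : Multiset V, (∀ a ∈ s', ρ a (F a)) → ρ s'.sum (s'.map F).sum := by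
    intro s'
    induction s' using Multiset.induction with
    | empty => exact fun _ => h.zero
    | cons a s' ih =>
      intro H
      rw [Multiset.map_cons, Multiset.sum_cons, Multiset.sum_cons]
      exact h.add (H a (by simp)) (ih fun b hb => H b (by simp [hb]))
  have hinj : ∀ a ∈ s, ∀ b ∈ s, F a = F b → a = b := fun a ha b hb =>
    (h.eq_iff (hF a ha) (hF b hb)).2
  refine ⟨s.map F, fun b hb => ?_, (h.eq_iff (hsum s hF) hr).1 rfl, ?_, fun hn => hn.map_on hinj⟩
  · obtain ⟨a, ha, rfl⟩ := Multiset.mem_map.1 hb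
    exact h.irr (hF a ha) (hs a ha)
  · rw [Multiset.toFinset_map]
    refine Finset.card_image_of_injOn fun a ha b hb => hinj a ?_ b ?_
    · simpa using ha
    · simpa using hb

lemma num (h : PartialIso ρ) (hr : ρ v w) {k : ℕ} (hv : Num v k) : Num w k := by
  obtain ⟨s, hs, rfl, hk⟩ := hv
  obtain ⟨t, ht, h₁, h₂, -⟩ := h.exists_multiset s hs hr
  exact ⟨t, ht, h₁, h₂.trans hk⟩

lemma bas (h : PartialIso ρ) (hr : ρ v w) (hv : Bas v) : Bas w := by
  obtain ⟨s, hs, rfl, hk⟩ := hv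
  obtain ⟨t, ht, h₁, -, h₂⟩ := h.exists_multiset s hs hr
  exact ⟨t, ht, h₁, h₂ hk⟩

lemma num_iff (h : PartialIso ρ) (hr : ρ v w) {k : ℕ} : Num v k ↔ Num w k :=
  ⟨h.num hr, h.symm.num hr⟩

lemma bas_iff (h : PartialIso ρ) (hr : ρ v w) : Bas v ↔ Bas w := ⟨h.bas hr, h.symm.bas hr⟩

end PartialIso

lemma irr_inl_iff [Subsingleton (AddUnits W)] {a : V} : Irr (a, (0 : W)) ↔ Irr a := by
  refine ⟨fun h => ⟨fun h0 => h.1 (by rw [h0]; rfl), fun b c hbc => ?_⟩, fun h =>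
    ⟨fun h0 => h.1 (Prod.ext_iff.1 h0).1, fun b c hbc => ?_⟩⟩
  · simpa using h.2 (b, 0) (c, 0) (by simp [hbc])
  · obtain ⟨h₁, h₂⟩ := Prod.ext_iff.1 hbc
    obtain ⟨h₃, h₄⟩ := add_eq_zero.1 h₂.symm
    exact (h.2 _ _ h₁).imp (fun h => Prod.ext h h₃) fun h => Prod.ext h h₄

lemma irr_inr_iff [Subsingleton (AddUnits V)] {b : W} : Irr ((0 : V), b) ↔ Irr b := by
  refine ⟨fun h => ⟨fun h0 => h.1 (by rw [h0]; rfl), fun c d hbc => ?_⟩, fun h =>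
    ⟨fun h0 => h.1 (Prod.ext_iff.1 h0).2, fun c d hbc => ?_⟩⟩
  · simpa using h.2 (0, c) (0, d) (by simp [hbc])
  · obtain ⟨h₁, h₂⟩ := Prod.ext_iff.1 hbc
    obtain ⟨h₃, h₄⟩ := add_eq_zero.1 h₁.symm
    exact (h.2 _ _ h₂).imp (fun h => Prod.ext h₃ h) fun h => Prod.ext h₄ h

lemma exists_multiset_prod [Subsingleton (AddUnits V)] [Subsingleton (AddUnits W)]
    (s : Multiset (V × W)) (hs : ∀ a ∈ s, Irr a) :
    ∃ (s₁ : Multiset V) (s₂ : Multiset W), (∀ a ∈ s₁, Irr a) ∧ (∀ b ∈ s₂, Irr b) ∧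
      s = s₁.map (fun a => (a, 0)) + s₂.map (fun b => (0, b)) := by
  induction s using Multiset.induction with
  | empty => exact ⟨0, 0, by simp⟩
  | cons x s ih =>
    obtain ⟨s₁, s₂, h₁, h₂, rfl⟩ := ih fun a ha => hs a (by simp [ha])
    obtain ⟨a, b⟩ := x
    have h := hs (a, b) (by simp)
    rcases h.2 (a, 0) (0, b) (by simp) with h0 | h0
    · obtain rfl : a = 0 := (Prod.ext_iff.1 h0).1
      refine ⟨s₁, b ::ₘ s₂, h₁, fun c hc => ?_, by simp⟩
      rcases Multiset.mem_cons.1 hc with rfl | hc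
      exacts [irr_inr_iff.1 h, h₂ c hc]
    · obtain rfl : b = 0 := (Prod.ext_iff.1 h0).2
      refine ⟨a ::ₘ s₁, s₂, fun c hc => ?_, h₂, by simp⟩
      rcases Multiset.mem_cons.1 hc with rfl | hc
      exacts [irr_inl_iff.1 h, h₁ c hc]

lemma sum_prod (s₁ : Multiset V) (s₂ : Multiset W) :
    (s₁.map (fun a => (a, (0 : W))) + s₂.map (fun b => ((0 : V), b))).sum = (s₁.sum, s₂.sum) := by
  rw [Multiset.sum_add]
  exact (congrArg₂ (· + ·) ((AddMonoidHom.inl V W).map_multiset_sum s₁)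
    ((AddMonoidHom.inr V W).map_multiset_sum s₂)).symm.trans (by simp)

lemma disjoint_prod {s₁ : Multiset V} (h₁ : ∀ a ∈ s₁, Irr a) (s₂ : Multiset W) :
    Disjoint (s₁.map (fun a => (a, (0 : W)))) (s₂.map (fun b => ((0 : V), b))) := by
  rw [Multiset.disjoint_left]
  intro x hx hx'
  obtain ⟨a, ha, rfl⟩ := Multiset.mem_map.1 hx
  obtain ⟨b, -, hb⟩ := Multiset.mem_map.1 hx'
  exact (h₁ a ha).1 (Prod.ext_iff.1 hb).1.symm

lemma irr_of_mem_prod [Subsingleton (AddUnits V)] [Subsingleton (AddUnits W)] {s₁ : Multiset V}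
    {s₂ : Multiset W} (h₁ : ∀ a ∈ s₁, Irr a) (h₂ : ∀ b ∈ s₂, Irr b) :
    ∀ x ∈ s₁.map (fun a => (a, (0 : W))) + s₂.map (fun b => ((0 : V), b)), Irr x := by
  intro x hx
  rcases Multiset.mem_add.1 hx with hx | hx
  · obtain ⟨a, ha, rfl⟩ := Multiset.mem_map.1 hx
    exact irr_inl_iff.2 (h₁ a ha)
  · obtain ⟨b, hb, rfl⟩ := Multiset.mem_map.1 hx
    exact irr_inr_iff.2 (h₂ b hb)

lemma num_prod_iff [Subsingleton (AddUnits V)] [Subsingleton (AddUnits W)] {v : V} {w : W} {l : ℕ} :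
    Num (v, w) l ↔ ∃ k₁ k₂, Num v k₁ ∧ Num w k₂ ∧ k₁ + k₂ = l := by
  have key : ∀ (s₁ : Multiset V) (s₂ : Multiset W), (∀ a ∈ s₁, Irr a) →
      (s₁.map (fun a => (a, (0 : W))) + s₂.map (fun b => ((0 : V), b))).toFinset.card =
        s₁.toFinset.card + s₂.toFinset.card := by
    intro s₁ s₂ h₁
    rw [Multiset.toFinset_add, Finset.card_union_of_disjoint
      (Multiset.disjoint_toFinset.2 (disjoint_prod h₁ s₂)), Multiset.toFinset_map,
      Multiset.toFinset_map, Finset.card_image_of_injective _ (Prod.mk_left_injective 0),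
      Finset.card_image_of_injective _ (Prod.mk_right_injective 0)]
  constructor
  · rintro ⟨s, hs, hv, rfl⟩
    obtain ⟨s₁, s₂, h₁, h₂, rfl⟩ := exists_multiset_prod s hs
    rw [sum_prod] at hv
    exact ⟨_, _, ⟨s₁, h₁, (Prod.ext_iff.1 hv).1, rfl⟩, ⟨s₂, h₂, (Prod.ext_iff.1 hv).2, rfl⟩,
      by convert (key s₁ s₂ h₁).symm⟩
  · rintro ⟨_, _, ⟨s₁, h₁, rfl, rfl⟩, ⟨s₂, h₂, rfl, rfl⟩, rfl⟩
    exact ⟨_, irr_of_mem_prod h₁ h₂, sum_prod s₁ s₂,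
      by convert key s₁ s₂ h₁⟩

lemma bas_prod_iff [Subsingleton (AddUnits V)] [Subsingleton (AddUnits W)] {v : V} {w : W} :
    Bas (v, w) ↔ Bas v ∧ Bas w := by
  constructor
  · rintro ⟨s, hs, hv, hn⟩
    obtain ⟨s₁, s₂, h₁, h₂, rfl⟩ := exists_multiset_prod s hs
    rw [sum_prod] at hv
    obtain ⟨h₃, h₄, -⟩ := Multiset.nodup_add.1 hn
    exact ⟨⟨s₁, h₁, (Prod.ext_iff.1 hv).1, h₃.of_map⟩, ⟨s₂, h₂, (Prod.ext_iff.1 hv).2, h₄.of_map⟩⟩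
  · rintro ⟨⟨s₁, h₁, rfl, h₃⟩, ⟨s₂, h₂, rfl, h₄⟩⟩
    exact ⟨_, irr_of_mem_prod h₁ h₂, sum_prod s₁ s₂, Multiset.nodup_add.2
      ⟨h₃.map (Prod.mk_left_injective 0), h₄.map (Prod.mk_right_injective 0), disjoint_prod h₁ s₂⟩⟩

end
end Decomposition

section IsoClass

variable (R : Type u) [Ring R]

/-- Isomorphism of modules. -/
def isoSetoid : Setoid (ModuleCat.{u} R) where
  r A B := Nonempty (A ≃ₗ[R] B)
  iseqv := ⟨fun _ => ⟨.refl R _⟩, fun ⟨e⟩ => ⟨e.symm⟩, fun ⟨e⟩ ⟨f⟩ => ⟨e.trans f⟩⟩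

/-- The monoid of isomorphism classes of modules under direct sum. -/
def IsoClass : Type (u + 1) := Quotient (isoSetoid R)

/-- The isomorphism class of a module. -/
def cls (M : Type u) [AddCommGroup M] [Module R M] : IsoClass R :=
  Quotient.mk (isoSetoid R) (ModuleCat.of R M)

variable {R} {M N : Type u} [AddCommGroup M] [Module R M] [AddCommGroup N] [Module R N]

lemma cls_eq_iff : cls R M = cls R N ↔ Nonempty (M ≃ₗ[R] N) :=
  Quotient.eq (r := isoSetoid R)

lemma exists_cls (v : IsoClass R) : ∃ A : ModuleCat.{u} R, cls R A = v :=
  Quotient.exists_rep v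

instance : Add (IsoClass R) :=
  ⟨Quotient.map₂ (fun A B => ModuleCat.of R (A × B))
    fun _ _ ⟨e⟩ _ _ ⟨f⟩ => ⟨e.prodCongr f⟩⟩

instance : Zero (IsoClass R) := ⟨cls R PUnit.{u + 1}⟩

lemma cls_prod : cls R (M × N) = cls R M + cls R N := rfl

lemma cls_eq_zero_iff : cls R M = 0 ↔ Subsingleton M :=
  cls_eq_iff.trans ⟨fun ⟨e⟩ => e.toEquiv.subsingleton, fun _ => ⟨⟨0, 0, fun _ => Subsingleton.elim _ _,
    fun _ => Subsingleton.elim _ _⟩⟩⟩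

instance : AddCommMonoid (IsoClass R) where
  add_assoc a b c := by
    obtain ⟨A, rfl⟩ := exists_cls a
    obtain ⟨B, rfl⟩ := exists_cls b
    obtain ⟨C, rfl⟩ := exists_cls c
    exact cls_eq_iff.2 ⟨LinearEquiv.prodAssoc R A B C⟩
  add_comm a b := by
    obtain ⟨A, rfl⟩ := exists_cls a
    obtain ⟨B, rfl⟩ := exists_cls b
    exact cls_eq_iff.2 ⟨LinearEquiv.prodComm R A B⟩
  zero_add a := by
    obtain ⟨A, rfl⟩ := exists_cls a
    exact cls_eq_iff.2 ⟨LinearEquiv.uniqueProd⟩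
  add_zero a := by
    obtain ⟨A, rfl⟩ := exists_cls a
    exact cls_eq_iff.2 ⟨LinearEquiv.prodUnique⟩
  nsmul := nsmulRec

instance : Subsingleton (AddUnits (IsoClass R)) := by
  refine subsingleton_of_forall_eq 0 fun ⟨a, b, h, _⟩ => AddUnits.ext ?_
  obtain ⟨A, rfl⟩ := exists_cls a
  obtain ⟨B, rfl⟩ := exists_cls b
  rw [← cls_prod, cls_eq_zero_iff] at h
  refine cls_eq_zero_iff.2 ⟨fun x y => ?_⟩
  exact (Prod.ext_iff.1 (Subsingleton.elim (x, (0 : B)) (y, 0))).1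

lemma irr_cls_iff : Irr (cls R M) ↔ IsIndec R M := by
  rw [Irr, IsIndec, Ne, cls_eq_zero_iff, not_subsingleton_iff_nontrivial]
  refine and_congr_right fun _ => ⟨fun H N₁ N₂ h => ?_, fun H b c h => ?_⟩
  · refine (H (cls R N₁) (cls R N₂) (cls_eq_iff.2 ⟨(N₁.prodEquivOfIsCompl N₂ h).symm⟩)).imp ?_ ?_ <;>
    · rw [cls_eq_zero_iff]
      exact fun _ => Submodule.eq_bot_of_subsingleton
  · obtain ⟨B, rfl⟩ := exists_cls b
    obtain ⟨C, rfl⟩ := exists_cls c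
    obtain ⟨e⟩ := cls_eq_iff.1 h
    have key := (LinearMap.isCompl_range_inl_inr (R := R) (M := B) (M₂ := C)).map
      (Submodule.orderIsoMapComap e.symm)
    rw [cls_eq_zero_iff, cls_eq_zero_iff]
    refine (H _ _ key).imp (fun h0 => ?_) fun h0 => ?_
    · rw [map_eq_bot_iff, LinearMap.range_eq_bot] at h0
      exact ⟨fun x y => LinearMap.inl_injective (R := R) (M₂ := C) (by simp [h0])⟩
    · rw [map_eq_bot_iff, LinearMap.range_eq_bot] at h0
      exact ⟨fun x y => LinearMap.inr_injective (R := R) (M := B) (by simp [h0])⟩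

lemma cls_pi {n : ℕ} (A : Fin n → Type u) [∀ i, AddCommGroup (A i)] [∀ i, Module R (A i)] :
    cls R (∀ i, A i) = ∑ i, cls R (A i) := by
  induction n with
  | zero => rw [Finset.univ_eq_empty, Finset.sum_empty, cls_eq_zero_iff]; infer_instance
  | succ n ih =>
    rw [Fin.sum_univ_succ, ← ih, ← cls_prod]
    exact cls_eq_iff.2 ⟨(Fin.consLinearEquiv R A).symm⟩

lemma cls_eq_sum {n : ℕ} {N : Fin n → Submodule R M} (h : DirectSum.IsInternal N) :
    cls R M = ∑ i, cls R (N i) := by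
  rw [← cls_pi]
  exact cls_eq_iff.2 ⟨(LinearEquiv.ofBijective (DirectSum.coeLinearMap N) h).symm.trans
    (DirectSum.linearEquivFunOnFintype R (Fin n) fun i => N i)⟩

lemma exists_isInternal {n : ℕ} {a : Fin n → IsoClass R} (h : cls R M = ∑ i, a i) :
    ∃ N : Fin n → Submodule R M, DirectSum.IsInternal N ∧ ∀ i, cls R (N i) = a i := by
  choose A hA using fun i => exists_cls (a i)
  obtain rfl : (fun i => cls R (A i)) = a := funext hA
  rw [← cls_pi] at h
  obtain ⟨e⟩ := cls_eq_iff.1 h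
  let S (i : Fin n) : Submodule R (∀ i, A i) := LinearMap.range (LinearMap.single R (fun i => A i) i)
  refine ⟨fun i => (S i).map e.symm.toLinearMap, ?_, fun i => cls_eq_iff.2 ⟨?_⟩⟩
  · rw [DirectSum.isInternal_submodule_iff_iSupIndep_and_iSup_eq_top]
    constructor
    · refine iSupIndep.map_orderIso (Submodule.orderIsoMapComap e.symm) (a := S) fun i => ?_
      simpa [S] using LinearMap.disjoint_single_single R (fun i => A i) {i} {i}ᶜ
        disjoint_compl_right
    · rw [← Submodule.map_iSup, LinearMap.iSup_range_single, Submodule.map_top]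
      exact e.symm.range
  · exact ((LinearEquiv.ofInjective (LinearMap.single R (fun i => A i) i)
      (LinearMap.ker_eq_bot.1 (LinearMap.ker_single R (fun i => A i) i))).trans (e.symm.submoduleMap (S i))).symm

lemma exists_eq_map_univ {V : Type*} (s : Multiset V) :
    ∃ (n : ℕ) (a : Fin n → V), s = Finset.univ.val.map a := by
  obtain ⟨l, rfl⟩ := Quot.exists_rep s
  exact ⟨l.length, l.get, by rw [Fin.univ_val_map, List.ofFn_get]; rfl⟩

open scoped Classical in
lemma numIndec_iff {k : ℕ} : NumIndec R M k ↔ Num (cls R M) k := by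
  constructor
  · rintro ⟨n, N, hN, hi, c, hc, h⟩
    refine ⟨Finset.univ.val.map fun i => cls R (N i), ?_, (cls_eq_sum hN).symm, ?_⟩
    · simpa [irr_cls_iff] using hi
    · obtain ⟨g, hg⟩ := hc.hasRightInverse
      have : (Finset.univ.val.map fun i => cls R (N i)).toFinset =
          Finset.univ.image fun j => cls R (N (g j)) := by
        ext v
        simp only [Multiset.mem_toFinset, Multiset.mem_map, Finset.mem_val, Finset.mem_univ,
          true_and, Finset.mem_image]
        exact ⟨fun ⟨i, hi⟩ => ⟨c i, by rw [← hi, cls_eq_iff, ← h, hg]⟩, fun ⟨j, hj⟩ => ⟨_, hj⟩⟩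
      rw [this, Finset.card_image_of_injective, Finset.card_univ, Fintype.card_fin]
      intro i j hij
      rwa [cls_eq_iff, ← h, hg, hg] at hij
  · rintro ⟨s, hs, hv, hk⟩
    obtain ⟨n, a, rfl⟩ := exists_eq_map_univ s
    obtain ⟨N, hN, h⟩ := exists_isInternal hv.symm
    have hm (i) : a i ∈ (Finset.univ.val.map a).toFinset := by simp
    refine ⟨n, N, hN, fun i => ?_, fun i => Finset.equivFinOfCardEq hk ⟨a i, hm i⟩, fun j => ?_,
      fun i j => ?_⟩
    · rw [← irr_cls_iff, h]
      exact hs _ (by simp)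
    · obtain ⟨⟨v, hv⟩, rfl⟩ := (Finset.equivFinOfCardEq hk).surjective j
      obtain ⟨i, -, rfl⟩ := Multiset.mem_map.1 (Multiset.mem_toFinset.1 hv)
      exact ⟨i, rfl⟩
    · rw [← cls_eq_iff, h, h, EmbeddingLike.apply_eq_iff_eq, Subtype.mk_eq_mk]

lemma isBasic_iff : IsBasic R M ↔ Bas (cls R M) := by
  constructor
  · rintro ⟨n, N, hN, hi, h⟩
    refine ⟨Finset.univ.val.map fun i => cls R (N i), ?_, (cls_eq_sum hN).symm, ?_⟩
    · simpa [irr_cls_iff] using hi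
    · refine Finset.univ.nodup.map fun i j hij => ?_
      by_contra hne
      exact h i j hne (cls_eq_iff.1 hij)
  · rintro ⟨s, hs, hv, hn⟩
    obtain ⟨n, a, rfl⟩ := exists_eq_map_univ s
    obtain ⟨N, hN, h⟩ := exists_isInternal hv.symm
    refine ⟨n, N, hN, fun i => ?_, fun i j hij h' => hij ?_⟩
    · rw [← irr_cls_iff, h]
      exact hs _ (by simp)
    · rw [← cls_eq_iff, h, h] at h'
      rw [Fin.univ_val_map, Multiset.coe_nodup, List.nodup_ofFn] at hn
      exact hn h'

end IsoClass

section Transfer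

variable {R S T : Type u} [Ring R] [Ring S] [AddCommGroup T] [Module R T] [Module S T]

lemma exists_cls_eq_add {A : Type u} [AddCommGroup A] [Module R A] [Module.Finite R A]
    {v v' : IsoClass R} (h : cls R A = v + v') :
    ∃ B C : ModuleCat.{u} R, Module.Finite R B ∧ Module.Finite R C ∧ v = cls R B ∧ v' = cls R C ∧
      Nonempty (A ≃ₗ[R] B × C) := by
  obtain ⟨B, rfl⟩ := exists_cls v
  obtain ⟨C, rfl⟩ := exists_cls v'
  rw [← cls_prod, cls_eq_iff] at h
  obtain ⟨e⟩ := h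
  exact ⟨B, C, .of_surjective (LinearMap.fst R B C ∘ₗ e.toLinearMap)
    (Prod.fst_surjective.comp e.surjective), .of_surjective (LinearMap.snd R B C ∘ₗ e.toLinearMap)
    (Prod.snd_surjective.comp e.surjective), rfl, rfl, ⟨e⟩⟩

lemma nonempty_equiv_iff_of_dualPair {A B A' B' : Type u} [AddCommGroup A] [Module R A]
    [AddCommGroup B] [Module R B] [AddCommGroup A'] [Module S A'] [AddCommGroup B'] [Module S B']
    (p : DualPair R S T A A') (q : DualPair R S T B B') :
    Nonempty (A ≃ₗ[R] B) ↔ Nonempty (A' ≃ₗ[S] B') := by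
  constructor
  · rintro ⟨e⟩
    obtain ⟨e', -⟩ := DualPair.exists_isTr_equiv p q e
    exact ⟨e'.symm⟩
  · rintro ⟨e⟩
    obtain ⟨e', -⟩ := DualPair.exists_isTr_equiv p.symm q.symm e
    exact ⟨e'.symm⟩

lemma forall_eq_zero_iff_of_dualPair {A B A' B' : Type u} [AddCommGroup A] [Module R A]
    [AddCommGroup B] [Module R B] [AddCommGroup A'] [Module S A'] [AddCommGroup B'] [Module S B']
    (p : DualPair R S T A A') (q : DualPair R S T B B') :
    (∀ f : A →ₗ[R] B, f = 0) ↔ ∀ f : B' →ₗ[S] A', f = 0 := by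
  constructor
  · intro h f
    obtain ⟨g, hg⟩ := DualPair.exists_isTr' p q f
    obtain rfl := h g
    exact hg.unique DualPair.isTr_zero
  · intro h f
    obtain ⟨g, hg⟩ := DualPair.exists_isTr p q f
    obtain rfl := h g
    exact hg.unique' DualPair.isTr_zero

/-- The relation on isomorphism classes of finitely generated modules of being in perfect
pairing. -/
def DualRel (R S T : Type u) [Ring R] [Ring S] [AddCommGroup T] [Module R T] [Module S T]
    (v : IsoClass R) (w : IsoClass S) : Prop :=
  ∃ (A : ModuleCat.{u} R) (A' : ModuleCat.{u} S), v = cls R A ∧ w = cls S A' ∧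
    Module.Finite R A ∧ Module.Finite S A' ∧ Nonempty (DualPair R S T A A')

lemma DualRel.symm {v : IsoClass R} {w : IsoClass S} : DualRel R S T v w → DualRel S R T w v := by
  rintro ⟨A, A', hv, hw, hA, hA', ⟨p⟩⟩
  exact ⟨A', A, hw, hv, hA', hA, ⟨p.symm⟩⟩

lemma IsDuality.exists_dualRel (H : IsDuality R S T) {v v' : IsoClass R} {w : IsoClass S}
    (h : DualRel R S T (v + v') w) : ∃ u u', DualRel R S T v u ∧ DualRel R S T v' u' := by
  obtain ⟨A, A', hv, rfl, hA, hA', ⟨p⟩⟩ := h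
  obtain ⟨B, C, hB, hC, rfl, rfl, -⟩ := exists_cls_eq_add hv.symm
  obtain ⟨B', hB', q⟩ := H.exists_right B
  obtain ⟨C', hC', q'⟩ := H.exists_right C
  exact ⟨_, _, ⟨B, B', rfl, rfl, hB, hB', q⟩, ⟨C, C', rfl, rfl, hC, hC', q'⟩⟩

lemma IsDuality.partialIso (H : IsDuality R S T) : PartialIso (DualRel R S T) where
  eq_iff := by
    rintro _ _ _ _ ⟨A, A', rfl, rfl, hA, hA', ⟨p⟩⟩ ⟨B, B', rfl, rfl, hB, hB', ⟨q⟩⟩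
    rw [cls_eq_iff, cls_eq_iff, nonempty_equiv_iff_of_dualPair p q]
  zero := ⟨.of R PUnit.{u + 1}, .of S PUnit.{u + 1}, rfl, rfl, inferInstanceAs
    (Module.Finite R PUnit.{u + 1}), inferInstanceAs (Module.Finite S PUnit.{u + 1}),
    ⟨DualPair.zero⟩⟩
  add := by
    rintro _ _ _ _ ⟨A, A', rfl, rfl, hA, hA', ⟨p⟩⟩ ⟨B, B', rfl, rfl, hB, hB', ⟨q⟩⟩
    exact ⟨.of R (A × B), .of S (A' × B'), rfl, rfl, inferInstanceAs (Module.Finite R (A × B)),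
      inferInstanceAs (Module.Finite S (A' × B')), ⟨p.prod q⟩⟩
  exists_right := H.exists_dualRel
  exists_left h := by
    obtain ⟨u, u', h₁, h₂⟩ := H.symm.exists_dualRel h.symm
    exact ⟨u, u', h₁.symm, h₂.symm⟩

lemma pres_punit : Pres R (0 : PUnit.{u + 1} →ₗ[R] PUnit.{u + 1}) PUnit.{u + 1} PUnit.{u + 1} :=
  ⟨{ P₁ := PUnit
     P₀ := PUnit
     fin₁ := inferInstance
     fin₀ := inferInstance
     proj₁ := inferInstance
     proj₀ := inferInstance
     d := 0
     p := 0
     surj := fun _ => ⟨0, rfl⟩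
     exact := fun _ => ⟨fun _ => ⟨0, rfl⟩, fun _ => rfl⟩
     min₀ := fun _ _ => Subsingleton.elim _ _
     min₁ := fun _ _ => Subsingleton.elim _ _ },
    ⟨0, 0, fun _ => rfl, fun _ => rfl⟩, LinearEquiv.refl R _, fun _ => rfl⟩

lemma dag_punit : Dag R S T PUnit.{u + 1} PUnit.{u + 1} PUnit.{u + 1} PUnit.{u + 1} := by
  refine ⟨.of R PUnit.{u + 1}, .of R PUnit.{u + 1}, .of S PUnit.{u + 1}, .of S PUnit.{u + 1},
    DualPair.zero, DualPair.zero, 0, 0, ?_, ?_, fun _ _ => rfl, pres_punit, pres_punit⟩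
  · change Module.Finite R PUnit.{u + 1} ∧ Module.Projective R PUnit.{u + 1} ∧
      Module.Finite R PUnit.{u + 1} ∧ Module.Projective R PUnit.{u + 1}
    exact ⟨inferInstance, inferInstance, inferInstance, inferInstance⟩
  · change Module.Finite S PUnit.{u + 1} ∧ Module.Projective S PUnit.{u + 1} ∧
      Module.Finite S PUnit.{u + 1} ∧ Module.Projective S PUnit.{u + 1}
    exact ⟨inferInstance, inferInstance, inferInstance, inferInstance⟩

/-- The relation induced by `Dag` on isomorphism classes of pairs. -/
def DagRel (R S T : Type u) [Ring R] [Ring S] [AddCommGroup T] [Module R T] [Module S T]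
    (v : IsoClass R × IsoClass R) (w : IsoClass S × IsoClass S) : Prop :=
  ∃ (M P : ModuleCat.{u} R) (Z Q : ModuleCat.{u} S), v = (cls R M, cls R P) ∧
    w = (cls S Z, cls S Q) ∧ Dag R S T M P Z Q

lemma DagRel.symm {v : IsoClass R × IsoClass R} {w : IsoClass S × IsoClass S} :
    DagRel R S T v w → DagRel S R T w v := by
  rintro ⟨M, P, Z, Q, hv, hw, h⟩
  exact ⟨Z, Q, M, P, hw, hv, h.symm⟩

lemma IsDuality.isBasic_iff (H : IsDuality R S T) {A A' : Type u} [AddCommGroup A] [Module R A]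
    [AddCommGroup A'] [Module S A'] [Module.Finite R A] [Module.Finite S A']
    (p : DualPair R S T A A') : IsBasic R A ↔ IsBasic S A' := by
  rw [GPTau.isBasic_iff, GPTau.isBasic_iff]
  exact H.partialIso.bas_iff ⟨.of R A, .of S A', rfl, rfl, ‹_›, ‹_›, ⟨p⟩⟩

lemma IsDuality.numIndec_iff (H : IsDuality R S T) {A A' : Type u} [AddCommGroup A] [Module R A]
    [AddCommGroup A'] [Module S A'] [Module.Finite R A] [Module.Finite S A']
    (p : DualPair R S T A A') {k : ℕ} : NumIndec R A k ↔ NumIndec S A' k := by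
  rw [GPTau.numIndec_iff, GPTau.numIndec_iff]
  exact H.partialIso.num_iff ⟨.of R A, .of S A', rfl, rfl, ‹_›, ‹_›, ⟨p⟩⟩

variable [IsArtinianRing R] [IsArtinianRing S]

lemma Dag.nonempty_equiv_iff {M P Z Q M' P' Z' Q' : Type u} [AddCommGroup M] [Module R M]
    [AddCommGroup P] [Module R P] [AddCommGroup Z] [Module S Z] [AddCommGroup Q] [Module S Q]
    [AddCommGroup M'] [Module R M'] [AddCommGroup P'] [Module R P'] [AddCommGroup Z'] [Module S Z']
    [AddCommGroup Q'] [Module S Q'] (h : Dag R S T M P Z Q) (h' : Dag R S T M' P' Z' Q') :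
    Nonempty (M ≃ₗ[R] M') ∧ Nonempty (P ≃ₗ[R] P') ↔
      Nonempty (Z ≃ₗ[S] Z') ∧ Nonempty (Q ≃ₗ[S] Q') :=
  ⟨fun ⟨⟨e⟩, ⟨e'⟩⟩ => h.nonempty_equiv h' e e', fun ⟨⟨e⟩, ⟨e'⟩⟩ =>
    h.symm.nonempty_equiv h'.symm e e'⟩

lemma exists_dagRel (u : DualPair R S T R S) {v v' : IsoClass R × IsoClass R}
    {w : IsoClass S × IsoClass S} (h : DagRel R S T (v + v') w) :
    ∃ u u', DagRel R S T v u ∧ DagRel R S T v' u' := by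
  obtain ⟨v₁, v₂⟩ := v
  obtain ⟨v₁', v₂'⟩ := v'
  obtain ⟨M, P, Z, Q, hv, rfl, h⟩ := h
  obtain ⟨h₁, h₂, h₃⟩ := h.finite
  obtain ⟨hv₁, hv₂⟩ := Prod.ext_iff.1 hv
  obtain ⟨B, C, hB, hC, rfl, rfl, -⟩ := exists_cls_eq_add hv₁.symm
  obtain ⟨B', C', hB', hC', rfl, rfl, ⟨e⟩⟩ := exists_cls_eq_add hv₂.symm
  have : Module.Projective R (B' × C') := .of_equiv e
  have : Module.Projective R B' := .of_split (LinearMap.inl R B' C') (LinearMap.fst R B' C')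
    (LinearMap.fst_comp_inl ..)
  have : Module.Projective R C' := .of_split (LinearMap.inr R B' C') (LinearMap.snd R B' C')
    (LinearMap.snd_comp_inr ..)
  obtain ⟨Z₁, Q₁, k₁⟩ := exists_dag (M := B) (P := B') u
  obtain ⟨Z₂, Q₂, k₂⟩ := exists_dag (M := C) (P := C') u
  exact ⟨_, _, ⟨B, B', Z₁, Q₁, rfl, rfl, k₁⟩, ⟨C, C', Z₂, Q₂, rfl, rfl, k₂⟩⟩

lemma partialIso_dagRel (u : DualPair R S T R S) : PartialIso (DagRel R S T) where
  eq_iff := by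
    rintro _ _ _ _ ⟨M, P, Z, Q, rfl, rfl, h⟩ ⟨M', P', Z', Q', rfl, rfl, h'⟩
    rw [Prod.ext_iff, Prod.ext_iff, cls_eq_iff, cls_eq_iff, cls_eq_iff, cls_eq_iff,
      h.nonempty_equiv_iff h']
  zero := ⟨.of R PUnit.{u + 1}, .of R PUnit.{u + 1}, .of S PUnit.{u + 1}, .of S PUnit.{u + 1},
    rfl, rfl, dag_punit⟩
  add := by
    rintro _ _ _ _ ⟨M, P, Z, Q, rfl, rfl, h⟩ ⟨M', P', Z', Q', rfl, rfl, h'⟩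
    exact ⟨.of R (M × M'), .of R (P × P'), .of S (Z × Z'), .of S (Q × Q'), rfl, rfl, h.prod h'⟩
  exists_right h := exists_dagRel u h
  exists_left h := by
    obtain ⟨u, u', h₁, h₂⟩ := exists_dagRel u.symm h.symm
    exact ⟨u, u', h₁.symm, h₂.symm⟩

section

variable {M P Z Q : Type u} [AddCommGroup M] [Module R M] [AddCommGroup P] [Module R P]
  [AddCommGroup Z] [Module S Z] [AddCommGroup Q] [Module S Q]

lemma Dag.isBasic_iff (u : DualPair R S T R S) (h : Dag R S T M P Z Q) :
    IsBasic R M ∧ IsBasic R P ↔ IsBasic S Z ∧ IsBasic S Q := by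
  rw [GPTau.isBasic_iff, GPTau.isBasic_iff, GPTau.isBasic_iff, GPTau.isBasic_iff,
    ← bas_prod_iff, ← bas_prod_iff]
  exact (partialIso_dagRel u).bas_iff ⟨.of R M, .of R P, .of S Z, .of S Q, rfl, rfl, h⟩

lemma Dag.numIndec_iff (u : DualPair R S T R S) (h : Dag R S T M P Z Q) {l : ℕ} :
    (∃ m p, NumIndec R M m ∧ NumIndec R P p ∧ m + p = l) ↔
      ∃ m p, NumIndec S Z m ∧ NumIndec S Q p ∧ m + p = l := by
  simp only [GPTau.numIndec_iff]
  rw [← num_prod_iff, ← num_prod_iff]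
  exact (partialIso_dagRel u).num_iff ⟨.of R M, .of R P, .of S Z, .of S Q, rfl, rfl, h⟩

end

end Transfer

section KTransfer

variable (R : Type u) [Ring R]

/-- The multiplication pairing of a ring with its opposite. -/
def selfPair : DualPair R Rᵐᵒᵖ R R Rᵐᵒᵖ where
  b r s := r * unop s
  add_left x y z := add_mul x y _
  add_right x y z := mul_add x _ _
  smul_left r x y := mul_assoc r x _
  smul_right s x y := (mul_assoc x _ _).symm
  exists_right φ := ⟨op (φ 1), fun r => by
    rw [unop_op, ← smul_eq_mul, ← map_smul, smul_eq_mul, mul_one]⟩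
  exists_left ψ := ⟨ψ 1, fun s => by
    rw [show ψ s = s • ψ 1 by rw [← map_smul, smul_eq_mul, mul_one]]; rfl⟩
  ext_right s h := unop_injective (by simpa using h 1)
  ext_left r h := by simpa using h 1

variable (K : Type u) [Field K] [Algebra K R] [FiniteDimensional K R]

lemma finiteDimensional_op : FiniteDimensional K Rᵐᵒᵖ := Module.Finite.equiv (opLinearEquiv K)

variable (X : Type u) [AddCommGroup X] [Module R X] [Module K X] [IsScalarTower K R X]

lemma isGI_iff [FiniteDimensional K X] : IsGI R K X ↔ IsGP Rᵐᵒᵖ (LDual R K X) := by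
  have : IsNoetherianRing R := .of_finite K R
  obtain ⟨p⟩ := nonempty_dualPair_lDual R K X
  have H := isDuality_opDual R K
  refine ⟨fun h => ?_, fun h => ?_⟩
  · obtain ⟨C, hC, hX⟩ := h.exists_isStable
    exact H.isGP hC hX p
  · obtain ⟨C, hC, hX⟩ := H.exists_isStable h p
    exact hC.isGI hX

variable {R K X} in
lemma finite_lDual [Module.Finite R X] : Module.Finite Rᵐᵒᵖ (LDual R K X) := by
  have : FiniteDimensional K X := Module.Finite.trans R X
  exact .of_restrictScalars_finite K Rᵐᵒᵖ _

lemma injective_iff_lDual [Module.Finite R X] :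
    Module.Injective R X ↔ Module.Projective Rᵐᵒᵖ (LDual R K X) := by
  have : FiniteDimensional K X := Module.Finite.trans R X
  obtain ⟨p⟩ := nonempty_dualPair_lDual R K X
  have := finite_lDual (R := R) (K := K) (X := X)
  exact ((isDuality_opDual R K).projective_iff p).symm

lemma isBasic_iff_lDual [Module.Finite R X] : IsBasic R X ↔ IsBasic Rᵐᵒᵖ (LDual R K X) := by
  have : FiniteDimensional K X := Module.Finite.trans R X
  obtain ⟨p⟩ := nonempty_dualPair_lDual R K X
  have := finite_lDual (R := R) (K := K) (X := X)
  exact (isDuality_opDual R K).isBasic_iff p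

lemma numIndec_iff_lDual [Module.Finite R X] {k : ℕ} :
    NumIndec R X k ↔ NumIndec Rᵐᵒᵖ (LDual R K X) k := by
  have : FiniteDimensional K X := Module.Finite.trans R X
  obtain ⟨p⟩ := nonempty_dualPair_lDual R K X
  have := finite_lDual (R := R) (K := K) (X := X)
  exact (isDuality_opDual R K).numIndec_iff p

lemma forall_eq_zero_iff_lDual [Module.Finite R X] (Y : Type u) [AddCommGroup Y] [Module R Y]
    [Module K Y] [IsScalarTower K R Y] [Module.Finite R Y] :
    (∀ f : X →ₗ[R] Y, f = 0) ↔ ∀ f : LDual R K Y →ₗ[Rᵐᵒᵖ] LDual R K X, f = 0 := by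
  have : FiniteDimensional K X := Module.Finite.trans R X
  have : FiniteDimensional K Y := Module.Finite.trans R Y
  obtain ⟨p⟩ := nonempty_dualPair_lDual R K X
  obtain ⟨q⟩ := nonempty_dualPair_lDual R K Y
  exact forall_eq_zero_iff_of_dualPair p q

lemma nonempty_equiv_iff_lDual [Module.Finite R X] (Y : Type u) [AddCommGroup Y] [Module R Y]
    [Module K Y] [IsScalarTower K R Y] [Module.Finite R Y] :
    Nonempty (X ≃ₗ[R] Y) ↔ Nonempty (LDual R K X ≃ₗ[Rᵐᵒᵖ] LDual R K Y) := by
  have : FiniteDimensional K X := Module.Finite.trans R X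
  have : FiniteDimensional K Y := Module.Finite.trans R Y
  obtain ⟨p⟩ := nonempty_dualPair_lDual R K X
  obtain ⟨q⟩ := nonempty_dualPair_lDual R K Y
  exact nonempty_equiv_iff_of_dualPair p q

lemma nonempty_lDual_opDual_equiv (Z : Type u) [AddCommGroup Z] [Module Rᵐᵒᵖ Z] [Module K Z]
    [IsScalarTower K Rᵐᵒᵖ Z] [Module.Finite Rᵐᵒᵖ Z] :
    Nonempty (LDual R K (OpDual R K Z) ≃ₗ[Rᵐᵒᵖ] Z) := by
  have := finiteDimensional_op R K
  have : FiniteDimensional K Z := Module.Finite.trans Rᵐᵒᵖ Z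
  obtain ⟨p⟩ := nonempty_dualPair_lDual R K (OpDual R K Z)
  obtain ⟨q⟩ := nonempty_dualPair_opDual R K Z
  exact (nonempty_equiv_iff_of_dualPair p q).1 ⟨.refl R _⟩

end KTransfer

section Pairs

variable {K R : Type u} [Field K] [Ring R] [Algebra K R]

/-- `y` is dual to the dagger of `x`. -/
def DDag (x y : ModPair K R) : Prop :=
  Dag R Rᵐᵒᵖ R x.M x.P (LDual R K y.M) (LDual R K y.P)

variable (K) in
lemma exists_modPair (M P : Type u) [AddCommGroup M] [Module R M] [AddCommGroup P] [Module R P]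
    [Module.Finite R M] [Module.Finite R P] :
    ∃ x : ModPair K R, Nonempty (x.M ≃ₗ[R] M) ∧ Nonempty (x.P ≃ₗ[R] P) := by
  let _ : Module K M := Module.compHom M (algebraMap K R)
  have : IsScalarTower K R M := .of_algebraMap_smul fun _ _ => rfl
  let _ : Module K P := Module.compHom P (algebraMap K R)
  have : IsScalarTower K R P := .of_algebraMap_smul fun _ _ => rfl
  exact ⟨{ M := M, finM := ‹_›, P := P, finP := ‹_› }, ⟨.refl R M⟩, ⟨.refl R P⟩⟩

variable [FiniteDimensional K R] {x y x' y' : ModPair K R}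

lemma DDag.iso_iff (h : DDag x y) (h' : DDag x' y') : x.Iso x' ↔ y.Iso y' := by
  have := finiteDimensional_op R K
  have : IsArtinianRing R := .of_finite K R
  have : IsArtinianRing Rᵐᵒᵖ := .of_finite K Rᵐᵒᵖ
  have := y.finM
  have := y.finP
  have := y'.finM
  have := y'.finP
  rw [ModPair.Iso, ModPair.Iso, Dag.nonempty_equiv_iff h h', nonempty_equiv_iff_lDual R K y.M,
    nonempty_equiv_iff_lDual R K y.P]

lemma DDag.isBasicPair_iff (h : DDag x y) : IsBasicPair K R x ↔ IsBasicPair K R y := by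
  have := finiteDimensional_op R K
  have : IsArtinianRing R := .of_finite K R
  have : IsArtinianRing Rᵐᵒᵖ := .of_finite K Rᵐᵒᵖ
  have := y.finM
  have := y.finP
  rw [IsBasicPair, IsBasicPair, Dag.isBasic_iff (selfPair R) h, isBasic_iff_lDual R K y.M,
    isBasic_iff_lDual R K y.P]

lemma DDag.isTauRigidPair_iff (h : DDag x y) :
    IsTauRigidPair K R x ↔ IsTauInvRigidPair K R y := by
  have := finiteDimensional_op R K
  have : IsArtinianRing R := .of_finite K R
  have : IsArtinianRing Rᵐᵒᵖ := .of_finite K Rᵐᵒᵖ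
  have := y.finM
  have := y.finP
  have : FiniteDimensional K y.M := Module.Finite.trans R y.M
  have hP : Module.Projective R x.P := Dag.finite h |>.2.2
  have hQ : Module.Projective Rᵐᵒᵖ (LDual R K y.P) := Dag.finite h.symm |>.2.2
  rw [IsTauRigidPair, IsTauInvRigidPair, injective_iff_lDual R K y.P, isTauInvRigid_iff,
    forall_eq_zero_iff_lDual R K y.M]
  refine ⟨fun ⟨h₁, _, h₂⟩ => ?_, fun ⟨h₁, _, h₂⟩ => ?_⟩
  · have := Dag.isTauRigid h ⟨h₁, h₂⟩
    exact ⟨this.1, hQ, this.2⟩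
  · have := Dag.isTauRigid h.symm ⟨h₁, h₂⟩
    exact ⟨this.1, hP, this.2⟩

lemma DDag.isGPSuppTauTiltingPair_iff (h : DDag x y) :
    IsGPSuppTauTiltingPair K R x ↔ IsGISuppTauInvTiltingPair K R y := by
  have := finiteDimensional_op R K
  have : IsArtinianRing R := .of_finite K R
  have : IsArtinianRing Rᵐᵒᵖ := .of_finite K Rᵐᵒᵖ
  have := y.finM
  have := y.finP
  have : FiniteDimensional K y.M := Module.Finite.trans R y.M
  have key : (∃ m p l : ℕ, NumIndec R x.M m ∧ NumIndec R x.P p ∧ NumIndec R R l ∧ m + p = l) ↔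
      ∃ m p l : ℕ, NumIndec R y.M m ∧ NumIndec R y.P p ∧ NumIndec R R l ∧ m + p = l := by
    have hl (l : ℕ) := Dag.numIndec_iff (selfPair R) h (l := l)
    simp only [numIndec_iff_lDual R K y.M, numIndec_iff_lDual R K y.P]
    constructor
    · rintro ⟨m, p, l, hm, hp, hR, h⟩
      obtain ⟨m', p', hm', hp', h'⟩ := (hl l).1 ⟨m, p, hm, hp, h⟩
      exact ⟨m', p', l, hm', hp', hR, h'⟩
    · rintro ⟨m, p, l, hm, hp, hR, h⟩
      obtain ⟨m', p', hm', hp', h'⟩ := (hl l).2 ⟨m, p, hm, hp, h⟩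
      exact ⟨m', p', l, hm', hp', hR, h'⟩
  rw [IsGPSuppTauTiltingPair, IsGISuppTauInvTiltingPair, IsSuppTauTiltingPair,
    IsSuppTauInvTiltingPair, h.isTauRigidPair_iff, key, isGI_iff]
  exact and_congr_right fun _ => ⟨Dag.isGP (selfPair R) h, Dag.isGP (selfPair R).symm h.symm⟩

lemma exists_dDag_right (hx : Module.Projective R x.P) : ∃ y, DDag x y := by
  have := finiteDimensional_op R K
  have : IsArtinianRing R := .of_finite K R
  have : IsArtinianRing Rᵐᵒᵖ := .of_finite K Rᵐᵒᵖ
  have := x.finM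
  have := x.finP
  obtain ⟨Z, Q, h⟩ := exists_dag (M := x.M) (P := x.P) (selfPair R)
  have := h.symm.finite.1
  have := h.symm.finite.2.1
  obtain ⟨z, ⟨e⟩, ⟨e'⟩⟩ := exists_modPair K (R := Rᵐᵒᵖ) Z Q
  have := z.finM
  have := z.finP
  have : FiniteDimensional K z.M := Module.Finite.trans Rᵐᵒᵖ z.M
  have : FiniteDimensional K z.P := Module.Finite.trans Rᵐᵒᵖ z.P
  obtain ⟨f⟩ := nonempty_lDual_opDual_equiv R K z.M
  obtain ⟨f'⟩ := nonempty_lDual_opDual_equiv R K z.P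
  exact ⟨{ M := OpDual R K z.M, finM := .of_restrictScalars_finite K R _,
           P := OpDual R K z.P, finP := .of_restrictScalars_finite K R _ },
    h.congr_right (f.trans e).symm (f'.trans e').symm⟩

lemma exists_dDag_left (hy : Module.Injective R y.P) : ∃ x, DDag x y := by
  have := finiteDimensional_op R K
  have : IsArtinianRing R := .of_finite K R
  have : IsArtinianRing Rᵐᵒᵖ := .of_finite K Rᵐᵒᵖ
  have := y.finM
  have := y.finP
  have := finite_lDual (R := R) (K := K) (X := y.M)
  have := finite_lDual (R := R) (K := K) (X := y.P)
  have := (injective_iff_lDual R K y.P).1 hy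
  obtain ⟨M, P, h⟩ := exists_dag (M := LDual R K y.M) (P := LDual R K y.P) (selfPair R).symm
  have := h.symm.finite.1
  have := h.symm.finite.2.1
  obtain ⟨x, ⟨e⟩, ⟨e'⟩⟩ := exists_modPair K (R := R) M P
  exact ⟨x, h.symm.congr_left e.symm e'.symm⟩

end Pairs

section Dagger

variable {R : Type u} [Ring R]

/-- The evaluation pairing of a finitely generated projective module with its dual. -/
lemma exists_dualPair_hom (X : Type u) [AddCommGroup X] [Module R X] [Module.Finite R X]
    [Module.Projective R X] :
    Module.Finite Rᵐᵒᵖ (X →ₗ[R] R) ∧ Module.Projective Rᵐᵒᵖ (X →ₗ[R] R) ∧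
      ∃ p : DualPair R Rᵐᵒᵖ R X (X →ₗ[R] R), ∀ x φ, p.b x φ = φ x := by
  obtain ⟨X', _, _, _, _, ⟨p⟩⟩ := (selfPair R).exists_dual X
  let f : X' →ₗ[Rᵐᵒᵖ] (X →ₗ[R] R) :=
    { toFun := p.left
      map_add' := fun a b => LinearMap.ext fun x => p.add_right x a b
      map_smul' := fun s a => LinearMap.ext fun x => p.smul_right s x a }
  let e : X' ≃ₗ[Rᵐᵒᵖ] (X →ₗ[R] R) := .ofBijective f
    ⟨fun a b h => p.eq_right fun x => LinearMap.congr_fun h x, fun φ => by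
      obtain ⟨a, ha⟩ := p.exists_right φ
      exact ⟨a, LinearMap.ext fun x => ha x⟩⟩
  refine ⟨.equiv e, .of_equiv e, p.congr (.refl R X) e.symm, fun x φ => ?_⟩
  exact LinearMap.congr_fun (e.apply_symm_apply φ) x

lemma MinPres.isSuperfluous_ker_dualMap [IsArtinianRing Rᵐᵒᵖ] {M : Type u} [AddCommGroup M]
    [Module R M] (pr : MinPres R M) (h : NoProjSummand R M) :
    IsSuperfluous Rᵐᵒᵖ (LinearMap.ker pr.dualMap) := by
  have := pr.fin₀
  have := pr.proj₀
  obtain ⟨_, _, q, hq⟩ := exists_dualPair_hom (R := R) pr.P₀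
  obtain ⟨A, P, hAP, hP, hs⟩ := exists_isCompl_superfluous_ker pr.dualMap
  obtain ⟨ε, hε⟩ := DualPair.exists_isTr' q q (P.projection A hAP.symm)
  have hid : ε ∘ₗ ε = ε := (DualPair.IsTr.comp hε hε).unique' <| by
    rwa [show P.projection A hAP.symm ∘ₗ P.projection A hAP.symm = P.projection A hAP.symm from
      Submodule.isIdempotentElem_projection hAP.symm]
  have hd (a : pr.P₁) : ε (pr.d a) = 0 := q.ext_left _ fun φ => by
    rw [hε, hq]
    exact LinearMap.congr_fun (hP (Submodule.projection_apply_mem hAP.symm φ)) a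
  obtain ⟨s, hs'⟩ := exists_factor pr.surj (f := ε) fun x hx => by
    obtain ⟨a, rfl⟩ := (pr.exact x).1 hx
    exact hd a
  have hsp (m : M) : s (pr.p (s m)) = s m := by
    obtain ⟨x, rfl⟩ := pr.surj m
    rw [hs', hs', ← LinearMap.comp_apply, hid]
  have hτ : IsIdempotentElem (pr.p ∘ₗ s) := LinearMap.ext fun m => congrArg pr.p (hsp m)
  have hproj : Module.Projective R (LinearMap.range (pr.p ∘ₗ s)) := by
    refine Module.Projective.of_split (s ∘ₗ (LinearMap.range (pr.p ∘ₗ s)).subtype)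
      ((pr.p ∘ₗ s).rangeRestrict ∘ₗ pr.p) ?_
    ext ⟨_, m, rfl⟩
    simp [hsp]
  have hbot := h _ _ (LinearMap.IsIdempotentElem.isCompl hτ) hproj
  have hs0 (m : M) : s m = 0 := by
    have : (pr.p ∘ₗ s) m = 0 := (Submodule.eq_bot_iff _).1 hbot _ ⟨m, rfl⟩
    rw [← hsp, ← LinearMap.comp_apply pr.p s, this, map_zero]
  have hπ : P.projection A hAP.symm = 0 := hε.unique <| by
    rw [show ε = 0 from LinearMap.ext fun x => by rw [← hs', hs0, LinearMap.zero_apply]]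
    exact DualPair.isTr_zero
  have hA : A = ⊤ := by
    rw [← Submodule.ker_projection hAP.symm, hπ, LinearMap.ker_zero]
  refine (hs.map A.subtype).mono fun φ hφ => ⟨⟨φ, hA ▸ Submodule.mem_top⟩, hφ, rfl⟩

/-- The dagger of a module without projective summands is its transpose. -/
lemma MinPres.dag [IsArtinianRing R] [IsArtinianRing Rᵐᵒᵖ] {M : Type u} [AddCommGroup M]
    [Module R M] (pr : MinPres R M) (h : NoProjSummand R M) :
    Dag R Rᵐᵒᵖ R M PUnit.{u + 1} pr.Tr PUnit.{u + 1} := by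
  have := pr.fin₀
  have := pr.proj₀
  have := pr.fin₁
  have := pr.proj₁
  obtain ⟨h₀, h₀', q, hq⟩ := exists_dualPair_hom (R := R) pr.P₀
  obtain ⟨h₁, h₁', p, hp⟩ := exists_dualPair_hom (R := R) pr.P₁
  have hd : p.IsTr q pr.d pr.dualMap := fun a φ => by rw [hq, hp]; rfl
  have hmin : IsSuperfluous Rᵐᵒᵖ (LinearMap.range pr.dualMap) := hd.isSuperfluous_range <| by
    rw [← pr.exact.linearMap_ker_eq]
    exact pr.min₀
  let π : (pr.P₁ →ₗ[R] R) →ₗ[Rᵐᵒᵖ] pr.Tr := (LinearMap.range pr.dualMap).mkQ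
  have hπ : LinearMap.ker π = LinearMap.range pr.dualMap := Submodule.ker_mkQ _
  refine ⟨.of R pr.P₁, .of R pr.P₀, .of Rᵐᵒᵖ (pr.P₁ →ₗ[R] R), .of Rᵐᵒᵖ (pr.P₀ →ₗ[R] R), p, q,
    pr.d, pr.dualMap, ⟨‹_›, ‹_›, ‹_›, ‹_›⟩, ⟨h₁, h₁', h₀, h₀'⟩, hd,
    ⟨pr, LinearEquiv.prodUnique.symm, .refl R _, fun _ => rfl⟩,
    ⟨⟨pr.P₀ →ₗ[R] R, pr.P₁ →ₗ[R] R, h₀, h₁, h₀', h₁', pr.dualMap, π, Submodule.mkQ_surjective _,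
      LinearMap.exact_iff.2 hπ, hπ ▸ hmin, pr.isSuperfluous_ker_dualMap h⟩,
      LinearEquiv.prodUnique.symm, .refl Rᵐᵒᵖ _, fun _ => rfl⟩⟩

/-- The dagger of a projective module is a shifted projective module. -/
lemma DualPair.dag {S T : Type u} [Ring S] [AddCommGroup T] [Module R T] [Module S T]
    {M Q : Type u} [AddCommGroup M] [Module R M] [AddCommGroup Q] [Module S Q]
    [hM : Module.Finite R M] [hM' : Module.Projective R M] [hQ : Module.Finite S Q]
    [hQ' : Module.Projective S Q] (p : DualPair R S T M Q) :
    Dag R S T M PUnit.{u + 1} PUnit.{u + 1} Q := by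
  refine ⟨.of R PUnit.{u + 1}, .of R M, .of S PUnit.{u + 1}, .of S Q, DualPair.zero, p, 0, 0,
    ⟨inferInstanceAs (Module.Finite R PUnit.{u + 1}),
      inferInstanceAs (Module.Projective R PUnit.{u + 1}), hM, hM'⟩,
    ⟨inferInstanceAs (Module.Finite S PUnit.{u + 1}),
      inferInstanceAs (Module.Projective S PUnit.{u + 1}), hQ, hQ'⟩, DualPair.isTr_zero,
    ⟨{ P₁ := PUnit
       P₀ := M
       fin₁ := inferInstance
       fin₀ := hM
       proj₁ := inferInstance
       proj₀ := hM'
       d := 0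
       p := LinearMap.id
       surj := surjective_id
       exact := fun x => ⟨fun h => ⟨0, h.symm⟩, by rintro ⟨_, rfl⟩; rfl⟩
       min₀ := by rw [LinearMap.ker_id]; exact isSuperfluous_bot
       min₁ := fun _ _ => Subsingleton.elim _ _ },
      LinearEquiv.prodUnique.symm, .refl R M, fun _ => rfl⟩,
    ⟨{ P₁ := PUnit
       P₀ := PUnit
       fin₁ := inferInstance
       fin₀ := inferInstance
       proj₁ := inferInstance
       proj₀ := inferInstance
       d := 0
       p := 0
       surj := fun _ => ⟨0, rfl⟩
       exact := fun _ => ⟨fun _ => ⟨0, rfl⟩, fun _ => rfl⟩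
       min₀ := fun _ _ => Subsingleton.elim _ _
       min₁ := fun _ _ => Subsingleton.elim _ _ },
      LinearEquiv.uniqueProd.symm, .refl S _, fun _ => rfl⟩⟩

variable {K : Type u} [Field K] [Algebra K R] [FiniteDimensional K R]

lemma IsDaggerOf.dag {x : ModPair K R} {z : ModPair K Rᵐᵒᵖ} (h : IsDaggerOf K R x z)
    (hx : Module.Projective R x.P) : Dag R Rᵐᵒᵖ R x.M x.P z.M z.P := by
  have := finiteDimensional_op R K
  have : IsArtinianRing R := .of_finite K R
  have : IsArtinianRing Rᵐᵒᵖ := .of_finite K Rᵐᵒᵖ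
  have := x.finM
  have := x.finP
  obtain ⟨Mp, Mnp, hM, hMp, hMnp, pr, ⟨e⟩, ⟨e'⟩⟩ := h
  obtain ⟨_, _, p, -⟩ := exists_dualPair_hom (R := R) Mp
  obtain ⟨_, _, q, -⟩ := exists_dualPair_hom (R := R) x.P
  have key := (p.dag.prod ((pr.dag hMnp).prod q.symm.dag.symm))
  refine (key.congr_left ?_ ?_).congr_right ?_ ?_
  · exact ((LinearEquiv.refl R Mp).prodCongr LinearEquiv.prodUnique).trans
      (Submodule.prodEquivOfIsCompl Mp Mnp hM)
  · exact LinearEquiv.uniqueProd.trans LinearEquiv.uniqueProd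
  · exact LinearEquiv.uniqueProd.trans e.symm
  · exact (((LinearEquiv.refl _ _).prodCongr LinearEquiv.prodUnique).trans
      LinearEquiv.prodUnique).trans e'.symm

lemma IsDDaggerOf.dDag {x y : ModPair K R} (h : IsDDaggerOf K R x y)
    (hx : Module.Projective R x.P) : DDag x y := by
  obtain ⟨z, hz, e, e'⟩ := h
  have := finiteDimensional_op R K
  have := y.finM
  have := y.finP
  have := z.finM
  have := z.finP
  have : FiniteDimensional K z.M := Module.Finite.trans Rᵐᵒᵖ z.M
  have : FiniteDimensional K z.P := Module.Finite.trans Rᵐᵒᵖ z.P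
  have : Module.Finite R (OpDual R K z.M) := .of_restrictScalars_finite K R _
  have : Module.Finite R (OpDual R K z.P) := .of_restrictScalars_finite K R _
  obtain ⟨f⟩ := nonempty_lDual_opDual_equiv R K z.M
  obtain ⟨f'⟩ := nonempty_lDual_opDual_equiv R K z.P
  obtain ⟨g⟩ := (nonempty_equiv_iff_lDual R K _ _).1 e
  obtain ⟨g'⟩ := (nonempty_equiv_iff_lDual R K _ _).1 e'
  exact (hz.dag hx).congr_right (g.trans f).symm (g'.trans f').symm

end Dagger

/-- A relation which is total on both sides and compatible with two equivalence relations induces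
a bijection between the quotients. -/
lemma exists_quotient_equiv {α β : Type*} (s : Setoid α) (t : Setoid β) (T : α → β → Prop)
    (hl : ∀ x, ∃ y, T x y) (hr : ∀ y, ∃ x, T x y)
    (h : ∀ x y x' y', T x y → T x' y' → (s x x' ↔ t y y')) :
    ∃ e : Quotient s ≃ Quotient t, ∀ x y, T x y → e (Quotient.mk s x) = Quotient.mk t y := by
  choose f hf using hl
  choose g hg using hr
  refine ⟨⟨Quotient.map f fun x x' hx => (h _ _ _ _ (hf x) (hf x')).1 hx,
    Quotient.map g fun y y' hy => (h _ _ _ _ (hg y) (hg y')).2 hy, ?_, ?_⟩, fun x y hxy =>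
      Quotient.sound ((h _ _ _ _ (hf x) hxy).1 (s.refl x))⟩
  · rintro ⟨x⟩
    exact Quotient.sound ((h _ _ _ _ (hg (f x)) (hf x)).2 (t.refl _))
  · rintro ⟨y⟩
    exact Quotient.sound ((h _ _ _ _ (hf (g y)) (hg y)).1 (s.refl _))

/-- The assignment `(M,P) ↦ D((M,P)†)` is a bijection between
the isomorphism classes of basic Gorenstein projective support τ-tilting pairs
in `mod Λ` and the isomorphism classes of basic Gorenstein injective support
τ⁻¹-tilting pairs in `mod Λ`. -/
theorem gp_supp_tau_tilting_Ddagger_bijection (K R : Type u) [Field K] [Ring R]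
    [Algebra K R] [FiniteDimensional K R] :
    ∃ e : Quotient (pairSetoid K R fun x => IsBasicPair K R x ∧
          IsGPSuppTauTiltingPair K R x) ≃
        Quotient (pairSetoid K R fun y => IsBasicPair K R y ∧
          IsGISuppTauInvTiltingPair K R y),
      ∀ (x : {x : ModPair K R // IsBasicPair K R x ∧ IsGPSuppTauTiltingPair K R x})
        (y : {y : ModPair K R // IsBasicPair K R y ∧ IsGISuppTauInvTiltingPair K R y}),
        IsDDaggerOf K R x.1 y.1 → e (Quotient.mk _ x) = Quotient.mk _ y := by
  obtain ⟨e, he⟩ := exists_quotient_equiv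
    (pairSetoid K R fun x => IsBasicPair K R x ∧ IsGPSuppTauTiltingPair K R x)
    (pairSetoid K R fun y => IsBasicPair K R y ∧ IsGISuppTauInvTiltingPair K R y)
    (fun x y => DDag x.1 y.1)
    (fun x => by
      obtain ⟨y, h⟩ := exists_dDag_right x.2.2.1.1.2.1
      exact ⟨⟨y, h.isBasicPair_iff.1 x.2.1, h.isGPSuppTauTiltingPair_iff.1 x.2.2⟩, h⟩)
    (fun y => by
      obtain ⟨x, h⟩ := exists_dDag_left y.2.2.1.1.2.1
      exact ⟨⟨x, h.isBasicPair_iff.2 y.2.1, h.isGPSuppTauTiltingPair_iff.2 y.2.2⟩, h⟩)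
    (fun x y x' y' h h' => h.iso_iff h')
  exact ⟨e, fun x y h => he x y (h.dDag x.2.2.1.1.2.1)⟩

end GPTau
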